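/- arXiv:1301.4853 — 2 statements merged into one kernel-verified Lean document; each statement's English description precedes it below -/
import Mathlib

section
/- For every ε > 0 there exists a constant c > 0 such that the following holds: for every prime p and every finite set P of points in the plane F_p² with |P| < p, at least one of the following occurs: (1) there is a line l in F_p² with |P ∩ l| ≥ c·|P|^(1−ε); or (2) |L(P)| ≥ c·|P|^(1 + 1/133 − ε), where L(P) is the set of lines containing at least two points of P. -/
/-- A line in the plane `F²`: the zero set of a nontrivial linear equation. -/
def IsLine {F : Type*} [CommRing F] (l : Set (F × F)) : Prop :=
  ∃ a b c : F, (a, b) ≠ ((0 : F), (0 : F)) ∧ l = {p : F × F | a * p.1 + b * p.2 + c = 0}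

/-- `L(P)`: the set of lines containing at least two distinct points of `P`. -/
def linesOf {F : Type*} [CommRing F] (P : Finset (F × F)) : Set (Set (F × F)) :=
  {l | IsLine l ∧ ∃ x ∈ P, ∃ y ∈ P, x ≠ y ∧ x ∈ l ∧ y ∈ l}


open Polynomial in
/-- division with weighted degree control -/
lemma redei_div {F : Type*} [Field F] (R : F[X][X]) (d : ℕ) (hd : R.natDegree = d) (hm : R.Monic)
    (hpos : 0 < d)
    (hw : ∀ i, R.coeff i ≠ 0 → (R.coeff i).natDegree + i ≤ d) (m : ℕ) :
    ∃ q r : F[X][X], X ^ m = R * q + r ∧ (∀ i, d ≤ i → r.coeff i = 0) ∧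
      ∀ i, r.coeff i ≠ 0 → (r.coeff i).natDegree + i ≤ m := by
  induction m with
  | zero =>
    refine ⟨0, 1, by simp, ?_, ?_⟩
    · intro i hi
      rw [coeff_one, if_neg (by omega)]
    · intro i hi
      rw [coeff_one] at hi ⊢
      split_ifs at hi ⊢ with h
      · simp [h]
      · simp at hi
  | succ m ih =>
    obtain ⟨q, r, h1, h2, h3⟩ := ih
    have hRd : R.coeff d = 1 := by rw [← hd]; exact hm
    have hRlarge : ∀ i, d < i → R.coeff i = 0 := fun i hi =>
      coeff_eq_zero_of_natDegree_lt (by omega)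
    refine ⟨X * q + C (r.coeff (d-1)), X * r - C (r.coeff (d-1)) * R, ?_, ?_, ?_⟩
    · rw [pow_succ, h1]; ring
    · intro i hi
      obtain ⟨j, rfl⟩ : ∃ j, i = j + 1 := ⟨i - 1, by omega⟩
      rw [coeff_sub, coeff_X_mul, coeff_C_mul]
      rcases hi.eq_or_lt with h | h
      · have : d - 1 = j := by omega
        rw [← h, hRd, this]; simp
      · rw [hRlarge _ h, h2 j (by omega)]; simp
    · intro i hi
      have key : ∀ a b : F[X], ∀ k : ℕ, (a ≠ 0 → a.natDegree + i ≤ k) → (b ≠ 0 → b.natDegree + i ≤ k) →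
          a - b ≠ 0 → (a - b).natDegree + i ≤ k := by
        intro a b k ha hb hab
        by_cases ha0 : a = 0
        · subst ha0
          have : b ≠ 0 := by rintro rfl; simp at hab
          simpa using hb this
        by_cases hb0 : b = 0
        · subst hb0; simpa using ha ha0
        have := natDegree_sub_le a b
        have := ha ha0
        have := hb hb0
        omega
      rw [coeff_sub] at hi ⊢
      refine key _ _ (m+1) ?_ ?_ hi
      · intro h
        cases i with
        | zero => simp at h
        | succ i =>
          rw [coeff_X_mul] at h ⊢
          have := h3 i h
          omega
      · intro h
        rw [coeff_C_mul] at h ⊢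
        have ha := left_ne_zero_of_mul h
        have hb := right_ne_zero_of_mul h
        have := h3 _ ha
        have := hw _ hb
        have := natDegree_mul_le (p := r.coeff (d-1)) (q := R.coeff i)
        omega

open Polynomial in
lemma redei_wt {F : Type*} [Field F] (S : Finset (F × F)) :
    ∀ i, (∏ s ∈ S, (X - C (C s.2 + C s.1 * X) : F[X][X])).coeff i ≠ 0 →
      ((∏ s ∈ S, (X - C (C s.2 + C s.1 * X) : F[X][X])).coeff i).natDegree + i ≤ S.card := by
  classical
  induction S using Finset.induction_on with
  | empty =>
    intro i hi
    simp only [Finset.prod_empty, coeff_one] at hi ⊢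
    split_ifs at hi ⊢ with h
    · simp [h]
    · simp at hi
  | insert s S hs ih =>
    intro i hi
    rw [Finset.prod_insert hs, Finset.card_insert_of_notMem hs] at *
    set f := ∏ s ∈ S, (X - C (C s.2 + C s.1 * X) : F[X][X])
    rw [sub_mul, coeff_sub, coeff_C_mul] at hi ⊢
    have hl : (C s.2 + C s.1 * X : F[X]).natDegree ≤ 1 := by
      rw [add_comm]; exact natDegree_linear_le
    have h1 : (X * f).coeff i ≠ 0 → ((X * f).coeff i).natDegree + i ≤ S.card + 1 := by
      intro h
      cases i with
      | zero => simp at h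
      | succ i =>
        rw [coeff_X_mul] at h ⊢
        have := ih i h
        omega
    have h2 : (C s.2 + C s.1 * X) * f.coeff i ≠ 0 →
        ((C s.2 + C s.1 * X) * f.coeff i).natDegree + i ≤ S.card + 1 := by
      intro h
      have := ih i (right_ne_zero_of_mul h)
      have := natDegree_mul_le (p := (C s.2 + C s.1 * X)) (q := f.coeff i)
      omega
    by_cases ha0 : (X * f).coeff i = 0
    · rw [ha0] at hi ⊢
      have : (C s.2 + C s.1 * X) * f.coeff i ≠ 0 := by rintro h; simp [h] at hi
      have := h2 this
      simpa using this
    by_cases hb0 : (C s.2 + C s.1 * X) * f.coeff i = 0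
    · rw [hb0]; simpa using h1 ha0
    have := natDegree_sub_le ((X * f).coeff i) ((C s.2 + C s.1 * X) * f.coeff i)
    have := h1 ha0
    have := h2 hb0
    omega

open Polynomial in
lemma redei (p : ℕ) [Fact p.Prime] (A : Finset (ZMod p)) (hA : 2 ≤ A.card)
    (h : A.card * A.card ≤ p) (D : Finset (ZMod p))
    (hD : ∀ a ∈ A, ∀ a' ∈ A, ∀ b ∈ A, ∀ b' ∈ A, a ≠ a' → (b - b') / (a - a') ∈ D) :
    A.card * (A.card - 1) ≤ D.card := by
  classical
  set R : (ZMod p)[X][X] := ∏ s ∈ A ×ˢ A, (X - C (C s.2 + C s.1 * X)) with hR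
  set d := A.card * A.card with hd
  have hmon : R.Monic := monic_prod_X_sub_C _ _
  have hdeg : R.natDegree = d := by
    rw [hR, natDegree_finsetProd_X_sub_C_eq_card, Finset.card_product]
  have hd4 : 4 ≤ d := Nat.mul_le_mul hA hA
  obtain ⟨q, r, h1, h2, h3⟩ := redei_div R d hdeg hmon (by omega)
    (by have := redei_wt (A ×ˢ A); rw [Finset.card_product] at this; exact this) p
  -- evaluation at a non-direction
  have hev : ∀ y : ZMod p, y ∉ D → ∀ i, i ≠ 1 → (r.coeff i).eval y = 0 := by
    intro y hy i hi
    have e1 := congrArg (Polynomial.map (evalRingHom y)) h1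
    simp only [Polynomial.map_pow, map_X, Polynomial.map_add, Polynomial.map_mul] at e1
    have eR : R.map (evalRingHom y) = ∏ s ∈ A ×ˢ A, (X - C (s.2 + s.1 * y)) := by
      rw [hR, Polynomial.map_prod]
      refine Finset.prod_congr rfl fun s _ => ?_
      simp
    have hinj : Set.InjOn (fun s : ZMod p × ZMod p => s.2 + s.1 * y) (A ×ˢ A : Finset _) := by
      rintro ⟨a, b⟩ hs ⟨a', b'⟩ hs' heq
      simp only [Finset.coe_product, Set.mem_prod, Finset.mem_coe] at hs hs'
      simp only at heq
      by_cases haa : a = a'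
      · subst haa; simp at heq; simp [heq]
      · exfalso; apply hy
        have := hD a' hs'.1 a hs.1 b hs.2 b' hs'.2 (Ne.symm haa)
        have hne : a' - a ≠ 0 := sub_ne_zero.2 (Ne.symm haa)
        have hh : (b - b') / (a' - a) = y := by
          rw [div_eq_iff hne]; linear_combination heq
        rwa [hh] at this
    have hdvd : R.map (evalRingHom y) ∣ X ^ p - X := by
      rw [eR]
      refine Finset.prod_dvd_of_coprime ?_ ?_
      · intro s hs t ht hst
        exact pairwise_coprime_X_sub_C Function.injective_id (fun h => hst (hinj hs ht h))
      · intro s _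
        rw [dvd_iff_isRoot, IsRoot]
        simp only [eval_sub, eval_pow, eval_X, ZMod.pow_card, sub_self]
    have hdvd2 : R.map (evalRingHom y) ∣ r.map (evalRingHom y) - X := by
      have : r.map (evalRingHom y) - X = (X ^ p - X) - R.map (evalRingHom y) * q.map (evalRingHom y) := by
        rw [e1]; ring
      rw [this]
      exact dvd_sub hdvd (dvd_mul_right _ _)
    have hz : r.map (evalRingHom y) - X = 0 := by
      by_contra hne
      have := natDegree_le_of_dvd hdvd2 hne
      rw [hmon.natDegree_map, hdeg] at this
      have h5 : (r.map (evalRingHom y) - X).natDegree ≤ d - 1 := by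
        rw [natDegree_le_iff_coeff_eq_zero]
        intro N hN
        rw [coeff_sub, coeff_map, h2 N (by omega), coeff_X, if_neg (by omega)]
        simp
      omega
    have := congrArg (fun f => coeff f i) hz
    simp only [coeff_sub, coeff_map, coeff_zero, coe_evalRingHom, coeff_X, if_neg hi.symm, sub_zero] at this
    exact this
  obtain ⟨b1, hb1, b2, hb2, hb12⟩ := Finset.one_lt_card.1 (show 1 < A.card by omega)
  have hD0 : 0 < D.card := Finset.card_pos.2 ⟨_, hD b1 hb1 b2 hb2 b1 hb1 b2 hb2 hb12⟩
  have hDp : D.card ≤ p := by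
    have := Finset.card_le_univ D
    rwa [ZMod.card] at this
  have hlac : ∀ i, D.card < i → r.coeff i = 0 := by
    intro i hi
    by_contra hne
    have hle := h3 i hne
    have hc : (Finset.univ \ D).card = p - D.card := by
      rw [Finset.card_sdiff_of_subset (Finset.subset_univ _), Finset.card_univ, ZMod.card]
    have := Polynomial.card_le_degree_of_subset_roots (p := r.coeff i) (Z := Finset.univ \ D) (by
      intro y hy
      rw [mem_roots hne, IsRoot]
      have hy' : y ∈ Finset.univ \ D := hy
      exact hev y (by simpa using hy') i (by omega))
    omega
  set r0 := r.map (evalRingHom (0 : ZMod p)) with hr0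
  have e0 : X ^ p = R.map (evalRingHom (0 : ZMod p)) * q.map (evalRingHom (0 : ZMod p)) + r0 := by
    have e1 := congrArg (Polynomial.map (evalRingHom (0 : ZMod p))) h1
    simpa only [Polynomial.map_pow, map_X, Polynomial.map_add, Polynomial.map_mul] using e1
  have eR0 : R.map (evalRingHom (0 : ZMod p)) = ∏ b ∈ A, (X - C b) ^ A.card := by
    rw [hR, Polynomial.map_prod, Finset.prod_product_right]
    refine Finset.prod_congr rfl fun b _ => ?_
    simp
  have hdvdb : ∀ b ∈ A, (X - C b) ^ A.card ∣ X ^ p - r0 := by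
    intro b hb
    have : X ^ p - r0 = R.map (evalRingHom (0 : ZMod p)) * q.map (evalRingHom (0 : ZMod p)) := by
      rw [e0]; ring
    rw [this, eR0]
    exact Dvd.dvd.mul_right (Finset.dvd_prod_of_mem _ hb) _
  have hr0d : r0.natDegree ≤ D.card := by
    rw [natDegree_le_iff_coeff_eq_zero]
    intro N hN
    rw [hr0, coeff_map, hlac N hN]; simp
  have hr0d' : r0.natDegree ≤ d - 1 := by
    rw [natDegree_le_iff_coeff_eq_zero]
    intro N hN
    rw [hr0, coeff_map, h2 N (by omega)]; simp
  have hder : ∀ b ∈ A, (X - C b) ^ (A.card - 1) ∣ derivative r0 := by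
    intro b hb
    have := pow_sub_one_dvd_derivative_of_pow_dvd (hdvdb b hb)
    have e : derivative (X ^ p - r0) = - derivative r0 := by
      rw [derivative_sub, derivative_X_pow, CharP.cast_eq_zero]; simp
    rw [e] at this
    exact (dvd_neg).1 this
  have hprod : ∏ b ∈ A, (X - C b) ^ (A.card - 1) ∣ derivative r0 := by
    refine Finset.prod_dvd_of_coprime ?_ hder
    intro a _ b _ hab
    exact (pairwise_coprime_X_sub_C Function.injective_id hab).pow
  by_cases hz : derivative r0 = 0
  · exfalso
    have hc : r0.natDegree = 0 := by
      by_contra hne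
      have := congrArg (fun f => coeff f (r0.natDegree - 1)) hz
      simp only [coeff_derivative, coeff_zero] at this
      have e : r0.natDegree - 1 + 1 = r0.natDegree := by omega
      rw [e] at this
      have e2 : ((r0.natDegree - 1 : ℕ) : ZMod p) + 1 = (r0.natDegree : ℕ) := by
        rw [← e]; push_cast; simp
      rw [e2] at this
      rcases mul_eq_zero.1 this with h | h
      · rw [coeff_natDegree, leadingCoeff_eq_zero] at h
        rw [h] at hne; simp at hne
      · rw [ZMod.natCast_eq_zero_iff] at h
        have := Nat.le_of_dvd (by omega) h
        omega
    rw [natDegree_eq_zero] at hc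
    obtain ⟨c, hc⟩ := hc
    have hroot : ∀ b ∈ A, b = c := by
      intro b hb
      have h1 : (X - C b) ∣ X ^ p - r0 := (dvd_pow_self _ (by omega)).trans (hdvdb b hb)
      rw [dvd_iff_isRoot, IsRoot, ← hc] at h1
      simp [ZMod.pow_card] at h1
      exact sub_eq_zero.1 h1
    exact hb12 ((hroot b1 hb1).trans (hroot b2 hb2).symm)
  · have h6 := natDegree_le_of_dvd hprod hz
    have h7 : (∏ b ∈ A, (X - C b : (ZMod p)[X]) ^ (A.card - 1)).natDegree = A.card * (A.card - 1) := by
      rw [natDegree_prod_of_monic _ _ (fun b _ => (monic_X_sub_C b).pow _)]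
      simp
    have := natDegree_derivative_le r0
    omega

lemma card_sq_le_image {α β : Type*} [DecidableEq α] [DecidableEq β] (S : Finset α) (f : α → β) :
    S.card ^ 2 ≤ (S.image f).card * ((S ×ˢ S).filter (fun x => f x.1 = f x.2)).card := by
  have h1 : S.card = ∑ b ∈ S.image f, (S.filter (fun a => f a = b)).card :=
    Finset.card_eq_sum_card_fiberwise (fun x hx => Finset.mem_image_of_mem f hx)
  have h2 : ((S ×ˢ S).filter (fun x => f x.1 = f x.2)).card =
      ∑ b ∈ S.image f, (S.filter (fun a => f a = b)).card ^ 2 := by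
    rw [Finset.card_eq_sum_card_fiberwise (f := fun x => f x.1) (t := S.image f)]
    · refine Finset.sum_congr rfl fun b _ => ?_
      rw [sq, ← Finset.card_product]
      congr 1
      ext ⟨x, y⟩
      simp only [Finset.mem_filter, Finset.mem_product]
      constructor
      · rintro ⟨⟨⟨h1, h2⟩, h3⟩, h4⟩
        exact ⟨⟨h1, h4⟩, h2, h3 ▸ h4⟩
      · rintro ⟨⟨h1, h4⟩, h2, h3⟩
        exact ⟨⟨⟨h1, h2⟩, h4.trans h3.symm⟩, h4⟩
    · intro x hx
      simp only [Finset.coe_filter, Finset.mem_product, Set.mem_ofPred_eq] at hx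
      exact Finset.mem_image_of_mem f hx.1.1
  rw [h2]
  conv_lhs => rw [h1]
  exact sq_sum_le_card_mul_sum_sq

open Pointwise in
lemma core_sumset {F : Type*} [Field F] [DecidableEq F] (Y U0 C1 C2 C3 C4 : Finset F)
    (l1 l2 l3 l4 : F) (w1 w2 w3 w4 : F) (h2 : l2 ≠ 0) (h4 : l4 ≠ 0)
    (hC1 : C1 ⊆ U0) (hC2 : C2 ⊆ U0) (hC3 : C3 ⊆ U0) (hC4 : C4 ⊆ U0)
    (hw1 : ∀ c ∈ C1, w1 - l1 * c ∈ Y) (hw2 : ∀ c ∈ C2, w2 - l2 * c ∈ Y)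
    (hw3 : ∀ c ∈ C3, w3 - l3 * c ∈ Y) (hw4 : ∀ c ∈ C4, w4 - l4 * c ∈ Y) :
    ((C1 ×ˢ C3).image (fun x => (l1 - l2) * x.1 + (l3 - l4) * x.2)).card * (C2.card * C4.card) ≤
      (U0 - U0).card ^ 2 * (2 • Y - 2 • Y).card := by
  set S := (C1 ×ˢ C3).image (fun x => (l1 - l2) * x.1 + (l3 - l4) * x.2) with hS
  set X := C1.image (fun x => l1 * x) + C3.image (fun x => l3 * x) with hX
  set A1 := C1.image (fun x => l2 * x)
  set A2 := C2.image (fun x => l2 * x)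
  set A3 := C3.image (fun x => l4 * x)
  set A4 := C4.image (fun x => l4 * x)
  have cA2 : A2.card = C2.card := Finset.card_image_of_injective _ (mul_right_injective₀ h2)
  have cA4 : A4.card = C4.card := Finset.card_image_of_injective _ (mul_right_injective₀ h4)
  have hsub : S ⊆ (X - A3) - A1 := by
    intro z hz
    simp only [hS, Finset.mem_image, Finset.mem_product] at hz
    obtain ⟨⟨c, d⟩, ⟨hc, hd⟩, rfl⟩ := hz
    have : (l1 - l2) * c + (l3 - l4) * d = (l1 * c + l3 * d) - l4 * d - l2 * c := by ring
    simp only [this]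
    exact Finset.sub_mem_sub (Finset.sub_mem_sub (Finset.add_mem_add
      (Finset.mem_image_of_mem _ hc) (Finset.mem_image_of_mem _ hd)) (Finset.mem_image_of_mem _ hd))
      (Finset.mem_image_of_mem _ hc)
  have hdil : ∀ (l : F) (C D : Finset F), C ⊆ U0 → D ⊆ U0 →
      (C.image (fun x => l * x) - D.image (fun x => l * x)).card ≤ (U0 - U0).card := by
    intro l C D hC hD
    calc _ ≤ ((U0 - U0).image (fun x => l * x)).card := by
          apply Finset.card_le_card
          intro z hz
          rw [Finset.mem_sub] at hz
          obtain ⟨x, hx, y, hy, rfl⟩ := hz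
          rw [Finset.mem_image] at hx hy ⊢
          obtain ⟨x, hx, rfl⟩ := hx
          obtain ⟨y, hy, rfl⟩ := hy
          exact ⟨x - y, Finset.sub_mem_sub (hC hx) (hD hy), by ring⟩
      _ ≤ _ := Finset.card_image_le
  have t1 := Finset.ruzsa_triangle_inequality_sub_sub_sub (X - A3) A2 A1
  have t2 := Finset.ruzsa_triangle_inequality_sub_sub_sub (X - A2) A4 A3
  have e1 : X - A3 - A2 = X - A2 - A3 := sub_right_comm _ _ _
  have t3 : (X - A2 - A4).card ≤ (2 • Y - 2 • Y).card := by
    calc _ ≤ ((2 • Y - 2 • Y).image (fun x => (w1 + w3 - w2 - w4) + x)).card := by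
          apply Finset.card_le_card
          intro z hz
          simp only [Finset.mem_sub, hX, Finset.mem_add, A2, A4, Finset.mem_image] at hz
          obtain ⟨_, ⟨_, ⟨_, ⟨a, ha, rfl⟩, _, ⟨c, hc, rfl⟩, rfl⟩, _, ⟨b, hb, rfl⟩, rfl⟩, _, ⟨d, hd, rfl⟩, rfl⟩ := hz
          rw [Finset.mem_image]
          refine ⟨((w2 - l2 * b) + (w4 - l4 * d)) - ((w1 - l1 * a) + (w3 - l3 * c)), ?_, by ring⟩
          rw [two_nsmul]
          exact Finset.sub_mem_sub (Finset.add_mem_add (hw2 _ hb) (hw4 _ hd))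
            (Finset.add_mem_add (hw1 _ ha) (hw3 _ hc))
      _ ≤ _ := Finset.card_image_le
  have d1 := hdil l2 C1 C2 hC1 hC2
  have d2 := hdil l4 C3 C4 hC3 hC4
  have hcs := Finset.card_le_card hsub
  rw [cA2, e1] at t1
  rw [cA4] at t2
  calc S.card * (C2.card * C4.card) ≤ (X - A3 - A1).card * (C2.card * C4.card) := by gcongr
    _ = ((X - A3 - A1).card * C2.card) * C4.card := by ring
    _ ≤ ((X - A2 - A3).card * (A1 - A2).card) * C4.card := by gcongr
    _ = ((X - A2 - A3).card * C4.card) * (A1 - A2).card := by ring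
    _ ≤ ((X - A2 - A4).card * (A3 - A4).card) * (A1 - A2).card := by gcongr
    _ ≤ ((2 • Y - 2 • Y).card * (U0 - U0).card) * (U0 - U0).card := by gcongr
    _ = _ := by ring

lemma exists_small_energy {F : Type*} [Field F] [DecidableEq F] (U0 D : Finset F) (hD : D.Nonempty) :
    ∃ ξ ∈ D, D.card * (((U0 ×ˢ U0) ×ˢ (U0 ×ˢ U0)).filter
      (fun x => ξ * x.1.1 + x.1.2 = ξ * x.2.1 + x.2.2)).card ≤ D.card * U0.card ^ 2 + U0.card ^ 4 := by
  by_contra hcon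
  push Not at hcon
  set E : F → ℕ := fun ξ => (((U0 ×ˢ U0) ×ˢ (U0 ×ˢ U0)).filter
      (fun x => ξ * x.1.1 + x.1.2 = ξ * x.2.1 + x.2.2)).card with hE
  set T := (U0 ×ˢ U0) ×ˢ (U0 ×ˢ U0)
  have hT : T.card = U0.card ^ 4 := by simp only [T, Finset.card_product]; ring
  have hsum : ∑ ξ ∈ D, E ξ ≤ D.card * U0.card ^ 2 + U0.card ^ 4 := by
    have h1 : ∀ ξ ∈ D, E ξ ≤ U0.card ^ 2 +
        (T.filter (fun x => x.1.1 ≠ x.2.1 ∧ ξ = (x.2.2 - x.1.2) / (x.1.1 - x.2.1))).card := by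
      intro ξ _
      have hsub : T.filter (fun x => ξ * x.1.1 + x.1.2 = ξ * x.2.1 + x.2.2) ⊆
          ((U0 ×ˢ U0).image (fun x => (x, x))) ∪
          (T.filter (fun x => x.1.1 ≠ x.2.1 ∧ ξ = (x.2.2 - x.1.2) / (x.1.1 - x.2.1))) := by
        rintro ⟨⟨c, d⟩, ⟨c', d'⟩⟩ hx
        simp only [T, Finset.mem_filter, Finset.mem_product, Finset.mem_union, Finset.mem_image] at hx ⊢
        obtain ⟨⟨⟨h1, h2⟩, h3, h4⟩, h5⟩ := hx
        by_cases hc : c = c'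
        · left
          subst hc
          simp only [add_right_inj] at h5
          subst h5
          exact ⟨(c, d), ⟨h1, h2⟩, rfl⟩
        · right
          refine ⟨⟨⟨h1, h2⟩, h3, h4⟩, hc, ?_⟩
          rw [eq_div_iff (sub_ne_zero.2 hc)]
          linear_combination h5
      refine (Finset.card_le_card hsub).trans ((Finset.card_union_le _ _).trans ?_)
      gcongr
      refine Finset.card_image_le.trans ?_
      rw [Finset.card_product, sq]
    refine (Finset.sum_le_sum h1).trans ?_
    rw [Finset.sum_add_distrib, Finset.sum_const, smul_eq_mul]
    gcongr
    rw [← hT, ← Finset.card_biUnion]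
    · apply Finset.card_le_card
      intro x hx
      rw [Finset.mem_biUnion] at hx
      obtain ⟨_, _, hx⟩ := hx
      exact (Finset.mem_filter.1 hx).1
    · intro a _ b _ hab
      rw [Function.onFun, Finset.disjoint_left]
      intro x hx hy
      exact hab (((Finset.mem_filter.1 hx).2.2).trans ((Finset.mem_filter.1 hy).2.2).symm)
  have h2 : D.card * ∑ ξ ∈ D, E ξ > D.card * (D.card * U0.card ^ 2 + U0.card ^ 4) := by
    rw [Finset.mul_sum]
    calc _ > ∑ ξ ∈ D, (D.card * U0.card ^ 2 + U0.card ^ 4) := Finset.sum_lt_sum_of_nonempty hD hcon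
      _ = _ := by rw [Finset.sum_const, smul_eq_mul]
  exact absurd (Nat.mul_le_mul_left D.card hsum) (not_le.2 h2)

open Pointwise in
set_option maxHeartbeats 800000 in
lemma core_final (p : ℕ) [Fact p.Prime] (Y U0 A : Finset (ZMod p)) (hA : 2 ≤ A.card)
    (hAp : A.card * A.card ≤ p) (h0 : (0 : ZMod p) ∉ A) (γ : ℝ) (hγ : 0 ≤ γ)
    (hC : ∀ l ∈ A, ∃ C : Finset (ZMod p), C ⊆ U0 ∧ γ ≤ C.card ∧ ∃ w, ∀ c ∈ C, w - l * c ∈ Y) :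
    γ ^ 6 * A.card ^ 2 ≤ (A.card ^ 2 * U0.card ^ 2 + 2 * U0.card ^ 4) * (U0 - U0).card ^ 2 * (2 • Y - 2 • Y).card := by
  classical
  choose! C hCU hCγ w hw using hC
  set D := (((A ×ˢ A) ×ˢ (A ×ˢ A)).filter (fun x => x.2.1 ≠ x.2.2)).image
    (fun x => (x.1.1 - x.1.2) / (x.2.1 - x.2.2)) with hD
  have hDc := redei p A hA hAp D (by
    intro a ha a' ha' b hb b' hb' hne
    rw [hD, Finset.mem_image]
    exact ⟨((b, b'), (a, a')), by simp [ha, ha', hb, hb', hne], rfl⟩)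
  have hDpos : 0 < D.card := lt_of_lt_of_le (Nat.mul_pos (by omega) (by omega)) hDc
  obtain ⟨ξ, hξ, hE⟩ := exists_small_energy U0 D (Finset.card_pos.1 hDpos)
  rw [hD, Finset.mem_image] at hξ
  obtain ⟨⟨⟨l1, l2⟩, ⟨l3, l4⟩⟩, hl, hξe⟩ := hξ
  simp only [Finset.mem_filter, Finset.mem_product] at hl hξe
  obtain ⟨⟨⟨m1, m2⟩, m3, m4⟩, hne⟩ := hl
  have hne' : l3 - l4 ≠ 0 := sub_ne_zero.2 hne
  have hsum := core_sumset Y U0 (C l1) (C l2) (C l3) (C l4) l1 l2 l3 l4 (w l1) (w l2) (w l3) (w l4)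
    (fun h => h0 (h ▸ m2)) (fun h => h0 (h ▸ m4)) (hCU _ m1) (hCU _ m2) (hCU _ m3) (hCU _ m4)
    (hw _ m1) (hw _ m2) (hw _ m3) (hw _ m4)
  have hcs := card_sq_le_image (C l1 ×ˢ C l3) (fun x => (l1 - l2) * x.1 + (l3 - l4) * x.2)
  set S := (C l1 ×ˢ C l3).image (fun x => (l1 - l2) * x.1 + (l3 - l4) * x.2)
  set En := (((U0 ×ˢ U0) ×ˢ (U0 ×ˢ U0)).filter
      (fun x => ξ * x.1.1 + x.1.2 = ξ * x.2.1 + x.2.2)).card with hEn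
  have hEle : (((C l1 ×ˢ C l3) ×ˢ (C l1 ×ˢ C l3)).filter (fun x =>
      (l1 - l2) * x.1.1 + (l3 - l4) * x.1.2 = (l1 - l2) * x.2.1 + (l3 - l4) * x.2.2)).card ≤ En := by
    apply Finset.card_le_card
    rintro ⟨⟨c, d⟩, ⟨c', d'⟩⟩ hx
    simp only [Finset.mem_filter, Finset.mem_product] at hx ⊢
    obtain ⟨⟨⟨h1, h2⟩, h3, h4⟩, h5⟩ := hx
    refine ⟨⟨⟨hCU _ m1 h1, hCU _ m3 h2⟩, hCU _ m1 h3, hCU _ m3 h4⟩, ?_⟩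
    rw [← hξe]
    field_simp
    linear_combination h5
  rw [Finset.card_product] at hcs
  have hcs2 := hcs.trans (Nat.mul_le_mul_left _ hEle)
  -- pass to reals
  have g1 := hCγ _ m1
  have g2 := hCγ _ m2
  have g3 := hCγ _ m3
  have g4 := hCγ _ m4
  have r1 : (((C l1).card * (C l3).card : ℝ)) ^ 2 ≤ S.card * En := by exact_mod_cast hcs2
  have r2 : (S.card : ℝ) * ((C l2).card * (C l4).card) ≤ (U0 - U0).card ^ 2 * (2 • Y - 2 • Y).card := by
    exact_mod_cast hsum
  have r3 : (D.card : ℝ) * En ≤ D.card * U0.card ^ 2 + U0.card ^ 4 := by exact_mod_cast hE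
  have r4 : (A.card : ℝ) ^ 2 ≤ 2 * D.card := by
    have : A.card ^ 2 ≤ 2 * D.card := by
      obtain ⟨k, hk⟩ : ∃ k, A.card = k + 2 := ⟨A.card - 2, by omega⟩
      rw [hk] at hDc ⊢
      have e : k + 2 - 1 = k + 1 := by omega
      rw [e] at hDc
      nlinarith
    exact_mod_cast this
  have hDr : (0 : ℝ) < D.card := by exact_mod_cast hDpos
  set Z : ℝ := (U0 - U0).card ^ 2 * (2 • Y - 2 • Y).card with hZ
  have hZ0 : 0 ≤ Z := by positivity
  have e1 : γ ^ 6 ≤ En * Z := by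
    calc γ ^ 6 = (γ * γ) ^ 2 * (γ * γ) := by ring
      _ ≤ (((C l1).card : ℝ) * (C l3).card) ^ 2 * ((C l2).card * (C l4).card) := by gcongr
      _ ≤ ((S.card : ℝ) * En) * ((C l2).card * (C l4).card) := by gcongr
      _ = (En : ℝ) * ((S.card : ℝ) * ((C l2).card * (C l4).card)) := by ring
      _ ≤ (En : ℝ) * Z := by gcongr
  have e2 : (A.card : ℝ) ^ 2 * En ≤ A.card ^ 2 * U0.card ^ 2 + 2 * U0.card ^ 4 := by
    have h5 : (En : ℝ) ≤ U0.card ^ 2 + U0.card ^ 4 / D.card := by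
      rw [← sub_le_iff_le_add', le_div_iff₀ hDr]; linarith
    have h6 : (A.card : ℝ) ^ 2 * (U0.card ^ 4 / D.card) ≤ 2 * U0.card ^ 4 := by
      rw [← mul_div_assoc, div_le_iff₀ hDr]
      calc (A.card : ℝ) ^ 2 * U0.card ^ 4 ≤ (2 * D.card) * U0.card ^ 4 := by gcongr
        _ = _ := by ring
    calc (A.card : ℝ) ^ 2 * En ≤ A.card ^ 2 * (U0.card ^ 2 + U0.card ^ 4 / D.card) := by gcongr
      _ ≤ _ := by rw [mul_add]; linarith
  calc γ ^ 6 * A.card ^ 2 ≤ (En * Z) * A.card ^ 2 := mul_le_mul_of_nonneg_right e1 (sq_nonneg _)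
    _ = (A.card ^ 2 * En) * Z := by ring
    _ ≤ (A.card ^ 2 * U0.card ^ 2 + 2 * U0.card ^ 4) * Z := mul_le_mul_of_nonneg_right e2 hZ0
    _ = _ := by rw [hZ]; ring

lemma exists_ge_of_sum {α : Type*} (s : Finset α) (f : α → ℝ) (N t : ℝ) (hs : (s.card : ℝ) ≤ N)
    (hN : 0 < N) (ht : 0 < t) (h : N * t ≤ ∑ x ∈ s, f x) : ∃ x ∈ s, t ≤ f x := by
  by_contra hcon
  push Not at hcon
  rcases s.eq_empty_or_nonempty with rfl | hne
  · simp at h; nlinarith [mul_pos hN ht]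
  · have h1 := Finset.sum_lt_sum_of_nonempty hne hcon
    rw [Finset.sum_const, nsmul_eq_mul] at h1
    nlinarith

open Pointwise in
lemma path_bound {F : Type*} [Field F] [DecidableEq F] (U V V0 Y W : Finset F) (lam : F)
    (hlam : lam ≠ 0) (G : Finset (F × F))
    (he : ∀ u ∈ U, ∀ v ∈ V, (u, v) ∈ G → v + lam * u ∈ W) (hV0 : V0 ⊆ V) (hY : Y ⊆ V)
    (a T : ℝ) (hT : 0 ≤ T)
    (hpath : ∀ v ∈ Y, ∀ v'' ∈ Y, a ≤ ((V0.filter (fun v' =>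
      T ≤ ((U.filter (fun u => (u, v) ∈ G ∧ (u, v') ∈ G)).card : ℝ) ∧
      T ≤ ((U.filter (fun u => (u, v'') ∈ G ∧ (u, v') ∈ G)).card : ℝ))).card : ℝ)) :
    ((Y - Y).card : ℝ) * a * T ^ 2 ≤ (W.card : ℝ) ^ 4 := by
  have hch : ∀ d ∈ Y - Y, ∃ v ∈ Y, ∃ v'' ∈ Y, v - v'' = d := by
    intro d hd; simpa [Finset.mem_sub] using hd
  choose! f hf g hg hfg using hch
  set N : F → F → Finset F := fun v v' => U.filter (fun u => (u, v) ∈ G ∧ (u, v') ∈ G) with hN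
  set gd : F → Finset F := fun d => V0.filter (fun v' =>
      T ≤ ((N (f d) v').card : ℝ) ∧ T ≤ ((N (g d) v').card : ℝ)) with hgd
  set S : Finset (Σ _ : F, Σ _ : F, F × F) := (Y - Y).sigma (fun d => (gd d).sigma
    (fun v' => N (f d) v' ×ˢ N (g d) v')) with hS
  have h1 : ((Y - Y).card : ℝ) * a * T ^ 2 ≤ S.card := by
    rw [hS, Finset.card_sigma]
    push_cast
    rw [mul_assoc, ← nsmul_eq_mul]
    apply Finset.card_nsmul_le_sum
    intro d hd
    rw [Finset.card_sigma]
    push_cast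
    calc a * T ^ 2 ≤ (gd d).card * T ^ 2 := by
          gcongr
          exact hpath _ (hf d hd) _ (hg d hd)
      _ = (gd d).card • (T ^ 2) := by rw [nsmul_eq_mul]
      _ ≤ _ := by
        apply Finset.card_nsmul_le_sum
        intro v' hv'
        rw [Finset.card_product]
        push_cast
        rw [hgd, Finset.mem_filter] at hv'
        rw [sq]
        exact mul_le_mul hv'.2.1 hv'.2.2 hT (Nat.cast_nonneg _)
  have h2 : S.card ≤ ((W ×ˢ W) ×ˢ (W ×ˢ W)).card := by
    apply Finset.card_le_card_of_injOn (fun x : (Σ _ : F, Σ _ : F, F × F) =>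
      ((f x.1 + lam * x.2.2.1, x.2.1 + lam * x.2.2.1),
        (x.2.1 + lam * x.2.2.2, g x.1 + lam * x.2.2.2)))
    · rintro ⟨d, v', u, u'⟩ hx
      simp only [hS, Finset.coe_sigma, Set.mem_sigma_iff, Finset.mem_coe, Finset.mem_product, hgd, hN,
        Finset.mem_filter] at hx
      obtain ⟨hd, ⟨hv', -⟩, ⟨hu, hu1, hu2⟩, hu', hu3, hu4⟩ := hx
      simp only [Finset.mem_coe, Finset.mem_product]
      exact ⟨⟨he _ hu _ (hY (hf _ hd)) hu1, he _ hu _ (hV0 hv') hu2⟩,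
        he _ hu' _ (hV0 hv') hu4, he _ hu' _ (hY (hg _ hd)) hu3⟩
    · rintro ⟨d, v', u, u'⟩ hx ⟨d2, v2, u2, u2'⟩ hx2 heq
      simp only [hS, Finset.coe_sigma, Set.mem_sigma_iff, Finset.mem_coe] at hx hx2
      have hd := hfg d hx.1
      have hd2 := hfg d2 hx2.1
      simp only [Prod.mk.injEq] at heq
      obtain ⟨⟨e1, e2⟩, e3, e4⟩ := heq
      have : d = d2 := by
        rw [← hd, ← hd2]
        linear_combination e1 - e2 + e3 - e4
      subst this
      have hu : u = u2 := mul_left_cancel₀ hlam (add_left_cancel e1)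
      have hu' : u' = u2' := mul_left_cancel₀ hlam (add_left_cancel e4)
      subst hu; subst hu'
      have hv := add_right_cancel e2
      subst hv
      rfl
  have h3 : ((W ×ˢ W) ×ˢ (W ×ˢ W)).card = W.card ^ 4 := by
    simp only [Finset.card_product]; ring
  rw [h3] at h2
  exact h1.trans (by exact_mod_cast h2)

set_option maxHeartbeats 1000000 in
lemma selection {ι α β : Type*} [DecidableEq α] [DecidableEq β] (I : Finset ι) (U : Finset α)
    (V : Finset β) (G : ι → Finset (α × β)) (Q M d m T : ℝ) (hQ : (I.card : ℝ) ≤ Q) (hQ0 : 0 < Q)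
    (hU : (U.card : ℝ) ≤ M) (hV : (V.card : ℝ) ≤ M) (hM : 0 < M) (hd : 0 < d)
    (hdeg : ∀ i ∈ I, ∀ u ∈ U, ∀ v ∈ V, (u, v) ∈ G i →
      d ≤ ((V.filter (fun v => (u, v) ∈ G i)).card : ℝ))
    (hm0 : 0 < m)
    (hm : m ≤ ∑ v ∈ V, ∑ i ∈ I, ((U.filter (fun u => (u, v) ∈ G i)).card : ℝ))
    (hT0 : 0 ≤ T) (hT : 16 * Q ^ 2 * M ^ 4 * T ≤ m ^ 2 * d) :
    ∃ i ∈ I, ∃ V0 ⊆ V, ∃ Y ⊆ V0, d ≤ V0.card ∧ (V0.card : ℝ) ≤ 2 * Y.card ∧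
      (∀ v ∈ Y, 4 * ((V0.filter (fun v' =>
        ((U.filter (fun u => (u, v) ∈ G i ∧ (u, v') ∈ G i)).card : ℝ) < T)).card : ℝ) ≤ V0.card) ∧
      m ^ 2 ≤ 4 * Q * M ^ 2 * ∑ v ∈ Y, ∑ i ∈ I, ((U.filter (fun u => (u, v) ∈ G i)).card : ℝ) := by
  set μ : β → ℝ := fun v => ∑ i ∈ I, ((U.filter (fun u => (u, v) ∈ G i)).card : ℝ) with hμ
  have hμ0 : ∀ v, 0 ≤ μ v := fun v => Finset.sum_nonneg fun i _ => Nat.cast_nonneg _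
  have hμle : ∀ v, μ v ≤ Q * M := by
    intro v
    calc μ v ≤ ∑ i ∈ I, M := Finset.sum_le_sum fun i _ =>
          le_trans (by exact_mod_cast Finset.card_le_card (Finset.filter_subset _ _)) hU
      _ = I.card * M := by rw [Finset.sum_const, nsmul_eq_mul]
      _ ≤ Q * M := by gcongr
  set Nb : ι → α → Finset β := fun i u => V.filter (fun v => (u, v) ∈ G i) with hNb
  set bd : ι → β → β → Prop := fun i v v' =>
    ((U.filter (fun u => (u, v) ∈ G i ∧ (u, v') ∈ G i)).card : ℝ) < T with hbd
  have : ∀ i v v', Decidable (bd i v v') := fun i v v' => inferInstanceAs (Decidable (_ < _))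
  set B : ι → α → ℝ := fun i u => (((Nb i u ×ˢ Nb i u).filter (fun x => bd i x.1 x.2)).card : ℝ) with hB
  have s1 : ∑ i ∈ I, ∑ u ∈ U, ∑ v ∈ Nb i u, μ v = ∑ v ∈ V, μ v ^ 2 := by
    have : ∀ i ∈ I, ∑ u ∈ U, ∑ v ∈ Nb i u, μ v =
        ∑ v ∈ V, ((U.filter (fun u => (u, v) ∈ G i)).card : ℝ) * μ v := by
      intro i _
      simp only [hNb, Finset.sum_filter]
      rw [Finset.sum_comm]
      refine Finset.sum_congr rfl fun v _ => ?_
      rw [← Finset.sum_filter, Finset.sum_const, nsmul_eq_mul]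
    rw [Finset.sum_congr rfl this, Finset.sum_comm]
    refine Finset.sum_congr rfl fun v _ => ?_
    rw [← Finset.sum_mul, sq]
  clear_value μ
  have s2 : m ^ 2 / M ≤ ∑ v ∈ V, μ v ^ 2 := by
    rw [div_le_iff₀ hM]
    calc m ^ 2 ≤ (∑ v ∈ V, μ v) ^ 2 := pow_le_pow_left₀ hm0.le hm 2
      _ ≤ V.card * ∑ v ∈ V, μ v ^ 2 := sq_sum_le_card_mul_sum_sq
      _ ≤ M * ∑ v ∈ V, μ v ^ 2 := mul_le_mul_of_nonneg_right hV (Finset.sum_nonneg fun v _ => sq_nonneg _)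
      _ = _ := by ring
  have s3 : ∀ i ∈ I, ∑ u ∈ U, B i u ≤ M ^ 2 * T := by
    intro i _
    have hBi : ∀ u ∈ U, B i u = ((Finset.bipartiteAbove (fun u (x : β × β) =>
        (u, x.1) ∈ G i ∧ (u, x.2) ∈ G i) ((V ×ˢ V).filter (fun x => bd i x.1 x.2)) u).card : ℝ) := by
      intro u _
      simp only [hB]
      congr 2
      ext x
      simp only [hNb, Finset.bipartiteAbove, Finset.mem_filter, Finset.mem_product]
      tauto
    rw [Finset.sum_congr rfl hBi]
    have := Finset.sum_card_bipartiteAbove_eq_sum_card_bipartiteBelow (s := U)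
      (t := (V ×ˢ V).filter (fun x => bd i x.1 x.2)) (fun u (x : β × β) =>
        (u, x.1) ∈ G i ∧ (u, x.2) ∈ G i)
    have h2 : ∀ x ∈ (V ×ˢ V).filter (fun x => bd i x.1 x.2),
        ((Finset.bipartiteBelow (fun u (x : β × β) =>
        (u, x.1) ∈ G i ∧ (u, x.2) ∈ G i) U x).card : ℝ) ≤ T := by
      intro x hx
      exact le_of_lt (Finset.mem_filter.1 hx).2
    calc _ = ((∑ a ∈ U, (Finset.bipartiteAbove (fun u (x : β × β) =>
        (u, x.1) ∈ G i ∧ (u, x.2) ∈ G i) ((V ×ˢ V).filter (fun x => bd i x.1 x.2)) a).card : ℕ) : ℝ) := by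
          push_cast; rfl
      _ ≤ _ := by
        rw [this]
        push_cast
        refine (Finset.sum_le_card_nsmul _ _ _ h2).trans ?_
        rw [nsmul_eq_mul]
        refine mul_le_mul_of_nonneg_right ?_ hT0
        calc _ ≤ ((V ×ˢ V).card : ℝ) := by exact_mod_cast Finset.card_le_card (Finset.filter_subset _ _)
          _ = (V.card : ℝ) ^ 2 := by rw [Finset.card_product]; push_cast; ring
          _ ≤ _ := by gcongr
  set γ : ℝ := 8 * Q * M / d with hγ
  have hγ0 : 0 < γ := by positivity
  have hγd : γ * d = 8 * Q * M := by rw [hγ]; field_simp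
  have s4 : ∑ i ∈ I, ∑ u ∈ U, B i u ≤ Q * (M ^ 2 * T) := by
    calc _ ≤ ∑ i ∈ I, M ^ 2 * T := Finset.sum_le_sum s3
      _ = I.card * (M ^ 2 * T) := by rw [Finset.sum_const, nsmul_eq_mul]
      _ ≤ _ := by gcongr
  have hθ : 0 < m ^ 2 / (2 * Q * M ^ 2) := by positivity
  obtain ⟨⟨i, u⟩, hiu, hch⟩ := exists_ge_of_sum (I ×ˢ U)
    (fun x => (∑ v ∈ Nb x.1 x.2, μ v) - γ * B x.1 x.2) (Q * M) (m ^ 2 / (2 * Q * M ^ 2))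
    (by rw [Finset.card_product]; push_cast; gcongr) (by positivity) hθ (by
      rw [Finset.sum_sub_distrib, ← Finset.mul_sum, Finset.sum_product, Finset.sum_product, s1]
      have h1 : γ * ∑ x ∈ I, ∑ y ∈ U, B x y ≤ m ^ 2 / (2 * M) := by
        calc _ ≤ γ * (Q * (M ^ 2 * T)) := by gcongr
          _ = (16 * Q ^ 2 * M ^ 4 * T) / (2 * M * d) := by rw [hγ]; field_simp; ring
          _ ≤ (m ^ 2 * d) / (2 * M * d) := by gcongr
          _ = _ := by field_simp
      have h2 : Q * M * (m ^ 2 / (2 * Q * M ^ 2)) = m ^ 2 / M - m ^ 2 / (2 * M) := by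
        field_simp; ring
      rw [h2]; linarith)
  rw [Finset.mem_product] at hiu
  simp only at hiu hch
  obtain ⟨hi, hu⟩ := hiu
  set V0 := Nb i u with hV0
  have hB0 : 0 ≤ B i u := Nat.cast_nonneg _
  have hμV0 : m ^ 2 / (2 * Q * M ^ 2) + γ * B i u ≤ ∑ v ∈ V0, μ v := by linarith
  have hμpos : 0 < ∑ v ∈ V0, μ v := lt_of_lt_of_le (by positivity) hμV0
  have hV0d : d ≤ V0.card := by
    have : V0.Nonempty := by
      by_contra h
      rw [Finset.not_nonempty_iff_eq_empty] at h
      rw [h] at hμpos; simp at hμpos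
    obtain ⟨v, hv⟩ := this
    have hv' := Finset.mem_filter.1 hv
    exact hdeg i hi u hu v hv'.1 hv'.2
  have hV0pos : (0 : ℝ) < V0.card := lt_of_lt_of_le hd hV0d
  have hμV0le : ∑ v ∈ V0, μ v ≤ V0.card * (Q * M) := by
    rw [← nsmul_eq_mul]; exact Finset.sum_le_card_nsmul _ _ _ (fun v _ => hμle v)
  set Y := V0.filter (fun v => 4 * ((V0.filter (fun v' => bd i v v')).card : ℝ) ≤ V0.card) with hY
  set Z := V0.filter (fun v => ¬ 4 * ((V0.filter (fun v' => bd i v v')).card : ℝ) ≤ V0.card) with hZ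
  have hZB : (Z.card : ℝ) * V0.card ≤ 4 * B i u := by
    have h1 : ∑ v ∈ Z, ((V0.filter (fun v' => bd i v v')).card : ℝ) ≤ B i u := by
      have h2 : B i u = ∑ v ∈ V0, ((V0.filter (fun v' => bd i v v')).card : ℝ) := by
        simp only [hB]
        rw [← hV0, Finset.card_filter, Finset.sum_product]
        push_cast
        refine Finset.sum_congr rfl fun v _ => ?_
        rw [Finset.card_filter]; push_cast; rfl
      rw [h2]
      exact Finset.sum_le_sum_of_subset_of_nonneg (Finset.filter_subset _ _) (fun _ _ _ => Nat.cast_nonneg _)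
    have h3 : (Z.card : ℝ) * (V0.card / 4) ≤ ∑ v ∈ Z, ((V0.filter (fun v' => bd i v v')).card : ℝ) := by
      rw [← nsmul_eq_mul]
      apply Finset.card_nsmul_le_sum
      intro v hv
      have := (Finset.mem_filter.1 hv).2
      push Not at this
      linarith
    linarith
  have hZc : (Z.card : ℝ) * γ * V0.card ≤ 4 * ∑ v ∈ V0, μ v := by
    calc (Z.card : ℝ) * γ * V0.card = γ * (Z.card * V0.card) := by ring
      _ ≤ γ * (4 * B i u) := by gcongr
      _ ≤ _ := by linarith
  have hZ2 : 2 * (Z.card : ℝ) ≤ V0.card := by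
    have h1 : (Z.card : ℝ) * γ ≤ 4 * (Q * M) := by
      refine le_of_mul_le_mul_right ?_ hV0pos
      linarith
    have h2 : (Z.card : ℝ) * (8 * Q * M) ≤ 4 * (Q * M) * d := by
      rw [← hγd, ← mul_assoc]; gcongr
    have h3 : 2 * (Z.card : ℝ) ≤ d := by
      have : 0 < 4 * (Q * M) := by positivity
      refine le_of_mul_le_mul_left ?_ this
      linarith
    linarith
  have hμZ : ∑ v ∈ Z, μ v ≤ (∑ v ∈ V0, μ v) / 2 := by
    have h1 : ∑ v ∈ Z, μ v ≤ Z.card * (Q * M) := by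
      rw [← nsmul_eq_mul]; exact Finset.sum_le_card_nsmul _ _ _ (fun v _ => hμle v)
    have h2 : (Z.card : ℝ) * (8 * Q * M) ≤ 4 * ∑ v ∈ V0, μ v := by
      rw [← hγd, ← mul_assoc]
      refine le_trans ?_ hZc
      gcongr
    linarith
  have hcard : (Y.card : ℝ) + Z.card = V0.card := by
    exact_mod_cast Finset.card_filter_add_card_filter_not (s := V0) _
  have hsum : ∑ v ∈ Y, μ v + ∑ v ∈ Z, μ v = ∑ v ∈ V0, μ v :=
    Finset.sum_filter_add_sum_filter_not _ _ _
  refine ⟨i, hi, V0, Finset.filter_subset _ _, Y, Finset.filter_subset _ _, hV0d, by linarith, ?_, ?_⟩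
  · intro v hv
    have h := (Finset.mem_filter.1 hv).2
    convert h
  · have h1 : m ^ 2 / (2 * Q * M ^ 2) ≤ 2 * ∑ v ∈ Y, μ v := by
      have : 0 ≤ γ * B i u := by positivity
      linarith
    rw [div_le_iff₀ (by positivity)] at h1
    linarith

lemma prune {ι α β : Type*} [DecidableEq α] [DecidableEq β] (I : Finset ι) (U : Finset α)
    (V : Finset β) (G : ι → Finset (α × β)) (M d : ℝ) (hU : (U.card : ℝ) ≤ M) (hd : 0 ≤ d) :
    ∃ G' : ι → Finset (α × β), (∀ i, G' i ⊆ G i) ∧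
    (∀ i ∈ I, ∀ u ∈ U, ∀ v ∈ V, (u, v) ∈ G' i →
      d ≤ ((V.filter (fun v => (u, v) ∈ G' i)).card : ℝ)) ∧
    (∑ v ∈ V, ∑ i ∈ I, ((U.filter (fun u => (u, v) ∈ G i)).card : ℝ)) ≤
      (∑ v ∈ V, ∑ i ∈ I, ((U.filter (fun u => (u, v) ∈ G' i)).card : ℝ)) + I.card * (M * d) := by
  set dg : ι → α → ℝ := fun i u => ((V.filter (fun v => (u, v) ∈ G i)).card : ℝ) with hdg
  refine ⟨fun i => (G i).filter (fun x => d ≤ dg i x.1), fun i => Finset.filter_subset _ _, ?_, ?_⟩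
  · intro i _ u _ v _ huv
    rw [Finset.mem_filter] at huv
    refine huv.2.trans (le_of_eq ?_)
    simp only [hdg]
    congr 2
    ext x
    simp only [Finset.mem_filter]
    have := huv.2
    simp only [hdg] at this
    tauto
  · rw [Finset.sum_comm, Finset.sum_comm (s := V) (t := I), ← nsmul_eq_mul, ← Finset.sum_const,
      ← Finset.sum_add_distrib]
    refine Finset.sum_le_sum fun i _ => ?_
    have h1 : ∀ v ∈ V, ((U.filter (fun u => (u, v) ∈ G i)).card : ℝ) =
        ((U.filter (fun u => (u, v) ∈ (G i).filter (fun x => d ≤ dg i x.1))).card : ℝ) +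
        ((U.filter (fun u => (u, v) ∈ G i ∧ dg i u < d)).card : ℝ) := by
      intro v _
      rw [← Nat.cast_add, ← Finset.card_union_of_disjoint]
      · congr 2
        ext u
        simp only [Finset.mem_filter, Finset.mem_union]
        have := le_or_gt d (dg i u)
        tauto
      · rw [Finset.disjoint_left]
        intro u hu hu'
        simp only [Finset.mem_filter] at hu hu'
        linarith [hu.2.2, hu'.2.2]
    rw [Finset.sum_congr rfl h1, Finset.sum_add_distrib]
    gcongr
    have h2 := Finset.sum_card_bipartiteAbove_eq_sum_card_bipartiteBelow (s := U) (t := V)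
      (fun u v => (u, v) ∈ G i ∧ dg i u < d)
    simp only [Finset.bipartiteAbove, Finset.bipartiteBelow] at h2
    have h3 : ∑ v ∈ V, ((U.filter (fun u => (u, v) ∈ G i ∧ dg i u < d)).card : ℝ) =
        ∑ u ∈ U, ((V.filter (fun v => (u, v) ∈ G i ∧ dg i u < d)).card : ℝ) := by
      exact_mod_cast h2.symm
    rw [h3]
    calc _ ≤ ∑ u ∈ U, d := by
          refine Finset.sum_le_sum fun u _ => ?_
          by_cases hlt : dg i u < d
          · refine le_trans ?_ hlt.le
            simp only [hdg]
            refine Nat.cast_le.2 (Finset.card_le_card fun x hx => ?_)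
            simp only [Finset.mem_filter] at hx ⊢
            tauto
          · rw [Finset.filter_false_of_mem]
            · simpa using hd
            · intro x _ hx; exact hlt hx.2
      _ = U.card * d := by rw [Finset.sum_const, nsmul_eq_mul]
      _ ≤ _ := by gcongr

open Pointwise in
lemma core_Y {ι F : Type*} [Field F] [DecidableEq F] (I : Finset ι) (lam : ι → F) (U V : Finset F)
    (W : ι → Finset F) (G : ι → Finset (F × F)) (hlam : ∀ i ∈ I, lam i ≠ 0)
    (hW : ∀ i ∈ I, ∀ u ∈ U, ∀ v ∈ V, (u, v) ∈ G i → v + lam i * u ∈ W i)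
    (M J : ℝ) (hM : 0 < M) (hJ : 0 < J) (hQ : 0 < (I.card : ℝ))
    (hU : (U.card : ℝ) ≤ M) (hV : (V.card : ℝ) ≤ M) (hWM : ∀ i ∈ I, ((W i).card : ℝ) ≤ M)
    (hm : I.card * M ^ 2 / J ≤ ∑ v ∈ V, ∑ i ∈ I, ((U.filter (fun u => (u, v) ∈ G i)).card : ℝ)) :
    ∃ Y ⊆ V, M / (8 * J) ≤ Y.card ∧ ((Y - Y).card : ℝ) ≤ 2 ^ 19 * J ^ 7 * M ∧
      I.card * M ^ 2 / (16 * J ^ 2) ≤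
        ∑ v ∈ Y, ∑ i ∈ I, ((U.filter (fun u => (u, v) ∈ G i)).card : ℝ) := by
  set Q : ℝ := (I.card : ℝ) with hQd
  obtain ⟨G', hG', hdeg, hsum⟩ := prune I U V G M (M / (4 * J)) hU (by positivity)
  have hm' : Q * M ^ 2 / (2 * J) ≤
      ∑ v ∈ V, ∑ i ∈ I, ((U.filter (fun u => (u, v) ∈ G' i)).card : ℝ) := by
    have h1 : Q * (M * (M / (4 * J))) = Q * M ^ 2 / J / 4 := by field_simp
    have h2 : Q * M ^ 2 / (2 * J) = Q * M ^ 2 / J / 2 := by field_simp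
    have h3 : 0 < Q * M ^ 2 / J := by positivity
    rw [h2]; rw [← hQd, h1] at hsum; linarith
  obtain ⟨i, hi, V0, hV0, Y, hY, hV0d, hYc, hbad, hmass⟩ := selection I U V G' Q M (M / (4 * J))
    (Q * M ^ 2 / (2 * J)) (M / (256 * J ^ 3)) le_rfl hQ hU hV hM (by positivity) hdeg (by positivity)
    hm' (by positivity) (le_of_eq (by field_simp; norm_num))
  have hpb := path_bound U V V0 Y (W i) (lam i) (hlam i hi) (G' i)
    (fun u hu v hv h => hW i hi u hu v hv (hG' i h)) hV0 (hY.trans hV0) (V0.card / 2)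
    (M / (256 * J ^ 3)) (by positivity) (by
      intro v hv v'' hv''
      have b1 := hbad v hv
      have b2 := hbad v'' hv''
      set T := M / (256 * J ^ 3)
      set X1 := V0.filter (fun v' =>
        ((U.filter (fun u => (u, v) ∈ G' i ∧ (u, v') ∈ G' i)).card : ℝ) < T)
      set X2 := V0.filter (fun v' =>
        ((U.filter (fun u => (u, v'') ∈ G' i ∧ (u, v') ∈ G' i)).card : ℝ) < T)
      set X := V0.filter (fun v' =>
        T ≤ ((U.filter (fun u => (u, v) ∈ G' i ∧ (u, v') ∈ G' i)).card : ℝ) ∧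
        T ≤ ((U.filter (fun u => (u, v'') ∈ G' i ∧ (u, v') ∈ G' i)).card : ℝ))
      have hsub : V0 ⊆ X ∪ (X1 ∪ X2) := by
        intro x hx
        simp only [X, X1, X2, Finset.mem_union, Finset.mem_filter, hx, true_and]
        by_cases h1 : T ≤ ((U.filter (fun u => (u, v) ∈ G' i ∧ (u, x) ∈ G' i)).card : ℝ)
        · by_cases h2 : T ≤ ((U.filter (fun u => (u, v'') ∈ G' i ∧ (u, x) ∈ G' i)).card : ℝ)
          · exact Or.inl ⟨h1, h2⟩
          · exact Or.inr (Or.inr (not_le.1 h2))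
        · exact Or.inr (Or.inl (not_le.1 h1))
      have hc : V0.card ≤ X.card + (X1.card + X2.card) :=
        (Finset.card_le_card hsub).trans ((Finset.card_union_le _ _).trans
          (Nat.add_le_add_left (Finset.card_union_le _ _) _))
      have hc' : (V0.card : ℝ) ≤ X.card + (X1.card + X2.card) := by exact_mod_cast hc
      linarith)
  refine ⟨Y, hY.trans hV0, ?_, ?_, ?_⟩
  · have : M / (8 * J) = M / (4 * J) / 2 := by field_simp; norm_num
    rw [this]; linarith
  · have h1 : ((Y - Y).card : ℝ) * (M / (4 * J) / 2) * (M / (256 * J ^ 3)) ^ 2 ≤ M ^ 4 := by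
      calc _ ≤ ((Y - Y).card : ℝ) * (V0.card / 2) * (M / (256 * J ^ 3)) ^ 2 := by gcongr
        _ ≤ ((W i).card : ℝ) ^ 4 := hpb
        _ ≤ M ^ 4 := by gcongr; exact hWM i hi
    have h2 : ((Y - Y).card : ℝ) * (M / (4 * J) / 2) * (M / (256 * J ^ 3)) ^ 2 =
        ((Y - Y).card : ℝ) * (M ^ 3 / (2 ^ 19 * J ^ 7)) := by field_simp; ring
    rw [h2] at h1
    have h3 : 0 < M ^ 3 / (2 ^ 19 * J ^ 7) := by positivity
    refine le_of_mul_le_mul_right (h1.trans (le_of_eq ?_)) h3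
    field_simp
  · have h1 : ∑ v ∈ Y, ∑ i ∈ I, ((U.filter (fun u => (u, v) ∈ G' i)).card : ℝ) ≤
        ∑ v ∈ Y, ∑ i ∈ I, ((U.filter (fun u => (u, v) ∈ G i)).card : ℝ) := by
      refine Finset.sum_le_sum fun v _ => Finset.sum_le_sum fun i _ => ?_
      refine Nat.cast_le.2 (Finset.card_le_card fun x hx => ?_)
      simp only [Finset.mem_filter] at hx ⊢
      exact ⟨hx.1, hG' i hx.2⟩
    refine le_trans ?_ h1
    have h4 : 0 < 4 * Q * M ^ 2 := by positivity
    refine le_of_mul_le_mul_left (le_trans (le_of_eq ?_) hmass) h4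
    field_simp
    norm_num

lemma fiber_sum {F : Type*} [Field F] [DecidableEq F] (lam : F) (U Y W : Finset F)
    (G : Finset (F × F)) (hW : ∀ u ∈ U, ∀ v ∈ Y, (u, v) ∈ G → v + lam * u ∈ W) (f : F → ℝ) :
    ∑ w ∈ W, ∑ u ∈ U.filter (fun u => (u, w - lam * u) ∈ G ∧ w - lam * u ∈ Y), f u =
      ∑ u ∈ U, f u * ((Y.filter (fun v => (u, v) ∈ G)).card : ℝ) := by
  simp only [Finset.sum_filter]
  rw [Finset.sum_comm]
  refine Finset.sum_congr rfl fun u hu => ?_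
  rw [← Finset.sum_filter, Finset.sum_const, nsmul_eq_mul, mul_comm]
  congr 2
  refine Finset.card_bij (fun w _ => w - lam * u) ?_ ?_ ?_
  · intro w hw
    rw [Finset.mem_filter] at hw ⊢
    exact ⟨hw.2.2, hw.2.1⟩
  · intro a _ b _ h
    exact sub_left_injective h
  · intro v hv
    rw [Finset.mem_filter] at hv
    refine ⟨v + lam * u, ?_, by ring⟩
    rw [Finset.mem_filter]
    have e : v + lam * u - lam * u = v := by ring
    rw [e]
    exact ⟨hW u hu v hv.1 hv.2, hv.2, hv.1⟩

open Pointwise in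
lemma core_U {ι F : Type*} [Field F] [DecidableEq F] (I : Finset ι) (lam : ι → F) (U Y : Finset F)
    (W : ι → Finset F) (G : ι → Finset (F × F)) (hlam : ∀ i ∈ I, lam i ≠ 0)
    (hW : ∀ i ∈ I, ∀ u ∈ U, ∀ v ∈ Y, (u, v) ∈ G i → v + lam i * u ∈ W i)
    (M m : ℝ) (hM : 0 < M) (hQ : 0 < (I.card : ℝ))
    (hU : (U.card : ℝ) ≤ M) (hY : (Y.card : ℝ) ≤ M) (hWM : ∀ i ∈ I, ((W i).card : ℝ) ≤ M)
    (hm0 : 0 < m)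
    (hm : m ≤ ∑ v ∈ Y, ∑ i ∈ I, ((U.filter (fun u => (u, v) ∈ G i)).card : ℝ)) :
    ∃ U0 ⊆ U, 0 < (U0.card : ℝ) ∧ (U0 - U0).card ≤ (Y - Y).card ∧ ∃ I' ⊆ I,
      m / (4 * M ^ 2) ≤ I'.card ∧ ∃ γ : ℝ, m * U0.card / (4 * M ^ 2 * I.card) ≤ γ ∧
      m ^ 2 / (4 * I.card ^ 2 * M ^ 3) ≤ γ ∧
      ∀ i ∈ I', ∃ C ⊆ U0, γ ≤ C.card ∧ ∃ w, ∀ c ∈ C, w - lam i * c ∈ Y := by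
  set Q : ℝ := (I.card : ℝ) with hQd
  set s : ℝ := ∑ v ∈ Y, ∑ i ∈ I, ((U.filter (fun u => (u, v) ∈ G i)).card : ℝ) with hs
  set ν : F → ℝ := fun u => ∑ i ∈ I, ((Y.filter (fun v => (u, v) ∈ G i)).card : ℝ) with hν
  have hν0 : ∀ u, 0 ≤ ν u := fun u => Finset.sum_nonneg fun i _ => Nat.cast_nonneg _
  have hsν : ∑ u ∈ U, ν u = s := by
    rw [hs, hν]
    rw [Finset.sum_comm, Finset.sum_comm (s := Y)]
    refine Finset.sum_congr rfl fun i _ => ?_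
    have h2 := Finset.sum_card_bipartiteAbove_eq_sum_card_bipartiteBelow (s := U) (t := Y)
      (fun u v => (u, v) ∈ G i)
    simp only [Finset.bipartiteAbove, Finset.bipartiteBelow] at h2
    exact_mod_cast h2
  set K : ι → F → Finset F := fun i w =>
    U.filter (fun u => (u, w - lam i * u) ∈ G i ∧ w - lam i * u ∈ Y) with hK
  have hfib : ∀ i ∈ I, ∀ f : F → ℝ, ∑ w ∈ W i, ∑ u ∈ K i w, f u =
      ∑ u ∈ U, f u * ((Y.filter (fun v => (u, v) ∈ G i)).card : ℝ) :=
    fun i hi f => fiber_sum (lam i) U Y (W i) (G i) (hW i hi) f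
  have hfib2 : ∀ f : F → ℝ, ∑ i ∈ I, ∑ w ∈ W i, ∑ u ∈ K i w, f u = ∑ u ∈ U, f u * ν u := by
    intro f
    rw [Finset.sum_congr rfl (fun i hi => hfib i hi f), Finset.sum_comm]
    refine Finset.sum_congr rfl fun u _ => ?_
    rw [← Finset.mul_sum]
  set η : ℝ := m / (2 * M) with hη
  have hη0 : 0 < η := by positivity
  have hθ : 0 < m ^ 2 / (2 * Q * M ^ 2) := by positivity
  have hs0 : 0 < s := hm0.trans_le hm
  have hsq : s ^ 2 / M ≤ ∑ u ∈ U, ν u * ν u := by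
    rw [div_le_iff₀ hM, ← hsν]
    calc (∑ u ∈ U, ν u) ^ 2 ≤ U.card * ∑ u ∈ U, ν u ^ 2 := sq_sum_le_card_mul_sum_sq
      _ ≤ M * ∑ u ∈ U, ν u ^ 2 :=
        mul_le_mul_of_nonneg_right hU (Finset.sum_nonneg fun v _ => sq_nonneg _)
      _ = _ := by rw [mul_comm]; simp only [sq]
  clear_value s
  obtain ⟨⟨i, w⟩, hiw, hch⟩ := exists_ge_of_sum (I.sigma W)
    (fun x => ∑ u ∈ K x.1 x.2, (ν u - η)) (Q * M) (m ^ 2 / (2 * Q * M ^ 2))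
    (by
      rw [Finset.card_sigma]; push_cast
      calc _ ≤ ∑ i ∈ I, M := Finset.sum_le_sum hWM
        _ = _ := by rw [Finset.sum_const, nsmul_eq_mul]) (by positivity) hθ (by
      rw [Finset.sum_sigma]
      simp only
      rw [hfib2]
      simp only [sub_mul]
      rw [Finset.sum_sub_distrib, ← Finset.mul_sum, hsν]
      have h2 : Q * M * (m ^ 2 / (2 * Q * M ^ 2)) = m ^ 2 / (2 * M) := by
        field_simp
      have h3 : η * s ≤ s ^ 2 / (2 * M) := by
        rw [hη, div_mul_eq_mul_div]; gcongr; nlinarith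
      have h4 : m ^ 2 / (2 * M) ≤ s ^ 2 / (2 * M) := by gcongr
      have h5 : s ^ 2 / M = s ^ 2 / (2 * M) + s ^ 2 / (2 * M) := by field_simp; norm_num
      rw [h2]; linarith)
  rw [Finset.mem_sigma] at hiw
  simp only at hiw hch
  obtain ⟨hi, hw⟩ := hiw
  set U0 := K i w with hU0
  have hU0U : U0 ⊆ U := Finset.filter_subset _ _
  rw [Finset.sum_sub_distrib, Finset.sum_const, nsmul_eq_mul] at hch
  set A : ℝ := ∑ u ∈ U0, ν u with hA
  have hU0ne : U0.Nonempty := by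
    by_contra h
    rw [Finset.not_nonempty_iff_eq_empty] at h
    rw [hA, h] at hch; simp at hch; linarith
  have hU0pos : (0 : ℝ) < U0.card := by exact_mod_cast Finset.card_pos.2 hU0ne
  have hA1 : U0.card * η ≤ A := by linarith
  have hA2 : m ^ 2 / (2 * Q * M ^ 2) ≤ A := by nlinarith [mul_pos hU0pos hη0]
  have hA0 : 0 < A := lt_of_lt_of_le hθ hA2
  -- degree of graph i on U0 x Y
  set g : ι → ℝ := fun i => ∑ u ∈ U0, ((Y.filter (fun v => (u, v) ∈ G i)).card : ℝ) with hg
  have hgA : ∑ i ∈ I, g i = A := by rw [hA, hg, Finset.sum_comm]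
  have hgle : ∀ i, g i ≤ U0.card * M := by
    intro i
    rw [← nsmul_eq_mul]
    refine Finset.sum_le_card_nsmul _ _ _ fun u _ => le_trans ?_ hY
    exact_mod_cast Finset.card_le_card (Finset.filter_subset _ _)
  clear_value A
  set I' := I.filter (fun i => A / (2 * Q) ≤ g i) with hI'
  refine ⟨U0, hU0U, hU0pos, ?_, I', Finset.filter_subset _ _, ?_, A / (2 * Q * M), ?_, ?_, ?_⟩
  · calc (U0 - U0).card = ((U0 - U0).image (fun x => lam i * x)).card :=
        (Finset.card_image_of_injective _ (mul_right_injective₀ (hlam i hi))).symm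
      _ ≤ _ := by
        apply Finset.card_le_card
        intro z hz
        simp only [Finset.mem_image, Finset.mem_sub] at hz
        obtain ⟨_, ⟨x, hx, y, hy, rfl⟩, rfl⟩ := hz
        have hx' := (Finset.mem_filter.1 hx).2.2
        have hy' := (Finset.mem_filter.1 hy).2.2
        have e : lam i * (x - y) = (w - lam i * y) - (w - lam i * x) := by ring
        rw [e]
        exact Finset.sub_mem_sub hy' hx'
  · have h1 : A / 2 ≤ ∑ i ∈ I', g i := by
      have h2 : ∑ i ∈ I', g i + ∑ i ∈ I.filter (fun i => ¬ A / (2 * Q) ≤ g i), g i = A := by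
        exact (Finset.sum_filter_add_sum_filter_not I (fun i => A / (2 * Q) ≤ g i) g).trans hgA
      have h3 : ∑ i ∈ I.filter (fun i => ¬ A / (2 * Q) ≤ g i), g i ≤ A / 2 := by
        calc _ ≤ (I.filter (fun i => ¬ A / (2 * Q) ≤ g i)).card • (A / (2 * Q)) :=
              Finset.sum_le_card_nsmul _ _ _ (fun i hi => (not_le.1 (Finset.mem_filter.1 hi).2).le)
          _ ≤ Q * (A / (2 * Q)) := by
              rw [nsmul_eq_mul]
              gcongr
              exact Nat.cast_le.2 (Finset.card_le_card (Finset.filter_subset _ _))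
          _ = _ := by field_simp
      linarith
    have h4 : ∑ i ∈ I', g i ≤ I'.card * (U0.card * M) := by
      rw [← nsmul_eq_mul]
      exact Finset.sum_le_card_nsmul _ _ _ fun i _ => hgle i
    have h5 : U0.card * η / 2 ≤ I'.card * (U0.card * M) := by linarith
    have h6 : (U0.card : ℝ) * (η / 2) ≤ U0.card * (I'.card * M) := by linarith
    have h7 := le_of_mul_le_mul_left h6 hU0pos
    rw [div_le_iff₀ (by positivity)]
    rw [hη] at h7
    have h8 : m / (2 * M) / 2 = m / (4 * M) := by field_simp; norm_num
    rw [h8, div_le_iff₀ (by positivity)] at h7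
    linarith
  · rw [div_le_div_iff₀ (by positivity) (by positivity)]
    have h1 : (U0.card : ℝ) * m ≤ A * (2 * M) := by
      rw [hη, ← mul_div_assoc, div_le_iff₀ (by positivity)] at hA1; exact hA1
    calc m * U0.card * (2 * Q * M) = (U0.card * m) * (2 * Q * M) := by ring
      _ ≤ (A * (2 * M)) * (2 * Q * M) := by gcongr
      _ = _ := by ring
  · have h1 : m ^ 2 / (4 * Q ^ 2 * M ^ 3) = (m ^ 2 / (2 * Q * M ^ 2)) / (2 * Q * M) := by
      field_simp; norm_num
    rw [h1]; gcongr
  · intro j hj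
    rw [hI', Finset.mem_filter] at hj
    obtain ⟨hj, hgj⟩ := hj
    have h1 := fiber_sum (lam j) U0 Y (W j) (G j) (fun u hu => hW j hj u (hU0U hu)) (fun _ => 1)
    simp only [one_mul, Finset.sum_const, nsmul_eq_mul, mul_one] at h1
    obtain ⟨w', hw', hc⟩ := exists_ge_of_sum (W j) (fun w => ((U0.filter
      (fun u => (u, w - lam j * u) ∈ G j ∧ w - lam j * u ∈ Y)).card : ℝ)) M (A / (2 * Q * M))
      (hWM j hj) hM (by positivity) (by
        rw [h1]
        calc M * (A / (2 * Q * M)) = A / (2 * Q) := by field_simp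
          _ ≤ _ := hgj)
    exact ⟨_, Finset.filter_subset _ _, hc, w', fun c hc => (Finset.mem_filter.1 hc).2.2⟩

lemma core_arith (u M J γ s D E : ℝ) (hu : 0 < u) (hM : 0 < M) (hJ : 0 < J) 
    (hD0 : 0 ≤ D) (hE0 : 0 ≤ E) (hs : 0 ≤ s)
    (h1 : u / (64 * J ^ 2) ≤ γ) (h2 : M / (1024 * J ^ 4) ≤ γ)
    (hD : D ≤ 2 ^ 19 * J ^ 7 * M) (hE : E ≤ 2 ^ 85 * J ^ 31 * M)
    (h : γ ^ 6 * s ^ 2 ≤ (s ^ 2 * u ^ 2 + 2 * u ^ 4) * D ^ 2 * E) (hs0 : 0 < s) :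
    M ≤ 2 ^ 176 * J ^ 65 ∨ s ^ 2 ≤ 2 ^ 169 * J ^ 61 * M := by
  have hDE : D ^ 2 * E ≤ 2 ^ 123 * J ^ 45 * M ^ 3 := by
    calc D ^ 2 * E ≤ (2 ^ 19 * J ^ 7 * M) ^ 2 * (2 ^ 85 * J ^ 31 * M) := by gcongr
      _ = _ := by ring
  have hγ : 0 < γ := lt_of_lt_of_le (by positivity) h1
  by_cases hc : 2 * u ^ 4 ≤ s ^ 2 * u ^ 2
  · left
    have e1 : γ ^ 6 * s ^ 2 ≤ (2 * (s ^ 2 * u ^ 2)) * (2 ^ 123 * J ^ 45 * M ^ 3) := by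
      calc _ ≤ (s ^ 2 * u ^ 2 + 2 * u ^ 4) * (D ^ 2 * E) := by linarith
        _ ≤ (2 * (s ^ 2 * u ^ 2)) * (D ^ 2 * E) := by
          refine mul_le_mul_of_nonneg_right ?_ (by positivity); linarith
        _ ≤ _ := by gcongr
    have e2 : (u / (64 * J ^ 2)) ^ 2 * (M / (1024 * J ^ 4)) ^ 4 * s ^ 2 ≤ γ ^ 6 * s ^ 2 := by
      calc _ ≤ γ ^ 2 * γ ^ 4 * s ^ 2 := by gcongr
        _ = _ := by ring
    have e3 := e2.trans e1
    have e4 : (u / (64 * J ^ 2)) ^ 2 * (M / (1024 * J ^ 4)) ^ 4 * s ^ 2 =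
      (u ^ 2 * s ^ 2 * M ^ 3 / (2 ^ 52 * J ^ 20)) * M := by field_simp; norm_num
    rw [e4] at e3
    have e5 : 0 < u ^ 2 * s ^ 2 * M ^ 3 / (2 ^ 52 * J ^ 20) := by positivity
    refine le_of_mul_le_mul_left (e3.trans (le_of_eq ?_)) e5
    field_simp
  · right
    push Not at hc
    have e1 : γ ^ 6 * s ^ 2 ≤ (4 * u ^ 4) * (2 ^ 123 * J ^ 45 * M ^ 3) := by
      calc _ ≤ (s ^ 2 * u ^ 2 + 2 * u ^ 4) * (D ^ 2 * E) := by linarith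
        _ ≤ (4 * u ^ 4) * (D ^ 2 * E) := by
          refine mul_le_mul_of_nonneg_right ?_ (by positivity); linarith
        _ ≤ _ := by gcongr
    have e2 : (u / (64 * J ^ 2)) ^ 4 * (M / (1024 * J ^ 4)) ^ 2 * s ^ 2 ≤ γ ^ 6 * s ^ 2 := by
      calc _ ≤ γ ^ 4 * γ ^ 2 * s ^ 2 := by gcongr
        _ = _ := by ring
    have e3 := e2.trans e1
    have e4 : (u / (64 * J ^ 2)) ^ 4 * (M / (1024 * J ^ 4)) ^ 2 * s ^ 2 =
      (u ^ 4 * M ^ 2 / (2 ^ 44 * J ^ 16)) * s ^ 2 := by field_simp; norm_num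
    rw [e4] at e3
    have e5 : 0 < u ^ 4 * M ^ 2 / (2 ^ 44 * J ^ 16) := by positivity
    refine le_of_mul_le_mul_left (e3.trans (le_of_eq ?_)) e5
    field_simp; norm_num

open Pointwise in
lemma pl_bound {F : Type*} [Field F] [DecidableEq F] (Y : Finset F) (M J : ℝ) (hM : 0 < M)
    (hJ : 0 < J) (hY : M / (8 * J) ≤ Y.card) (hYY : ((Y - Y).card : ℝ) ≤ 2 ^ 19 * J ^ 7 * M) :
    ((2 • Y - 2 • Y).card : ℝ) ≤ 2 ^ 85 * J ^ 31 * M := by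
  have hYpos : (0 : ℝ) < Y.card := lt_of_lt_of_le (by positivity) hY
  have hne : Y.Nonempty := Finset.card_pos.1 (by exact_mod_cast hYpos)
  have h := Finset.pluennecke_ruzsa_inequality_nsmul_sub_nsmul_sub hne Y 2 2
  have h' : ((2 • Y - 2 • Y).card : ℝ) ≤ ((Y - Y).card / Y.card : ℝ) ^ 4 * Y.card := by
    have := (NNRat.cast_le (K := ℝ)).2 h
    push_cast at this
    exact this
  refine h'.trans ?_
  calc ((Y - Y).card / Y.card : ℝ) ^ 4 * Y.card = ((Y - Y).card : ℝ) ^ 4 / (Y.card : ℝ) ^ 3 := by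
        field_simp
    _ ≤ (2 ^ 19 * J ^ 7 * M) ^ 4 / (M / (8 * J)) ^ 3 := by gcongr
    _ = _ := by field_simp; norm_num

open Pointwise in
lemma core_lemma (p : ℕ) [Fact p.Prime] (I : Finset (ZMod p)) (lam : ZMod p → ZMod p)
    (U V : Finset (ZMod p)) (W : ZMod p → Finset (ZMod p)) (G : ZMod p → Finset (ZMod p × ZMod p))
    (hlam : ∀ i ∈ I, lam i ≠ 0) (hinj : ∀ i ∈ I, ∀ j ∈ I, lam i = lam j → i = j)
    (hW : ∀ i ∈ I, ∀ u ∈ U, ∀ v ∈ V, (u, v) ∈ G i → v + lam i * u ∈ W i)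
    (M J : ℝ) (hM : 0 < M) (hJ : 0 < J)
    (hU : (U.card : ℝ) ≤ M) (hV : (V.card : ℝ) ≤ M) (hWM : ∀ i ∈ I, ((W i).card : ℝ) ≤ M)
    (hm : I.card * M ^ 2 / J ≤ ∑ v ∈ V, ∑ i ∈ I, ((U.filter (fun u => (u, v) ∈ G i)).card : ℝ))
    (s : ℕ) (hs2 : 2 ≤ s) (hsp : s * s ≤ p) (hsI : (s : ℝ) ≤ I.card / (64 * J ^ 2)) :
    M ≤ 2 ^ 176 * J ^ 65 ∨ (s : ℝ) ^ 2 ≤ 2 ^ 169 * J ^ 61 * M := by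
  have hs0 : (0 : ℝ) < s := by exact_mod_cast (by omega : 0 < s)
  have hQ : 0 < (I.card : ℝ) := by
    by_contra h
    have : (I.card : ℝ) = 0 := le_antisymm (not_lt.1 h) (Nat.cast_nonneg _)
    rw [this] at hsI; simp at hsI; linarith
  obtain ⟨Y, hYV, hYc, hYY, hm1⟩ := core_Y I lam U V W G hlam hW M J hM hJ hQ hU hV hWM hm
  have hYM : (Y.card : ℝ) ≤ M := le_trans (by exact_mod_cast Finset.card_le_card hYV) hV
  obtain ⟨U0, hU0, hU0p, hUU, I', hI', hI'c, γ, hγ1, hγ2, hC⟩ := core_U I lam U Y W G hlam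
    (fun i hi u hu v hv => hW i hi u hu v (hYV hv)) M (I.card * M ^ 2 / (16 * J ^ 2)) hM hQ hU hYM hWM
    (by positivity) hm1
  have e1 : (I.card : ℝ) * M ^ 2 / (16 * J ^ 2) / (4 * M ^ 2) = I.card / (64 * J ^ 2) := by
    field_simp; norm_num
  have e2 : (I.card : ℝ) * M ^ 2 / (16 * J ^ 2) * U0.card / (4 * M ^ 2 * I.card) =
      U0.card / (64 * J ^ 2) := by field_simp; norm_num
  have e3 : ((I.card : ℝ) * M ^ 2 / (16 * J ^ 2)) ^ 2 / (4 * I.card ^ 2 * M ^ 3) =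
      M / (1024 * J ^ 4) := by field_simp; norm_num
  rw [e1] at hI'c
  rw [e2] at hγ1
  rw [e3] at hγ2
  have hsc : s ≤ (I'.image lam).card := by
    rw [Finset.card_image_of_injOn (fun i hi j hj h => hinj i (hI' hi) j (hI' hj) h)]
    exact_mod_cast hsI.trans hI'c
  obtain ⟨A, hA, hAs⟩ := Finset.exists_subset_card_eq hsc
  have hfin := core_final p Y U0 A (by omega) (by rw [hAs]; exact hsp)
    (by
      intro h
      obtain ⟨i, hi, h0⟩ := Finset.mem_image.1 (hA h)
      exact hlam i (hI' hi) h0) γ (le_trans (by positivity) hγ1)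
    (by
      intro l hl
      obtain ⟨i, hi, rfl⟩ := Finset.mem_image.1 (hA hl)
      exact hC i hi)
  rw [hAs] at hfin
  have hUU' : ((U0 - U0).card : ℝ) ≤ 2 ^ 19 * J ^ 7 * M := le_trans (by exact_mod_cast hUU) hYY
  exact core_arith U0.card M J γ s (U0 - U0).card (2 • Y - 2 • Y).card hU0p hM hJ
    (Nat.cast_nonneg _) (Nat.cast_nonneg _) hs0.le hγ1 hγ2 hUU' (pl_bound Y M J hM hJ hYc hYY) hfin hs0

lemma fiber_card_le {α : Type*} [DecidableEq α] (P : Finset α) (L : α → α → Finset α)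
    (hL1 : ∀ q ∈ P, ∀ r ∈ P, q ≠ r → q ∈ L q r ∧ r ∈ L q r) (T : Finset (α × α))
    (hT : T ⊆ P.offDiag) (l : Finset α) :
    (T.filter (fun x => L x.1 x.2 = l)).card ≤ l.card ^ 2 := by
  rw [sq, ← Finset.card_product]
  apply Finset.card_le_card
  rintro ⟨q, r⟩ hx
  rw [Finset.mem_filter] at hx
  obtain ⟨hx, rfl⟩ := hx
  have h := Finset.mem_offDiag.1 (hT hx)
  rw [Finset.mem_product]
  exact hL1 q h.1 r h.2.1 h.2.2

lemma light_pairs {α : Type*} [DecidableEq α] (P : Finset α) (L : α → α → Finset α)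
    (hL1 : ∀ q ∈ P, ∀ r ∈ P, q ≠ r → q ∈ L q r ∧ r ∈ L q r) (k H : ℝ)
    (hH : ((P.offDiag.image (fun x => L x.1 x.2)).card : ℝ) ≤ H) :
    ((P.offDiag.filter (fun x => ((L x.1 x.2).card : ℝ) < k)).card : ℝ) ≤ H * k ^ 2 := by
  set T := P.offDiag.filter (fun x => ((L x.1 x.2).card : ℝ) < k) with hT
  have hTs : T ⊆ P.offDiag := Finset.filter_subset _ _
  have h1 : T.card = ∑ l ∈ T.image (fun x => L x.1 x.2), (T.filter (fun x => L x.1 x.2 = l)).card :=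
    Finset.card_eq_sum_card_fiberwise (fun x hx => Finset.mem_image_of_mem _ hx)
  rw [h1]
  push_cast
  calc _ ≤ ∑ l ∈ T.image (fun x => L x.1 x.2), k ^ 2 := by
        refine Finset.sum_le_sum fun l hl => ?_
        obtain ⟨x, hx, rfl⟩ := Finset.mem_image.1 hl
        have hk := (Finset.mem_filter.1 hx).2
        calc _ ≤ (((L x.1 x.2).card ^ 2 : ℕ) : ℝ) := by
              exact_mod_cast fiber_card_le P L hL1 T hTs _
          _ = ((L x.1 x.2).card : ℝ) ^ 2 := by push_cast; rfl
          _ ≤ k ^ 2 := by gcongr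
    _ = (T.image (fun x => L x.1 x.2)).card * k ^ 2 := by rw [Finset.sum_const, nsmul_eq_mul]
    _ ≤ H * k ^ 2 := by
        gcongr
        refine le_trans ?_ hH
        exact_mod_cast Finset.card_le_card (Finset.image_subset_image hTs)

lemma heavy_pairs {α : Type*} [DecidableEq α] (P : Finset α) (L : α → α → Finset α)
    (hL1 : ∀ q ∈ P, ∀ r ∈ P, q ≠ r → q ∈ L q r ∧ r ∈ L q r)
    (hLP : ∀ q r, L q r ⊆ P)
    (hL2 : ∀ q ∈ P, ∀ r ∈ P, q ≠ r → ∀ x ∈ L q r, ∀ y ∈ L q r, x ≠ y → L x y = L q r)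
    (K X : ℝ) (hK0 : 0 < K) (hK : 4 * (P.card : ℝ) ≤ K ^ 2)
    (hX0 : 0 ≤ X) (hX : ∀ q ∈ P, ∀ r ∈ P, q ≠ r → ((L q r).card : ℝ) ≤ X) :
    ((P.offDiag.filter (fun x => K ≤ ((L x.1 x.2).card : ℝ))).card : ℝ) ≤ X * (4 * P.card / 3) := by
  set T := P.offDiag.filter (fun x => K ≤ ((L x.1 x.2).card : ℝ)) with hT
  have hTs : T ⊆ P.offDiag := Finset.filter_subset _ _
  set Lh := T.image (fun x => L x.1 x.2) with hLh
  set In : ℝ := ∑ l ∈ Lh, (l.card : ℝ) with hIn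
  have hmem : ∀ l ∈ Lh, ∃ q ∈ P, ∃ r ∈ P, q ≠ r ∧ L q r = l ∧ K ≤ (l.card : ℝ) := by
    intro l hl
    obtain ⟨x, hx, rfl⟩ := Finset.mem_image.1 hl
    have h := Finset.mem_offDiag.1 (hTs hx)
    exact ⟨_, h.1, _, h.2.1, h.2.2, rfl, (Finset.mem_filter.1 hx).2⟩
  have h1 : (T.card : ℝ) ≤ X * In := by
    have h1 : T.card = ∑ l ∈ Lh, (T.filter (fun x => L x.1 x.2 = l)).card :=
      Finset.card_eq_sum_card_fiberwise (fun x hx => Finset.mem_image_of_mem _ hx)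
    rw [h1]
    push_cast
    rw [hIn, Finset.mul_sum]
    refine Finset.sum_le_sum fun l hl => ?_
    obtain ⟨q, hq, r, hr, hne, rfl, -⟩ := hmem l hl
    calc _ ≤ (((L q r).card ^ 2 : ℕ) : ℝ) := by
              exact_mod_cast fiber_card_le P L hL1 T hTs _
      _ = ((L q r).card : ℝ) * (L q r).card := by push_cast; ring
      _ ≤ _ := by gcongr; exact hX q hq r hr hne
  have h2 : (Lh.card : ℝ) * K ≤ In := by
    rw [← nsmul_eq_mul]
    apply Finset.card_nsmul_le_sum
    intro l hl
    obtain ⟨_, _, _, _, _, _, h⟩ := hmem l hl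
    exact h
  have h3 : In = ∑ q ∈ P, ((Lh.filter (fun l => q ∈ l)).card : ℝ) := by
    have := Finset.sum_card_bipartiteAbove_eq_sum_card_bipartiteBelow (s := P) (t := Lh)
      (fun q l => q ∈ l)
    simp only [Finset.bipartiteAbove, Finset.bipartiteBelow] at this
    have h' : ∑ q ∈ P, ((Lh.filter (fun l => q ∈ l)).card : ℝ) =
        ∑ l ∈ Lh, ((P.filter (fun q => q ∈ l)).card : ℝ) := by exact_mod_cast this
    rw [h', hIn]
    refine Finset.sum_congr rfl fun l hl => ?_
    obtain ⟨q, hq, r, hr, hne, rfl, -⟩ := hmem l hl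
    congr 2
    ext x
    rw [Finset.mem_filter]
    exact ⟨fun h => ⟨hLP _ _ h, h⟩, fun h => h.2⟩
  have h4 : ∑ q ∈ P, ((Lh.filter (fun l => q ∈ l)).card : ℝ) ^ 2 ≤ In + (Lh.card : ℝ) ^ 2 := by
    have e1 : ∀ q ∈ P, ((Lh.filter (fun l => q ∈ l)).card : ℝ) ^ 2 =
        (((Lh ×ˢ Lh).filter (fun x => q ∈ x.1 ∧ q ∈ x.2)).card : ℝ) := by
      intro q _
      rw [Finset.filter_product (fun l => q ∈ l) (fun l => q ∈ l), Finset.card_product]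
      push_cast; ring
    rw [Finset.sum_congr rfl e1]
    have := Finset.sum_card_bipartiteAbove_eq_sum_card_bipartiteBelow (s := P) (t := Lh ×ˢ Lh)
      (fun q x => q ∈ x.1 ∧ q ∈ x.2)
    simp only [Finset.bipartiteAbove, Finset.bipartiteBelow] at this
    have h' : ∑ q ∈ P, (((Lh ×ˢ Lh).filter (fun x => q ∈ x.1 ∧ q ∈ x.2)).card : ℝ) =
        ∑ x ∈ Lh ×ˢ Lh, ((P.filter (fun q => q ∈ x.1 ∧ q ∈ x.2)).card : ℝ) := by exact_mod_cast this
    rw [h']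
    calc _ ≤ ∑ x ∈ Lh ×ˢ Lh, ((if x.1 = x.2 then (x.1.card : ℝ) else 0) + 1) := by
          refine Finset.sum_le_sum fun x hx => ?_
          rw [Finset.mem_product] at hx
          by_cases he : x.1 = x.2
          · rw [if_pos he]
            have : (P.filter (fun q => q ∈ x.1 ∧ q ∈ x.2)).card ≤ x.1.card := by
              apply Finset.card_le_card
              intro q hq
              exact (Finset.mem_filter.1 hq).2.1
            have : ((P.filter (fun q => q ∈ x.1 ∧ q ∈ x.2)).card : ℝ) ≤ x.1.card := by
              exact_mod_cast this
            linarith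
          · rw [if_neg he, zero_add]
            have : (P.filter (fun q => q ∈ x.1 ∧ q ∈ x.2)).card ≤ 1 := by
              rw [Finset.card_le_one]
              intro a ha b hb
              by_contra hab
              rw [Finset.mem_filter] at ha hb
              obtain ⟨q, hq, r, hr, hne, h5, -⟩ := hmem _ hx.1
              obtain ⟨q', hq', r', hr', hne', h6, -⟩ := hmem _ hx.2
              apply he
              rw [← h5, ← h6, ← hL2 q hq r hr hne a (h5 ▸ ha.2.1) b (h5 ▸ hb.2.1) hab,
                ← hL2 q' hq' r' hr' hne' a (h6 ▸ ha.2.2) b (h6 ▸ hb.2.2) hab]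
            exact_mod_cast this
      _ = _ := by
        rw [Finset.sum_add_distrib, Finset.sum_const, Finset.card_product, Finset.sum_product, hIn]
        congr 1
        · refine Finset.sum_congr rfl fun l hl => ?_
          simp only
          rw [Finset.sum_ite_eq, if_pos hl]
        · simp; ring
  have h5 : In ^ 2 ≤ P.card * (In + (Lh.card : ℝ) ^ 2) := by
    calc In ^ 2 ≤ P.card * ∑ q ∈ P, ((Lh.filter (fun l => q ∈ l)).card : ℝ) ^ 2 := by
          rw [h3]; exact sq_sum_le_card_mul_sum_sq
      _ ≤ _ := by gcongr
  have hIn0 : 0 ≤ In := Finset.sum_nonneg fun _ _ => Nat.cast_nonneg _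
  have h6 : 4 * ((P.card : ℝ) * (Lh.card : ℝ) ^ 2) ≤ In ^ 2 := by
    calc 4 * ((P.card : ℝ) * (Lh.card : ℝ) ^ 2) = (4 * P.card) * (Lh.card : ℝ) ^ 2 := by ring
      _ ≤ K ^ 2 * (Lh.card : ℝ) ^ 2 := by gcongr
      _ = ((Lh.card : ℝ) * K) ^ 2 := by ring
      _ ≤ In ^ 2 := by gcongr
  have h7 : In ≤ 4 * P.card / 3 := by
    by_contra hc
    push Not at hc
    have hp : (0 : ℝ) ≤ P.card := Nat.cast_nonneg _
    have : 0 < In := lt_of_le_of_lt (by positivity) hc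
    nlinarith
  exact h1.trans (by gcongr)

/-- Collinearity of three points of the plane. -/
def Clr {F : Type*} [Field F] (q r s : F × F) : Prop :=
  (r.1 - q.1) * (s.2 - q.2) = (r.2 - q.2) * (s.1 - q.1)

instance {F : Type*} [Field F] [DecidableEq F] (q r s : F × F) : Decidable (Clr q r s) :=
  inferInstanceAs (Decidable (_ = _))

/-- The points of `P` on the line through `q` and `r`. -/
def lnP {F : Type*} [Field F] [DecidableEq F] (P : Finset (F × F)) (q r : F × F) : Finset (F × F) :=
  P.filter (fun s => Clr q r s)

lemma par_trans {F : Type*} [Field F] (d1 d2 e1 e2 z1 z2 : F) (he : ¬ (e1 = 0 ∧ e2 = 0))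
    (h1 : d1 * e2 = d2 * e1) (h2 : e1 * z2 = e2 * z1) : d1 * z2 = d2 * z1 := by
  by_cases h : e1 = 0
  · have h' : e2 ≠ 0 := fun h' => he ⟨h, h'⟩
    apply mul_left_cancel₀ h'
    subst h
    have : d1 = 0 := by
      have : d1 * e2 = 0 := by rw [h1]; ring
      exact (mul_eq_zero.1 this).resolve_right h'
    have h3 : z1 = 0 := by
      have : e2 * z1 = 0 := by rw [← h2]; ring
      exact (mul_eq_zero.1 this).resolve_left h'
    rw [this, h3]; ring
  · apply mul_left_cancel₀ h
    linear_combination d1 * h2 + z1 * h1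

lemma clr_trans {F : Type*} [Field F] (q r x y s : F × F) (hxy : x ≠ y)
    (hx : Clr q r x) (hy : Clr q r y) (hs : Clr x y s) : Clr q r s := by
  unfold Clr at *
  have hd : (r.1 - q.1) * (y.2 - x.2) = (r.2 - q.2) * (y.1 - x.1) := by linear_combination hy - hx
  have := par_trans _ _ _ _ _ _ (by
    rintro ⟨h1, h2⟩
    exact hxy (Prod.ext (sub_eq_zero.1 h1).symm (sub_eq_zero.1 h2).symm)) hd hs
  linear_combination this + hx

lemma clr_left {F : Type*} [Field F] (q r : F × F) : Clr q r q := by unfold Clr; ring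

lemma clr_right {F : Type*} [Field F] (q r : F × F) : Clr q r r := by unfold Clr; ring

lemma clr_iff {F : Type*} [Field F] (q r x y s : F × F) (hqr : q ≠ r) (hxy : x ≠ y)
    (hx : Clr q r x) (hy : Clr q r y) : Clr x y s ↔ Clr q r s := by
  refine ⟨clr_trans q r x y s hxy hx hy, fun h => ?_⟩
  have hd : (r.1 - q.1) * (y.2 - x.2) = (r.2 - q.2) * (y.1 - x.1) := by
    unfold Clr at *; linear_combination hy - hx
  refine clr_trans x y q r s hqr ?_ ?_ h
  all_goals
    unfold Clr at *
    have hne : ¬ (r.1 - q.1 = 0 ∧ r.2 - q.2 = 0) := by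
      rintro ⟨h1, h2⟩
      exact hqr (Prod.ext (sub_eq_zero.1 h1).symm (sub_eq_zero.1 h2).symm)
  · exact par_trans (y.1 - x.1) (y.2 - x.2) (r.1 - q.1) (r.2 - q.2) (q.1 - x.1) (q.2 - x.2) hne
      (by linear_combination -hd) (by linear_combination -hx)
  · exact par_trans (y.1 - x.1) (y.2 - x.2) (r.1 - q.1) (r.2 - q.2) (r.1 - x.1) (r.2 - x.2) hne
      (by linear_combination -hd) (by linear_combination -hx)

lemma lnP_mem {F : Type*} [Field F] [DecidableEq F] (P : Finset (F × F)) :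
    ∀ q ∈ P, ∀ r ∈ P, q ≠ r → q ∈ lnP P q r ∧ r ∈ lnP P q r := by
  intro q hq r hr _
  exact ⟨Finset.mem_filter.2 ⟨hq, clr_left q r⟩, Finset.mem_filter.2 ⟨hr, clr_right q r⟩⟩

lemma lnP_eq {F : Type*} [Field F] [DecidableEq F] (P : Finset (F × F)) :
    ∀ q ∈ P, ∀ r ∈ P, q ≠ r → ∀ x ∈ lnP P q r, ∀ y ∈ lnP P q r, x ≠ y → lnP P x y = lnP P q r := by
  intro q _ r _ hqr x hx y hy hxy
  ext s
  simp only [lnP, Finset.mem_filter] at hx hy ⊢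
  rw [clr_iff q r x y s hqr hxy hx.2 hy.2]

lemma isLine_clr {F : Type*} [Field F] (q r : F × F) (hqr : q ≠ r) : IsLine {s | Clr q r s} := by
  refine ⟨-(r.2 - q.2), r.1 - q.1, (r.2 - q.2) * q.1 - (r.1 - q.1) * q.2, ?_, ?_⟩
  · intro h
    rw [Prod.mk.injEq] at h
    exact hqr (Prod.ext (sub_eq_zero.1 h.2).symm (sub_eq_zero.1 (neg_eq_zero.1 h.1)).symm)
  · ext s
    simp only [Set.mem_ofPred_eq, Clr]
    constructor
    · intro h; linear_combination h
    · intro h; linear_combination h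

lemma lnP_card_le {F : Type*} [Field F] [Finite F] [DecidableEq F] (P P' : Finset (F × F))
    (hP : P' ⊆ P) : (P'.offDiag.image (fun x => lnP P' x.1 x.2)).card ≤ (linesOf P).ncard := by
  classical
  rw [← Set.ncard_coe_finset]
  have hfin : (linesOf P).Finite := Set.toFinite _
  refine le_trans (Set.ncard_le_ncard ?_ (hfin.image (fun l => P'.filter (fun s => s ∈ l))))
    (Set.ncard_image_le hfin)
  intro l hl
  rw [Finset.mem_coe, Finset.mem_image] at hl
  obtain ⟨⟨q, r⟩, hx, rfl⟩ := hl
  rw [Finset.mem_offDiag] at hx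
  refine ⟨{s | Clr q r s}, ⟨isLine_clr q r hx.2.2, q, hP hx.1, r, hP hx.2.1, hx.2.2,
    clr_left q r, clr_right q r⟩, ?_⟩
  ext s
  simp [lnP]

lemma lnP_card_le_ncard {F : Type*} [Field F] [DecidableEq F] (P : Finset (F × F)) (q r : F × F) :
    (lnP P q r).card = ((P : Set (F × F)) ∩ {s | Clr q r s}).ncard := by
  rw [← Set.ncard_coe_finset]
  congr 1
  ext s
  simp [lnP]

lemma mem_colset {F : Type*} [DecidableEq F] (R : Finset (F × F)) (a t : F) :
    t ∈ (R.filter (fun q => q.1 = a)).image Prod.snd ↔ (a, t) ∈ R := by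
  simp only [Finset.mem_image, Finset.mem_filter]
  constructor
  · rintro ⟨⟨x, y⟩, ⟨h1, h2⟩, h3⟩
    simp only at h2 h3
    subst h2; subst h3; exact h1
  · intro h
    exact ⟨(a, t), ⟨h, rfl⟩, rfl⟩

lemma third_count {F : Type*} [Field F] [DecidableEq F] (R : Finset (F × F)) (a1 a2 u v : F)
    (hne : a1 ≠ a2) (k : ℝ) (hk4 : 4 ≤ k) (hk : k ≤ ((lnP R (a1, u) (a2, v)).card : ℝ)) :
    k / 2 ≤ ((((R.image Prod.fst) \ {a1, a2}).filter
      (fun i => (i, ((a2 - i) * u + (i - a1) * v) / (a2 - a1)) ∈ R)).card : ℝ) := by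
  have hne' : a2 - a1 ≠ 0 := sub_ne_zero.2 hne.symm
  have key : ∀ s, Clr (a1, u) (a2, v) s →
      s.2 = ((a2 - s.1) * u + (s.1 - a1) * v) / (a2 - a1) := by
    intro s hs
    unfold Clr at hs
    simp only at hs
    rw [eq_div_iff hne']
    linear_combination hs
  have h1 : (lnP R (a1, u) (a2, v) \ {(a1, u), (a2, v)}).card ≤
      (((R.image Prod.fst) \ {a1, a2}).filter
      (fun i => (i, ((a2 - i) * u + (i - a1) * v) / (a2 - a1)) ∈ R)).card := by
    apply Finset.card_le_card_of_injOn Prod.fst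
    · intro s hs
      rw [Finset.mem_coe, Finset.mem_sdiff, lnP, Finset.mem_filter] at hs
      obtain ⟨⟨hsR, hcl⟩, hs2⟩ := hs
      have hk := key s hcl
      simp only [Finset.mem_insert, Finset.mem_singleton, not_or] at hs2
      rw [Finset.mem_coe, Finset.mem_filter, Finset.mem_sdiff]
      refine ⟨⟨Finset.mem_image_of_mem _ hsR, ?_⟩, ?_⟩
      · simp only [Finset.mem_insert, Finset.mem_singleton, not_or]
        constructor
        · intro h
          apply hs2.1
          refine Prod.ext h ?_
          rw [hk, h]; field_simp; ring
        · intro h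
          apply hs2.2
          refine Prod.ext h ?_
          rw [hk, h]; field_simp; ring
      · rw [← hk]; exact hsR
    · intro s hs s' hs' h
      rw [Finset.mem_coe, Finset.mem_sdiff, lnP, Finset.mem_filter] at hs hs'
      refine Prod.ext h ?_
      rw [key s hs.1.2, key s' hs'.1.2, h]
  have h2 : (lnP R (a1, u) (a2, v)).card ≤ (lnP R (a1, u) (a2, v) \ {(a1, u), (a2, v)}).card + 2 := by
    have h3 := Finset.le_card_sdiff {(a1, u), (a2, v)} (lnP R (a1, u) (a2, v))
    have h4 : ({(a1, u), (a2, v)} : Finset (F × F)).card ≤ 2 := Finset.card_le_two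
    omega
  have h3 : ((lnP R (a1, u) (a2, v)).card : ℝ) ≤ ((((R.image Prod.fst) \ {a1, a2}).filter
      (fun i => (i, ((a2 - i) * u + (i - a1) * v) / (a2 - a1)) ∈ R)).card : ℝ) + 2 := by
    exact_mod_cast h2.trans (Nat.add_le_add_right h1 2)
  linarith

lemma good_cols {F : Type*} [Field F] [DecidableEq F] (R : Finset (F × F)) (M k : ℝ) (hM : 0 < M)
    (hcU : ∀ a ∈ R.image Prod.fst, ((R.filter (fun q => q.1 = a)).card : ℝ) ≤ 2 * M)
    (hcL : ∀ a ∈ R.image Prod.fst, M / 2 ≤ ((R.filter (fun q => q.1 = a)).card : ℝ))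
    (hlight : ((R.offDiag.filter (fun x => ((lnP R x.1 x.2).card : ℝ) < k)).card : ℝ) ≤
      (R.card : ℝ) ^ 2 / 4) (h16 : 16 * M ≤ R.card) :
    ∃ a1 a2 : F, a1 ∈ R.image Prod.fst ∧ a2 ∈ R.image Prod.fst ∧ a1 ≠ a2 ∧
      ∃ S : Finset (F × F), M ^ 2 / 8 ≤ S.card ∧ ∀ x ∈ S, (a1, x.1) ∈ R ∧ (a2, x.2) ∈ R ∧
        k ≤ ((lnP R (a1, x.1) (a2, x.2)).card : ℝ) := by
  set A := R.image Prod.fst with hA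
  set n : ℝ := (R.card : ℝ) with hn
  have hn0 : 0 < n := by linarith
  have hRsum : R.card = ∑ a ∈ A, (R.filter (fun q => q.1 = a)).card :=
    Finset.card_eq_sum_card_fiberwise (fun x hx => Finset.mem_image_of_mem _ hx)
  have hnQ : (A.card : ℝ) * (M / 2) ≤ n := by
    rw [hn, hRsum]; push_cast
    rw [← nsmul_eq_mul]
    exact Finset.card_nsmul_le_sum _ _ _ hcL
  have hA0 : (0 : ℝ) < A.card := by
    have : R.Nonempty := Finset.card_pos.1 (by rw [hn] at hn0; exact_mod_cast hn0)
    exact_mod_cast Finset.card_pos.2 (this.image _)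
  set Sm := (R ×ˢ R).filter (fun x => x.2.1 = x.1.1) with hSm
  have hSmc : (Sm.card : ℝ) ≤ n ^ 2 / 8 := by
    have h1 : Sm.card = ∑ q ∈ R, (R.filter (fun r => r.1 = q.1)).card := by
      rw [hSm, Finset.card_filter, Finset.sum_product]
      refine Finset.sum_congr rfl fun q _ => ?_
      rw [Finset.card_filter]
    rw [h1]; push_cast
    calc _ ≤ R.card • (2 * M) := Finset.sum_le_card_nsmul _ _ _
          (fun q hq => hcU _ (Finset.mem_image_of_mem _ hq))
      _ = n * (2 * M) := by rw [nsmul_eq_mul]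
      _ ≤ _ := by nlinarith
  set Lt := R.offDiag.filter (fun x => ((lnP R x.1 x.2).card : ℝ) < k) with hLt
  set Gp := (R ×ˢ R).filter (fun x => x.2.1 ≠ x.1.1 ∧ k ≤ ((lnP R x.1 x.2).card : ℝ)) with hGp
  have hGpc : n ^ 2 / 2 ≤ Gp.card := by
    have hsub : R ×ˢ R ⊆ Gp ∪ (Sm ∪ Lt) := by
      rintro ⟨q, r⟩ hx
      have hx' := Finset.mem_product.1 hx
      simp only [Finset.mem_union, hGp, hSm, hLt, Finset.mem_filter, hx, true_and, Finset.mem_offDiag]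
      by_cases h : r.1 = q.1
      · exact Or.inr (Or.inl h)
      · by_cases h2 : k ≤ ((lnP R q r).card : ℝ)
        · exact Or.inl ⟨h, h2⟩
        · refine Or.inr (Or.inr ⟨⟨hx'.1, hx'.2, ?_⟩, not_le.1 h2⟩)
          rintro h3
          exact h (by rw [h3])
    have h1 := (Finset.card_le_card hsub).trans ((Finset.card_union_le _ _).trans
          (Nat.add_le_add_left (Finset.card_union_le _ _) _))
    rw [Finset.card_product] at h1
    have h2 : n * n ≤ Gp.card + (Sm.card + Lt.card) := by rw [hn]; exact_mod_cast h1
    nlinarith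
  have hfib : Gp.card = ∑ y ∈ A ×ˢ A, (Gp.filter (fun x => (x.1.1, x.2.1) = y)).card := by
    refine Finset.card_eq_sum_card_fiberwise (fun x hx => ?_)
    have := Finset.mem_product.1 (Finset.mem_filter.1 (Finset.mem_coe.1 hx)).1
    exact Finset.mem_coe.2 (Finset.mem_product.2
      ⟨Finset.mem_image.2 ⟨x.1, this.1, rfl⟩, Finset.mem_image.2 ⟨x.2, this.2, rfl⟩⟩)
  rw [hfib] at hGpc
  push_cast at hGpc
  obtain ⟨⟨a1, a2⟩, ha, hge⟩ := exists_ge_of_sum (A ×ˢ A)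
    (fun y => ((Gp.filter (fun x => (x.1.1, x.2.1) = y)).card : ℝ)) ((A.card : ℝ) ^ 2) (M ^ 2 / 8)
    (by rw [Finset.card_product]; push_cast; rw [sq]) (by positivity) (by positivity)
    (by
      refine le_trans ?_ hGpc
      have : ((A.card : ℝ) * (M / 2)) ^ 2 ≤ n ^ 2 := by gcongr
      nlinarith)
  rw [Finset.mem_product] at ha
  set Gs := Gp.filter (fun x => (x.1.1, x.2.1) = (a1, a2)) with hGs
  have hGsm : ∀ x ∈ Gs, x.1 ∈ R ∧ x.2 ∈ R ∧ x.2.1 ≠ x.1.1 ∧ k ≤ ((lnP R x.1 x.2).card : ℝ) ∧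
      x.1.1 = a1 ∧ x.2.1 = a2 := by
    intro x hx
    simp only [hGs, hGp, Finset.mem_filter, Finset.mem_product, Prod.mk.injEq] at hx
    tauto
  have hGs0 : 0 < Gs.card := by
    have : (0 : ℝ) < Gs.card := lt_of_lt_of_le (by positivity) hge
    exact_mod_cast this
  obtain ⟨x0, hx0⟩ := Finset.card_pos.1 hGs0
  refine ⟨a1, a2, ha.1, ha.2, ?_, Gs.image (fun x => (x.1.2, x.2.2)), ?_, ?_⟩
  · obtain ⟨_, _, h, _, h1, h2⟩ := hGsm x0 hx0
    rw [h1, h2] at h; exact h.symm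
  · rw [Finset.card_image_of_injOn]
    · exact hge
    · rintro ⟨⟨q1, q2⟩, ⟨r1, r2⟩⟩ hx ⟨⟨q1', q2'⟩, ⟨r1', r2'⟩⟩ hy h
      obtain ⟨_, _, _, _, h1, h2⟩ := hGsm _ hx
      obtain ⟨_, _, _, _, h3, h4⟩ := hGsm _ hy
      simp only at h1 h2 h3 h4
      simp only [Prod.mk.injEq] at h
      simp only [h1, h2, h3, h4, h.1, h.2]
  · intro y hy
    obtain ⟨⟨⟨q1, q2⟩, ⟨r1, r2⟩⟩, hx, rfl⟩ := Finset.mem_image.1 hy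
    obtain ⟨h1, h2, _, h3, h4, h5⟩ := hGsm _ hx
    simp only at h1 h2 h3 h4 h5
    subst h4; subst h5
    exact ⟨h1, h2, h3⟩

lemma cols_core (p : ℕ) [Fact p.Prime] (R : Finset (ZMod p × ZMod p)) (M k J : ℝ) (hM : 0 < M)
    (hcU : ∀ a ∈ R.image Prod.fst, ((R.filter (fun q => q.1 = a)).card : ℝ) ≤ 2 * M)
    (hcL : ∀ a ∈ R.image Prod.fst, M / 2 ≤ ((R.filter (fun q => q.1 = a)).card : ℝ))
    (hlight : ((R.offDiag.filter (fun x => ((lnP R x.1 x.2).card : ℝ) < k)).card : ℝ) ≤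
      (R.card : ℝ) ^ 2 / 4) (h16 : 16 * M ≤ R.card) (hk4 : 4 ≤ k) (hJ0 : 0 < J)
    (hJ : 64 * ((R.image Prod.fst).card : ℝ) ≤ J * k)
    (s : ℕ) (hs2 : 2 ≤ s) (hsp : s * s ≤ p)
    (hs : (s : ℝ) ≤ (((R.image Prod.fst).card : ℝ) - 2) / (64 * J ^ 2)) :
    2 * M ≤ 2 ^ 176 * J ^ 65 ∨ (s : ℝ) ^ 2 ≤ 2 ^ 169 * J ^ 61 * (2 * M) := by
  obtain ⟨a1, a2, ha1, ha2, hne, S, hSc, hS⟩ := good_cols R M k hM hcU hcL hlight h16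
  have hne' : a2 - a1 ≠ 0 := sub_ne_zero.2 hne.symm
  set A := R.image Prod.fst with hA
  set I := A \ {a1, a2} with hI
  set Cl : ZMod p → Finset (ZMod p) := fun a => (R.filter (fun q => q.1 = a)).image Prod.snd with hCl
  have hClm : ∀ a t, t ∈ Cl a ↔ (a, t) ∈ R := fun a t => mem_colset R a t
  have hClc : ∀ a ∈ A, ((Cl a).card : ℝ) ≤ 2 * M := by
    intro a ha
    refine le_trans ?_ (hcU a ha)
    exact_mod_cast Finset.card_image_le
  set G : ZMod p → Finset (ZMod p × ZMod p) := fun i => ((Cl a1) ×ˢ (Cl a2)).filter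
    (fun x => (i, ((a2 - i) * x.1 + (i - a1) * x.2) / (a2 - a1)) ∈ R) with hG
  have hIm : ∀ i ∈ I, i ∈ A ∧ i - a1 ≠ 0 ∧ a2 - i ≠ 0 := by
    intro i hi
    simp only [hI, Finset.mem_sdiff, Finset.mem_insert, Finset.mem_singleton, not_or] at hi
    exact ⟨hi.1, sub_ne_zero.2 hi.2.1, sub_ne_zero.2 (Ne.symm hi.2.2)⟩
  have hIle : (I.card : ℝ) ≤ A.card := by
    exact_mod_cast Finset.card_le_card Finset.sdiff_subset
  have hIge : (A.card : ℝ) - 2 ≤ I.card := by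
    have h3 := Finset.le_card_sdiff {a1, a2} A
    rw [← hI] at h3
    have h4 : ({a1, a2} : Finset (ZMod p)).card ≤ 2 := Finset.card_le_two
    have h5 : A.card ≤ I.card + 2 := by omega
    have : (A.card : ℝ) ≤ I.card + 2 := by exact_mod_cast h5
    linarith
  have hsum : M ^ 2 / 8 * (k / 2) ≤
      ∑ v ∈ Cl a2, ∑ i ∈ I, (((Cl a1).filter (fun u => (u, v) ∈ G i)).card : ℝ) := by
    have e1 : ∑ v ∈ Cl a2, ∑ i ∈ I, (((Cl a1).filter (fun u => (u, v) ∈ G i)).card : ℝ) =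
        ∑ y ∈ Cl a1 ×ˢ Cl a2, ((I.filter (fun i => y ∈ G i)).card : ℝ) := by
      rw [Finset.sum_product_right]
      refine Finset.sum_congr rfl fun v _ => ?_
      have := Finset.sum_card_bipartiteAbove_eq_sum_card_bipartiteBelow (s := I) (t := Cl a1)
        (fun i u => (u, v) ∈ G i)
      simp only [Finset.bipartiteAbove, Finset.bipartiteBelow] at this
      exact_mod_cast this
    rw [e1]
    have hSsub : S ⊆ Cl a1 ×ˢ Cl a2 := by
      intro x hx
      rw [Finset.mem_product, hClm, hClm]
      exact ⟨(hS x hx).1, (hS x hx).2.1⟩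
    calc M ^ 2 / 8 * (k / 2) ≤ S.card * (k / 2) := by gcongr
      _ = S.card • (k / 2) := by rw [nsmul_eq_mul]
      _ ≤ ∑ y ∈ S, ((I.filter (fun i => y ∈ G i)).card : ℝ) := by
        apply Finset.card_nsmul_le_sum
        intro y hy
        obtain ⟨h1, h2, h3⟩ := hS y hy
        refine (third_count R a1 a2 y.1 y.2 hne k hk4 h3).trans (le_of_eq ?_)
        congr 2
        ext i
        have := hSsub hy
        simp only [hG, Finset.mem_filter, this, true_and, hI, hA]
      _ ≤ _ := Finset.sum_le_sum_of_subset_of_nonneg hSsub (fun _ _ _ => Nat.cast_nonneg _)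
  refine core_lemma p I (fun i => (a2 - i) / (i - a1)) (Cl a1) (Cl a2)
    (fun i => (Cl i).image (fun t => t * (a2 - a1) / (i - a1))) G ?_ ?_ ?_ (2 * M) J (by positivity)
    hJ0 (hClc a1 ha1) (hClc a2 ha2) ?_ ?_ s hs2 hsp ?_
  · intro i hi
    obtain ⟨_, h1, h2⟩ := hIm i hi
    exact div_ne_zero h2 h1
  · intro i hi j hj h
    obtain ⟨_, h1, _⟩ := hIm i hi
    obtain ⟨_, h2, _⟩ := hIm j hj
    rw [div_eq_div_iff h1 h2] at h
    have : (a2 - a1) * (j - i) = 0 := by linear_combination h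
    exact (sub_eq_zero.1 ((mul_eq_zero.1 this).resolve_left hne')).symm
  · intro i hi u hu v hv huv
    obtain ⟨_, h1, _⟩ := hIm i hi
    have h3 := (Finset.mem_filter.1 huv).2
    rw [Finset.mem_image]
    refine ⟨_, (hClm _ _).2 h3, ?_⟩
    field_simp
    ring
  · intro i hi
    refine le_trans ?_ (hClc i (hIm i hi).1)
    exact_mod_cast Finset.card_image_le
  · refine le_trans ?_ hsum
    rw [div_le_iff₀ hJ0]
    have h1 : (I.card : ℝ) * 64 ≤ J * k := by linarith
    nlinarith [sq_nonneg M]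
  · refine hs.trans ?_
    gcongr

/-- The projective map sending the point `O` to the vertical point at infinity. -/
def phi {F : Type*} [Field F] (O q : F × F) : F × F :=
  ((q.2 - O.2) / (q.1 - O.1), (q.1 - O.1)⁻¹)

lemma phi_inj {F : Type*} [Field F] (O q r : F × F) (h : phi O q = phi O r)
    (hq : q.1 ≠ O.1) (hr : r.1 ≠ O.1) : q = r := by
  have hq' := sub_ne_zero.2 hq
  have hr' := sub_ne_zero.2 hr
  simp only [phi, Prod.mk.injEq] at h
  have h1 : q.1 - O.1 = r.1 - O.1 := inv_injective h.2
  have h2 := h.1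
  rw [h1, div_left_inj' hr'] at h2
  exact Prod.ext (sub_left_injective h1) (sub_left_injective h2)

lemma phi_fst {F : Type*} [Field F] (O q r : F × F)
    (hq : q.1 ≠ O.1) (hr : r.1 ≠ O.1) : (phi O r).1 = (phi O q).1 ↔ Clr O q r := by
  have hq' := sub_ne_zero.2 hq
  have hr' := sub_ne_zero.2 hr
  simp only [phi, Clr]
  rw [div_eq_div_iff hr' hq']
  constructor
  · intro h; linear_combination h
  · intro h; linear_combination h

lemma phi_clr {F : Type*} [Field F] (O q r s : F × F)
    (hq : q.1 ≠ O.1) (hr : r.1 ≠ O.1) (hs : s.1 ≠ O.1) :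
    Clr (phi O q) (phi O r) (phi O s) ↔ Clr q r s := by
  have hq' := sub_ne_zero.2 hq
  have hr' := sub_ne_zero.2 hr
  have hs' := sub_ne_zero.2 hs
  have key : (((phi O r).1 - (phi O q).1) * ((phi O s).2 - (phi O q).2) -
      ((phi O r).2 - (phi O q).2) * ((phi O s).1 - (phi O q).1)) *
      ((q.1 - O.1) * (r.1 - O.1) * (s.1 - O.1)) =
      ((r.1 - q.1) * (s.2 - q.2) - (r.2 - q.2) * (s.1 - q.1)) := by
    simp only [phi]
    field_simp
    ring
  have hne : ((q.1 - O.1) * (r.1 - O.1) * (s.1 - O.1)) ≠ 0 := by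
    simp [hq', hr', hs']
  unfold Clr
  rw [← sub_eq_zero, ← sub_eq_zero (a := (r.1 - q.1) * (s.2 - q.2)), ← key]
  simp only [mul_eq_zero, hne, or_false]

lemma lnP_phi {F : Type*} [Field F] [DecidableEq F] (P : Finset (F × F)) (O : F × F)
    (hP : ∀ q ∈ P, q.1 ≠ O.1) (q r : F × F) (hq : q ∈ P) (hr : r ∈ P) :
    lnP (P.image (phi O)) (phi O q) (phi O r) = (lnP P q r).image (phi O) := by
  ext y
  simp only [lnP, Finset.mem_filter, Finset.mem_image]
  constructor
  · rintro ⟨⟨s, hs, rfl⟩, h⟩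
    exact ⟨s, ⟨hs, (phi_clr O q r s (hP q hq) (hP r hr) (hP s hs)).1 h⟩, rfl⟩
  · rintro ⟨s, ⟨hs, h⟩, rfl⟩
    exact ⟨⟨s, hs, rfl⟩, (phi_clr O q r s (hP q hq) (hP r hr) (hP s hs)).2 h⟩

lemma choose_O {F : Type*} [Field F] [Finite F] [DecidableEq F] (P : Finset (F × F)) (H k : ℝ)
    (hH : ((linesOf P).ncard : ℝ) ≤ H) (hk : H * k ^ 2 ≤ (P.card : ℝ) ^ 2 / 8)
    (h16 : ∀ q ∈ P, ∀ r ∈ P, q ≠ r → 16 * ((lnP P q r).card : ℝ) ≤ P.card)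
    (h32 : 32 ≤ (P.card : ℝ)) (hsq : 64 * √(P.card : ℝ) ≤ P.card) :
    ∃ O ∈ P, (P.card : ℝ) / 2 ≤ ((P.filter (fun q => q.1 ≠ O.1 ∧ k ≤ ((lnP P O q).card : ℝ) ∧
      ((lnP P O q).card : ℝ) < 2 * √(P.card : ℝ))).card : ℝ) := by
  set n : ℝ := (P.card : ℝ) with hn
  have hn0 : 0 < n := by linarith
  have hsq0 : 0 < √n := Real.sqrt_pos.2 hn0
  have hl := light_pairs P (lnP P) (lnP_mem P) k H
    (le_trans (by exact_mod_cast lnP_card_le P P (Finset.Subset.refl _)) hH)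
  have hh := heavy_pairs P (lnP P) (lnP_mem P) (fun q r => Finset.filter_subset _ _) (lnP_eq P)
    (2 * √n) (n / 16) (by positivity) (by rw [mul_pow, Real.sq_sqrt hn0.le]; linarith)
    (by positivity) (fun q hq r hr hqr => by have := h16 q hq r hr hqr; linarith)
  rw [← hn] at hh
  set B : F × F → Finset (F × F) := fun O => P.filter (fun q => q ≠ O ∧
    (((lnP P O q).card : ℝ) < k ∨ 2 * √n ≤ ((lnP P O q).card : ℝ))) with hB
  have hsum : (∑ O ∈ P, ((B O).card : ℝ)) ≤ 5 * n ^ 2 / 24 := by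
    have h1 : ∑ O ∈ P, (B O).card ≤
        (P.offDiag.filter (fun x => ((lnP P x.1 x.2).card : ℝ) < k)).card +
        (P.offDiag.filter (fun x => 2 * √n ≤ ((lnP P x.1 x.2).card : ℝ))).card := by
      refine le_trans ?_ (Finset.card_union_le _ _)
      rw [← Finset.card_sigma]
      refine Finset.card_le_card_of_injOn (fun x => (x.1, x.2)) ?_ ?_
      · rintro ⟨O, q⟩ hx
        simp only [Finset.mem_coe, Finset.mem_sigma, hB, Finset.mem_filter] at hx
        obtain ⟨hO, hq, hne, h⟩ := hx
        simp only [Finset.mem_coe, Finset.mem_union, Finset.mem_filter, Finset.mem_offDiag]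
        rcases h with h | h
        · exact Or.inl ⟨⟨hO, hq, Ne.symm hne⟩, h⟩
        · exact Or.inr ⟨⟨hO, hq, Ne.symm hne⟩, h⟩
      · rintro ⟨O, q⟩ _ ⟨O', q'⟩ _ h
        simp only [Prod.mk.injEq] at h
        obtain ⟨rfl, rfl⟩ := h
        rfl
    have h2 : (∑ O ∈ P, ((B O).card : ℝ)) ≤
        ((P.offDiag.filter (fun x => ((lnP P x.1 x.2).card : ℝ) < k)).card : ℝ) +
        ((P.offDiag.filter (fun x => 2 * √n ≤ ((lnP P x.1 x.2).card : ℝ))).card : ℝ) := by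
      exact_mod_cast h1
    have h3 : n / 16 * (4 * n / 3) = n ^ 2 / 12 := by ring
    linarith
  have hex : ∃ O ∈ P, ((B O).card : ℝ) ≤ n / 4 := by
    by_contra hcon
    push Not at hcon
    have h1 : P.card • (n / 4) ≤ ∑ O ∈ P, ((B O).card : ℝ) :=
      Finset.card_nsmul_le_sum _ _ _ (fun O hO => (hcon O hO).le)
    rw [nsmul_eq_mul, ← hn] at h1
    nlinarith
  obtain ⟨O, hO, hBO⟩ := hex
  refine ⟨O, hO, ?_⟩
  set P1 := P.filter (fun q => q.1 ≠ O.1 ∧ k ≤ ((lnP P O q).card : ℝ) ∧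
      ((lnP P O q).card : ℝ) < 2 * √n) with hP1
  set V := P.filter (fun q => q ≠ O ∧ q.1 = O.1 ∧ ((lnP P O q).card : ℝ) < 2 * √n) with hV
  have hVc : (V.card : ℝ) ≤ 2 * √n := by
    rcases V.eq_empty_or_nonempty with h | ⟨q0, h0⟩
    · rw [h]; simp
    · have h0' := (Finset.mem_filter.1 h0).2
      refine le_trans ?_ h0'.2.2.le
      have : V ⊆ lnP P O q0 := by
        intro q hq
        have hq' := Finset.mem_filter.1 hq
        refine Finset.mem_filter.2 ⟨hq'.1, ?_⟩
        unfold Clr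
        rw [h0'.2.1, hq'.2.2.1]; ring
      exact_mod_cast Finset.card_le_card this
  have hsub : P ⊆ P1 ∪ ({O} ∪ (B O ∪ V)) := by
    intro q hq
    simp only [Finset.mem_union, Finset.mem_singleton, hP1, hB, hV, Finset.mem_filter, hq, true_and]
    by_cases h1 : q = O
    · exact Or.inr (Or.inl h1)
    by_cases h2 : ((lnP P O q).card : ℝ) < k
    · exact Or.inr (Or.inr (Or.inl ⟨h1, Or.inl h2⟩))
    by_cases h3 : 2 * √n ≤ ((lnP P O q).card : ℝ)
    · exact Or.inr (Or.inr (Or.inl ⟨h1, Or.inr h3⟩))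
    by_cases h4 : q.1 = O.1
    · exact Or.inr (Or.inr (Or.inr ⟨h1, h4, not_le.1 h3⟩))
    · exact Or.inl ⟨h4, not_lt.1 h2, not_le.1 h3⟩
  have hc : P.card ≤ P1.card + (1 + ((B O).card + V.card)) := by
    refine (Finset.card_le_card hsub).trans ((Finset.card_union_le _ _).trans ?_)
    gcongr
    refine (Finset.card_union_le _ _).trans ?_
    gcongr
    · simp
    · exact Finset.card_union_le _ _
  have hc' : n ≤ P1.card + (1 + ((B O).card + V.card)) := by rw [hn]; exact_mod_cast hc
  linarith

lemma dyadic {α : Type*} [DecidableEq α] (P : Finset α) (f : α → ℕ) (N : ℕ) (t : ℝ) (ht : 0 < t)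
    (hf : ∀ x ∈ P, f x ≤ N) (hP : t ≤ P.card) :
    ∃ j, t / (Nat.log 2 N + 1 : ℕ) ≤ ((P.filter (fun x => Nat.log 2 (f x) = j)).card : ℝ) := by
  have h : P.card = ∑ j ∈ Finset.range (Nat.log 2 N + 1),
      (P.filter (fun x => Nat.log 2 (f x) = j)).card :=
    Finset.card_eq_sum_card_fiberwise (fun x hx => by
      rw [Finset.mem_coe, Finset.mem_range]
      exact Nat.lt_succ_of_le (Nat.log_mono_right (hf x hx)))
  rw [h] at hP
  push_cast at hP
  obtain ⟨j, -, hj⟩ := exists_ge_of_sum (Finset.range (Nat.log 2 N + 1))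
    (fun j => ((P.filter (fun x => Nat.log 2 (f x) = j)).card : ℝ)) ((Nat.log 2 N + 1 : ℕ) : ℝ)
    (t / (Nat.log 2 N + 1 : ℕ)) (by simp) (by positivity) (by positivity)
    (by rw [mul_div_cancel₀ _ (by positivity)]; exact hP)
  exact ⟨j, hj⟩

lemma num_end (M l J : ℝ) (hM : 0 < M) (hl : 1 ≤ l) (hJ : 1 ≤ J) (s : ℕ)
    (hsx : M / (2 ^ 11 * l * J ^ 2) / 2 ≤ s)
    (h : 2 * M ≤ 2 ^ 176 * J ^ 65 ∨ (s : ℝ) ^ 2 ≤ 2 ^ 169 * J ^ 61 * (2 * M)) :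
    M ≤ 2 ^ 194 * l ^ 2 * J ^ 65 := by
  rcases h with h | h
  · have h1 : (1 : ℝ) ≤ l ^ 2 := one_le_pow₀ hl
    have h2 : (0 : ℝ) < J ^ 65 := by positivity
    nlinarith
  · have h1 : (M / (2 ^ 11 * l * J ^ 2) / 2) ^ 2 ≤ 2 ^ 169 * J ^ 61 * (2 * M) :=
      le_trans (by gcongr) h
    have h2 : (M / (2 ^ 11 * l * J ^ 2) / 2) ^ 2 = M * M / (2 ^ 24 * l ^ 2 * J ^ 4) := by
      field_simp
    rw [h2, div_le_iff₀ (by positivity)] at h1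
    refine le_of_mul_le_mul_left (h1.trans (le_of_eq ?_)) hM
    ring
lemma columns {F : Type*} [Field F] [DecidableEq F] (P : Finset (F × F)) (O : F × F) (hO : O ∈ P)
    (C : (F × F) → Prop) [DecidablePred C] (hC : ∀ q ∈ P, C q → q.1 ≠ O.1)
    (hC2 : ∀ q ∈ P, ∀ r ∈ P, C q → r ≠ O → lnP P O r = lnP P O q → C r) (q : F × F) (hq : q ∈ P)
    (hCq : C q) :
    ((((P.filter C).image (phi O)).filter (fun x => x.1 = (phi O q).1)).card : ℝ) =
      ((lnP P O q).card : ℝ) - 1 := by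
  have hqO : q.1 ≠ O.1 := hC q hq hCq
  have hne : O ≠ q := fun h => hqO (by rw [h])
  have h1 : ((P.filter C).image (phi O)).filter (fun x => x.1 = (phi O q).1) =
      ((lnP P O q).erase O).image (phi O) := by
    ext y
    simp only [lnP, Finset.mem_filter, Finset.mem_image, Finset.mem_erase]
    constructor
    · rintro ⟨⟨s, ⟨hs, hCs⟩, rfl⟩, h⟩
      refine ⟨s, ⟨?_, hs, (phi_fst O q s hqO (hC s hs hCs)).1 h⟩, rfl⟩
      rintro rfl
      exact hC s hs hCs rfl
    · rintro ⟨s, ⟨hsO, hs, h⟩, rfl⟩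
      have hmem : s ∈ lnP P O q := Finset.mem_filter.2 ⟨hs, h⟩
      have hCs : C s := hC2 q hq s hs hCq hsO
        (lnP_eq P O hO q hq hne O (lnP_mem P O hO q hq hne).1 s hmem (Ne.symm hsO))
      exact ⟨⟨s, ⟨hs, hCs⟩, rfl⟩, (phi_fst O q s hqO (hC s hs hCs)).2 h⟩
  have h2 : ((lnP P O q).erase O).card + 1 = (lnP P O q).card :=
    Finset.card_erase_add_one (lnP_mem P O hO q hq hne).1
  have hmem : ∀ s ∈ (lnP P O q).erase O, s.1 ≠ O.1 := by
    intro s hs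
    rw [Finset.mem_erase, lnP, Finset.mem_filter] at hs
    have hsO : s ≠ O := hs.1
    have hmem : s ∈ lnP P O q := Finset.mem_filter.2 hs.2
    exact hC s hs.2.1 (hC2 q hq s hs.2.1 hCq hsO
        (lnP_eq P O hO q hq hne O (lnP_mem P O hO q hq hne).1 s hmem (Ne.symm hsO)))
  rw [h1, Finset.card_image_of_injOn, ← h2]
  · push_cast; ring
  · intro s hs t ht h
    exact phi_inj O s t h (hmem s hs) (hmem t ht)

lemma num_s (M l J Q n n2 : ℝ) (hM0 : 0 < M) (hl1 : 1 ≤ l) (hJ1 : 1 ≤ J) (hQ8 : 8 ≤ Q)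
    (hMn : M * M ≤ 4 * n) (hn2l : n ≤ 2 * l * n2) (hQU : n2 ≤ Q * (2 * M)) :
    M / (2 ^ 11 * l * J ^ 2) ≤ (Q - 2) / (64 * J ^ 2) := by
  have hl0 : 0 < l := by linarith
  have hJ0 : 0 < J := by linarith
  rw [div_le_div_iff₀ (by positivity) (by positivity)]
  have h1 : M ≤ (Q - 2) * (32 * l) := by
    have h2 : M * M ≤ M * ((Q - 2) * (32 * l)) := by
      have h3 : Q / 2 ≤ Q - 2 := by linarith
      calc M * M ≤ 4 * n := by linarith
        _ ≤ 4 * (2 * l * n2) := by gcongr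
        _ ≤ 4 * (2 * l * (Q * (2 * M))) := by gcongr
        _ = M * (Q / 2 * (32 * l)) := by ring
        _ ≤ _ := by gcongr
    exact le_of_mul_le_mul_left h2 hM0
  calc M * (64 * J ^ 2) ≤ (Q - 2) * (32 * l) * (64 * J ^ 2) := by gcongr
    _ = _ := by ring

set_option maxHeartbeats 4000000 in
lemma geom (p : ℕ) [Fact p.Prime] (P : Finset (ZMod p × ZMod p)) (hp : P.card < p) (H l : ℝ)
    (hl : l = (Nat.log 2 P.card + 1 : ℕ)) (hH : ((linesOf P).ncard : ℝ) ≤ H)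
    (h16 : ∀ q ∈ P, ∀ r ∈ P, q ≠ r → 16 * ((lnP P q r).card : ℝ) ≤ P.card)
    (h32 : 32 ≤ (P.card : ℝ)) (hnH : (P.card : ℝ) ≤ H)
    (hsq : 64 * l * √(P.card : ℝ) ≤ P.card) (hHn : 256 * l ^ 2 * H ≤ (P.card : ℝ) ^ 2) :
    ∃ M : ℝ, 0 < M ∧ (P.card : ℝ) ^ 2 ≤ 32 * H * M ^ 2 ∧
      M ≤ 2 ^ 194 * l ^ 2 * (2 ^ 11 * H / P.card) ^ 65 := by
  set n : ℝ := (P.card : ℝ) with hn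
  have hn0 : 0 < n := by linarith
  have hH0 : 0 < H := by linarith
  have hl1 : 1 ≤ l := by rw [hl]; push_cast; linarith [Nat.cast_nonneg (α := ℝ) (Nat.log 2 P.card)]
  have hsq0 : 0 < √n := Real.sqrt_pos.2 hn0
  have hsqn : √n ^ 2 = n := Real.sq_sqrt hn0.le
  have hsH0 : 0 < √H := Real.sqrt_pos.2 hH0
  have hsH : √H ^ 2 = H := Real.sq_sqrt hH0.le
  have hs8H0 : 0 < √(8 * H) := Real.sqrt_pos.2 (by linarith)
  have hs8H : √(8 * H) ^ 2 = 8 * H := Real.sq_sqrt (by linarith)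
  set k := n / √(8 * H) with hk
  clear_value k
  have hk2 : k ^ 2 = n ^ 2 / (8 * H) := by rw [hk, div_pow, hs8H]
  have hk0 : 0 < k := by rw [hk]; positivity
  have hk4 : 4 ≤ k := by
    have h1 : (4 : ℝ) ^ 2 ≤ k ^ 2 := by
      rw [hk2, le_div_iff₀ (by positivity)]
      have h1 : 1 * H ≤ l ^ 2 * H := mul_le_mul_of_nonneg_right (one_le_pow₀ hl1) hH0.le
      linarith
    exact le_of_sq_le_sq h1 hk0.le
  obtain ⟨O, hO, hP1⟩ := choose_O P H k hH (by rw [hk2, ← hn]; apply le_of_eq; field_simp) h16 h32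
    (le_trans (mul_le_mul_of_nonneg_right (by linarith) hsq0.le) hsq)
  rw [← hn] at hP1
  clear_value n
  set C1 : ZMod p × ZMod p → Prop := fun q => q.1 ≠ O.1 ∧ k ≤ ((lnP P O q).card : ℝ) ∧
      ((lnP P O q).card : ℝ) < 2 * √n with hC1
  obtain ⟨j, hj⟩ := dyadic (P.filter C1) (fun q => (lnP P O q).card) P.card (n / 2) (by positivity)
    (fun x _ => Finset.card_le_card (Finset.filter_subset _ _)) hP1
  rw [← hl, Finset.filter_filter] at hj
  set C : ZMod p × ZMod p → Prop := fun q => C1 q ∧ Nat.log 2 (lnP P O q).card = j with hC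
  set P2 := P.filter C with hP2
  set M : ℝ := 2 ^ j with hM
  have hM0 : 0 < M := by positivity
  clear_value M
  have hCq : ∀ q, C q → q.1 ≠ O.1 ∧ k ≤ ((lnP P O q).card : ℝ) ∧
      ((lnP P O q).card : ℝ) < 2 * √n ∧ M ≤ ((lnP P O q).card : ℝ) ∧
      ((lnP P O q).card : ℝ) < 2 * M := by
    rintro q ⟨⟨h1, h2, h3⟩, h4⟩
    refine ⟨h1, h2, h3, ?_, ?_⟩
    · have : (lnP P O q).card ≠ 0 := by
        intro h0; rw [h0] at h2; simp at h2; linarith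
      have := Nat.pow_log_le_self 2 this
      rw [h4] at this
      rw [hM]; exact_mod_cast this
    · have := Nat.lt_pow_succ_log_self (b := 2) (by norm_num) (lnP P O q).card
      rw [h4, pow_succ] at this
      rw [hM, mul_comm]; exact_mod_cast this
  set n2 : ℝ := (P2.card : ℝ) with hn2
  clear_value n2
  have hn2l : n ≤ 2 * l * n2 := by
    have h0 : n / 2 / l ≤ n2 := hj
    rw [div_div, div_le_iff₀ (by positivity)] at h0
    linarith
  have hn20 : 0 < n2 := by
    have h1 : 0 < 2 * l * n2 := by linarith
    exact (mul_pos_iff_of_pos_left (by linarith)).1 h1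
  have hP2ne : P2.Nonempty := by
    rw [hn2] at hn20
    exact Finset.card_pos.1 (by exact_mod_cast hn20)
  have hkM : k < 2 * M ∧ M < 2 * √n := by
    obtain ⟨q, hq⟩ := hP2ne
    obtain ⟨_, h2, h3, h4, h5⟩ := hCq q (Finset.mem_filter.1 hq).2
    exact ⟨by linarith, by linarith⟩
  have hnM : n ^ 2 ≤ 32 * H * M ^ 2 := by
    have h1 : k ^ 2 ≤ (2 * M) ^ 2 := by gcongr; exact hkM.1.le
    rw [hk2, div_le_iff₀ (by positivity)] at h1
    linarith
  refine ⟨M, hM0, hnM, ?_⟩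
  have hM2 : 2 ≤ M := by linarith
  have hMn : M ^ 2 ≤ 4 * n := by
    have h1 : M ^ 2 ≤ (2 * √n) ^ 2 := by gcongr; exact hkM.2.le
    rw [mul_pow, hsqn] at h1
    linarith
  set J := 2 ^ 11 * H / n with hJ
  clear_value J
  have hJ1 : 1 ≤ J := by
    rw [hJ, le_div_iff₀ hn0]; linarith
  have hP2O : ∀ q ∈ P2, q.1 ≠ O.1 := fun q hq => (hCq q (Finset.mem_filter.1 hq).2).1
  set R := P2.image (phi O) with hR
  have hRc : (R.card : ℝ) = n2 := by
    rw [hR, Finset.card_image_of_injOn]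
    · exact hn2.symm
    intro s hs t ht h
    exact phi_inj O s t h (hP2O s hs) (hP2O t ht)
  have hcol : ∀ a ∈ R.image Prod.fst, ∃ q, C q ∧
      ((R.filter (fun q => q.1 = a)).card : ℝ) = ((lnP P O q).card : ℝ) - 1 := by
    intro a ha
    obtain ⟨y, hy, rfl⟩ := Finset.mem_image.1 ha
    obtain ⟨q, hq, rfl⟩ := Finset.mem_image.1 hy
    obtain ⟨hqP, hqC⟩ := Finset.mem_filter.1 hq
    refine ⟨q, hqC, ?_⟩
    refine columns P O hO C (fun q _ h => (hCq q h).1) ?_ q hqP hqC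
    intro q hq r hr hCq' hrO heq
    refine ⟨⟨?_, ?_, ?_⟩, ?_⟩
    · have h1 := (hCq q hCq').1
      intro h2
      have hrm : r ∈ lnP P O q := by
        rw [← heq]; exact (lnP_mem P O hO r hr (Ne.symm hrO)).2
      have h3 := (Finset.mem_filter.1 hrm).2
      unfold Clr at h3
      rw [h2, sub_self, mul_zero] at h3
      rcases mul_eq_zero.1 h3 with h4 | h4
      · exact h1 (sub_eq_zero.1 h4)
      · exact hrO (Prod.ext h2 (sub_eq_zero.1 h4))
    · rw [heq]; exact hCq'.1.2.1
    · rw [heq]; exact hCq'.1.2.2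
    · rw [heq]; exact hCq'.2
  have hcU : ∀ a ∈ R.image Prod.fst, ((R.filter (fun q => q.1 = a)).card : ℝ) ≤ 2 * M := by
    intro a ha
    obtain ⟨q, hq, h⟩ := hcol a ha
    rw [h]; linarith [(hCq q hq).2.2.2.2]
  have hcL : ∀ a ∈ R.image Prod.fst, M / 2 ≤ ((R.filter (fun q => q.1 = a)).card : ℝ) := by
    intro a ha
    obtain ⟨q, hq, h⟩ := hcol a ha
    rw [h]; linarith [(hCq q hq).2.2.2.1]
  set A := R.image Prod.fst with hA
  have hRsum : R.card = ∑ a ∈ A, (R.filter (fun q => q.1 = a)).card :=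
    Finset.card_eq_sum_card_fiberwise (fun x hx => Finset.mem_image_of_mem _ hx)
  have hRsum' : n2 = ∑ a ∈ A, ((R.filter (fun q => q.1 = a)).card : ℝ) := by
    rw [← hRc, hRsum]; push_cast; rfl
  have hQL : (A.card : ℝ) * (M / 2) ≤ n2 := by
    rw [hRsum', ← nsmul_eq_mul]
    exact Finset.card_nsmul_le_sum _ _ _ hcL
  have hQU : n2 ≤ (A.card : ℝ) * (2 * M) := by
    rw [hRsum', ← nsmul_eq_mul]
    exact Finset.sum_le_card_nsmul _ _ _ hcU
  set k2 := n2 / (2 * √H) with hk2d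
  clear_value k2
  have hk22 : k2 ^ 2 = n2 ^ 2 / (4 * H) := by rw [hk2d, div_pow, mul_pow, hsH]; norm_num
  have hk20 : 0 < k2 := by rw [hk2d]; positivity
  have hk24 : 4 ≤ k2 := by
    have h1 : (4 : ℝ) ^ 2 ≤ k2 ^ 2 := by
      rw [hk22, le_div_iff₀ (by positivity)]
      have h2 : n ^ 2 ≤ (2 * l * n2) ^ 2 := by gcongr
      have h3 : l ^ 2 * (256 * H) ≤ l ^ 2 * (4 * n2 ^ 2) := by linarith
      have h4 := le_of_mul_le_mul_left h3 (by positivity)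
      linarith
    exact le_of_sq_le_sq h1 hk20.le
  have hlines : ((R.offDiag.image (fun x => lnP R x.1 x.2)).card : ℝ) ≤ H := by
    refine le_trans ?_ hH
    have h1 := lnP_card_le P P2 (Finset.filter_subset _ _)
    have h2 : R.offDiag.image (fun x => lnP R x.1 x.2) ⊆
        (P2.offDiag.image (fun x => lnP P2 x.1 x.2)).image (fun S => S.image (phi O)) := by
      intro S hS
      obtain ⟨⟨x, y⟩, hxy, rfl⟩ := Finset.mem_image.1 hS
      obtain ⟨hx, hy, hne⟩ := Finset.mem_offDiag.1 hxy
      obtain ⟨q, hq, rfl⟩ := Finset.mem_image.1 hx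
      obtain ⟨r, hr, rfl⟩ := Finset.mem_image.1 hy
      refine Finset.mem_image.2 ⟨lnP P2 q r, Finset.mem_image.2 ⟨(q, r), ?_, rfl⟩, ?_⟩
      · refine Finset.mem_offDiag.2 ⟨hq, hr, fun h => hne ?_⟩
        have h' : q = r := h
        rw [h']
      · exact (lnP_phi P2 O hP2O q r hq hr).symm
    exact_mod_cast (Finset.card_le_card h2).trans (Finset.card_image_le.trans h1)
  have hlight := light_pairs R (lnP R) (lnP_mem R) k2 H hlines
  have h16M : 16 * M ≤ n2 := by
    have h1 : 64 * l * √n ≤ 2 * l * n2 := hsq.trans hn2l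
    have h2 : l * (32 * √n) ≤ l * n2 := by linarith
    have h3 := le_of_mul_le_mul_left h2 (by linarith)
    linarith [hkM.2]
  have hJk : 64 * (A.card : ℝ) ≤ J * k2 := by
    have h1 : J * k2 = 2 ^ 10 * √H * n2 / n := by
      rw [hJ, hk2d]
      have h0 : H = √H * √H := by rw [← sq, hsH]
      rw [div_mul_div_comm, div_eq_div_iff (by positivity) (by positivity)]
      linear_combination 2 ^ 11 * n2 * n * h0
    rw [h1, le_div_iff₀ hn0]
    have h2 : n ≤ 8 * √H * M := by
      refine le_of_sq_le_sq ?_ (by positivity)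
      rw [mul_pow, mul_pow, hsH]
      have h3 : 0 ≤ H * M ^ 2 := by positivity
      linarith
    calc 64 * (A.card : ℝ) * n ≤ 64 * (A.card : ℝ) * (8 * √H * M) := by gcongr
      _ = 2 ^ 10 * √H * ((A.card : ℝ) * (M / 2)) := by ring
      _ ≤ _ := by gcongr
  have hQ8 : 8 ≤ (A.card : ℝ) := by
    have : (2 * M) * 8 ≤ (2 * M) * (A.card : ℝ) := by linarith
    exact le_of_mul_le_mul_left this (by positivity)
  have hx0 : 0 < M / (2 ^ 11 * l * J ^ 2) := by positivity
  by_cases hx2 : M / (2 ^ 11 * l * J ^ 2) < 2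
  · rw [div_lt_iff₀ (by positivity)] at hx2
    have h1 : J ^ 2 ≤ J ^ 65 := pow_le_pow_right₀ hJ1 (by norm_num)
    have h2 : l ≤ l ^ 2 := le_self_pow₀ hl1 (by norm_num)
    calc M ≤ 2 * (2 ^ 11 * l * J ^ 2) := hx2.le
      _ = 2 ^ 12 * l * J ^ 2 := by ring
      _ ≤ 2 ^ 194 * l ^ 2 * J ^ 65 := by gcongr <;> norm_num
  · rw [not_lt] at hx2
    set s := ⌊M / (2 ^ 11 * l * J ^ 2)⌋₊ with hs
    have hs1 : (s : ℝ) ≤ M / (2 ^ 11 * l * J ^ 2) := Nat.floor_le hx0.le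
    have hs2 : M / (2 ^ 11 * l * J ^ 2) < s + 1 := Nat.lt_floor_add_one _
    have hs3 : 2 ≤ s := Nat.le_floor (by exact_mod_cast hx2)
    clear_value s
    refine num_end M l J hM0 hl1 hJ1 s (by linarith) ?_
    refine cols_core p R M k2 J hM0 hcU hcL ?_ (by rw [hRc]; exact h16M) hk24 (by linarith) hJk s hs3
      ?_ ?_
    · refine hlight.trans (le_of_eq ?_)
      rw [hRc, hk22]; field_simp
    · have h1 : M / (2 ^ 11 * l * J ^ 2) ≤ M / 2 := by
        apply div_le_div_of_nonneg_left hM0.le (by norm_num)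
        have : 1 ≤ l * J ^ 2 := one_le_mul_of_one_le_of_one_le hl1 (one_le_pow₀ hJ1)
        linarith
      have h2 : (s : ℝ) * s ≤ n := by
        have : (s : ℝ) ≤ M / 2 := hs1.trans h1
        have h0 : (0 : ℝ) ≤ s := Nat.cast_nonneg _
        have h4 : (s : ℝ) * s ≤ M / 2 * (M / 2) := mul_le_mul this this h0 (by linarith)
        linarith
      have h3 : s * s ≤ P.card := by rw [hn] at h2; exact_mod_cast h2
      omega
    · refine hs1.trans ?_
      exact num_s M l J A.card n n2 hM0 hl1 hJ1 hQ8 (by linarith) hn2l hQU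

lemma log_small (K : ℝ) (hK : 0 < K) : ∃ n0 : ℕ, ∀ n : ℕ, n0 ≤ n →
    K * ((Nat.log 2 n + 1 : ℕ) : ℝ) ^ 4 < (n : ℝ) ^ ((1 : ℝ) / 133) := by
  have h1 := isLittleO_log_rpow_rpow_atTop (4 : ℝ) (s := (1 : ℝ) / 133) (by norm_num)
  have h2 := (h1.def (c := 1 / (K * 82)) (by positivity))
  have h3 := tendsto_natCast_atTop_atTop (R := ℝ) |>.eventually h2
  obtain ⟨n1, hn1⟩ := Filter.eventually_atTop.1 h3
  refine ⟨max n1 3, fun n hn => ?_⟩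
  have h4 := hn1 n (le_trans (le_max_left _ _) hn)
  have hn3 : 3 ≤ n := le_trans (le_max_right _ _) hn
  have hn3' : (3 : ℝ) ≤ n := by exact_mod_cast hn3
  have hlog : 1 ≤ Real.log n := by
    rw [Real.le_log_iff_exp_le (by linarith)]
    have := Real.exp_one_lt_d9
    linarith
  have hl2 : (1 : ℝ) / 2 < Real.log 2 := by
    have := Real.log_two_gt_d9; linarith
  have hL : ((Nat.log 2 n + 1 : ℕ) : ℝ) ≤ 3 * Real.log n := by
    have h5 : ((Nat.log 2 n : ℕ) : ℝ) * Real.log 2 ≤ Real.log n := by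
      rw [← Real.log_pow]
      apply Real.log_le_log (by positivity)
      exact_mod_cast Nat.pow_log_le_self 2 (by omega)
    have h6 : (0 : ℝ) ≤ (Nat.log 2 n : ℕ) := Nat.cast_nonneg _
    push_cast
    nlinarith
  have hx0 : 0 < (n : ℝ) ^ ((1 : ℝ) / 133) := Real.rpow_pos_of_pos (by linarith) _
  rw [Real.norm_of_nonneg hx0.le, Real.norm_of_nonneg (Real.rpow_nonneg (by linarith) _)] at h4
  have h7 : Real.log n ^ (4 : ℝ) = Real.log n ^ 4 := by
    exact_mod_cast Real.rpow_natCast (Real.log n) 4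
  rw [h7, div_mul_eq_mul_div, one_mul, le_div_iff₀ (by positivity)] at h4
  have h8 : ((Nat.log 2 n + 1 : ℕ) : ℝ) ^ 4 ≤ (3 * Real.log n) ^ 4 := by gcongr
  have h9 : 1 ≤ Real.log n ^ 4 := one_le_pow₀ hlog
  calc K * ((Nat.log 2 n + 1 : ℕ) : ℝ) ^ 4 ≤ K * (3 * Real.log n) ^ 4 := by gcongr
    _ = Real.log n ^ 4 * (K * 81) := by ring
    _ < Real.log n ^ 4 * (K * 82) := by
        apply mul_lt_mul_of_pos_left _ (by linarith)
        linarith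
    _ ≤ _ := h4

lemma num_final (a b : ℝ) (ha : 1 ≤ a) (hb : 1 ≤ b) (l x n : ℝ) (hl : 1 ≤ l) (hx : n = x ^ 133)
    (hx0 : 0 < x) (hK : (4096 * a ^ 2 * b ^ 130) * l ^ 4 < x) :
    32 ≤ n ∧ n ≤ n * x ∧ 64 * l * √n ≤ n ∧ 256 * l ^ 2 * (n * x) ≤ n ^ 2 ∧
    ∀ M, 0 < M → n ^ 2 ≤ 32 * (n * x) * M ^ 2 → M ≤ a * l ^ 2 * (b * (n * x) / n) ^ 65 → False := by
  have hab : 1 ≤ a ^ 2 * b ^ 130 := one_le_mul_of_one_le_of_one_le (one_le_pow₀ ha) (one_le_pow₀ hb)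
  have hl24 : l ^ 2 ≤ l ^ 4 := pow_le_pow_right₀ hl (by norm_num)
  have hl2 : 1 ≤ l ^ 2 := one_le_pow₀ hl
  have hy : l ^ 4 ≤ a ^ 2 * b ^ 130 * l ^ 4 := le_mul_of_one_le_left (by positivity) hab
  have hK' : 4096 * (a ^ 2 * b ^ 130 * l ^ 4) < x := by
    refine lt_of_le_of_lt (le_of_eq ?_) hK; ring
  have hx1 : 1 ≤ x := by linarith
  have hxn : x ≤ n := by rw [hx]; exact le_self_pow₀ hx1 (by norm_num)
  have hn0 : 0 < n := by linarith
  have hxxn : x * x ≤ n := by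
    rw [hx, ← sq]; exact pow_le_pow_right₀ hx1 (by norm_num)
  have hsq0 : 0 ≤ √n := Real.sqrt_nonneg n
  have hsq : √n * √n = n := Real.mul_self_sqrt hn0.le
  refine ⟨by linarith, le_mul_of_one_le_right hn0.le hx1, ?_, ?_, ?_⟩
  · have h1 : 64 * l ≤ √n := Real.le_sqrt_of_sq_le (by
      have : (64 * l) ^ 2 = 4096 * l ^ 2 := by ring
      rw [this]; linarith)
    calc 64 * l * √n ≤ √n * √n := by gcongr
      _ = n := hsq
  · calc 256 * l ^ 2 * (n * x) ≤ x * (n * x) := by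
          apply mul_le_mul_of_nonneg_right _ (by positivity); linarith
      _ = n * (x * x) := by ring
      _ ≤ n * n := by gcongr
      _ = n ^ 2 := by ring
  · intro M hM h1 h2
    have e : b * (n * x) / n = b * x := by field_simp
    rw [e] at h2
    have h3 : M ^ 2 ≤ (a * l ^ 2 * (b * x) ^ 65) ^ 2 := by gcongr
    have h4 : (a * l ^ 2 * (b * x) ^ 65) ^ 2 = (a ^ 2 * b ^ 130 * l ^ 4) * x ^ 130 := by ring
    rw [h4] at h3
    have h5 : n ^ 2 ≤ 32 * (n * x) * ((a ^ 2 * b ^ 130 * l ^ 4) * x ^ 130) := h1.trans (by gcongr)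
    have h6 : n * n ≤ n * (32 * (a ^ 2 * b ^ 130 * l ^ 4) * x ^ 131) := by
      calc n * n = n ^ 2 := by ring
        _ ≤ _ := h5
        _ = _ := by ring
    have h7 := le_of_mul_le_mul_left h6 hn0
    have h8 : 32 * (a ^ 2 * b ^ 130 * l ^ 4) * x ^ 131 < x * x ^ 131 := by
      apply mul_lt_mul_of_pos_right _ (by positivity); linarith
    have h9 : x * x ^ 131 ≤ n := by
      rw [hx, ← pow_succ']; exact pow_le_pow_right₀ hx1 (by norm_num)
    linarith

theorem stmt1 :
    ∀ ε : ℝ, 0 < ε → ∃ c : ℝ, 0 < c ∧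
      ∀ p : ℕ, p.Prime → ∀ P : Finset (ZMod p × ZMod p), P.card < p →
        (∃ l : Set (ZMod p × ZMod p), IsLine l ∧
            c * (P.card : ℝ) ^ ((1 : ℝ) - ε) ≤ (((P : Set (ZMod p × ZMod p)) ∩ l).ncard : ℝ)) ∨
        c * (P.card : ℝ) ^ ((1 : ℝ) + 1 / 133 - ε) ≤ ((linesOf P).ncard : ℝ) := by
  intro ε hε
  obtain ⟨n0, hn0⟩ := log_small (4096 * (2 ^ 194) ^ 2 * (2 ^ 11) ^ 130)
    (mul_pos (mul_pos (by norm_num) (pow_pos (pow_pos two_pos _) _)) (pow_pos (pow_pos two_pos _) _))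
  refine ⟨min (1 / 16) (1 / ((n0 : ℝ) + 1)), by positivity, ?_⟩
  set c : ℝ := min (1 / 16) (1 / ((n0 : ℝ) + 1)) with hc
  have hc0 : 0 < c := by positivity
  have hc1 : c ≤ 1 / 16 := min_le_left _ _
  have hc2 : c ≤ 1 / ((n0 : ℝ) + 1) := min_le_right _ _
  clear_value c
  intro p hp P hPp
  have : Fact p.Prime := ⟨hp⟩
  rcases P.eq_empty_or_nonempty with rfl | hne
  · by_cases h : (1 : ℝ) + 1 / 133 - ε = 0
    · left
      refine ⟨{q | (1 : ZMod p) * q.1 + 0 * q.2 + 0 = 0}, ⟨1, 0, 0, by simp, rfl⟩, ?_⟩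
      rw [Finset.card_empty, Nat.cast_zero, Real.zero_rpow (by intro h2; linarith)]
      simp
    · right
      rw [Finset.card_empty, Nat.cast_zero, Real.zero_rpow h]
      simp
  have hn1 : 1 ≤ P.card := Finset.card_pos.2 hne
  have hn1' : (1 : ℝ) ≤ P.card := by exact_mod_cast hn1
  have hpow1 : (P.card : ℝ) ^ ((1 : ℝ) - ε) ≤ P.card := by
    calc (P.card : ℝ) ^ ((1 : ℝ) - ε) ≤ (P.card : ℝ) ^ (1 : ℝ) :=
          Real.rpow_le_rpow_of_exponent_le hn1' (by linarith)
      _ = P.card := Real.rpow_one _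
  by_cases hsmall : P.card < n0
  · left
    obtain ⟨O, hO⟩ := hne
    refine ⟨{q | (1 : ZMod p) * q.1 + 0 * q.2 + (-O.1) = 0}, ⟨1, 0, -O.1, by simp, rfl⟩, ?_⟩
    have h1 : 1 ≤ ((P : Set (ZMod p × ZMod p)) ∩
        {q | (1 : ZMod p) * q.1 + 0 * q.2 + (-O.1) = 0}).ncard := by
      refine (Set.ncard_pos (Set.toFinite _)).2 ?_
      exact ⟨O, hO, by simp⟩
    have h2 : c * (P.card : ℝ) ^ ((1 : ℝ) - ε) ≤ 1 := by
      have h3 : (P.card : ℝ) ≤ (n0 : ℝ) + 1 := by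
        have : (P.card : ℝ) < n0 := by exact_mod_cast hsmall
        linarith
      calc c * (P.card : ℝ) ^ ((1 : ℝ) - ε) ≤ 1 / ((n0 : ℝ) + 1) * ((n0 : ℝ) + 1) := by
            gcongr
            exact hpow1.trans h3
        _ = 1 := by field_simp
    exact h2.trans (by exact_mod_cast h1)
  · by_cases hln : ∃ q ∈ P, ∃ r ∈ P, q ≠ r ∧ (P.card : ℝ) < 16 * ((lnP P q r).card : ℝ)
    · left
      obtain ⟨q, _, r, _, hqr, h⟩ := hln
      refine ⟨_, isLine_clr q r hqr, ?_⟩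
      rw [← lnP_card_le_ncard]
      calc c * (P.card : ℝ) ^ ((1 : ℝ) - ε) ≤ 1 / 16 * P.card := by gcongr
        _ ≤ _ := by linarith
    · right
      push Not at hln
      set x : ℝ := (P.card : ℝ) ^ ((1 : ℝ) / 133) with hx
      have hx0 : 0 < x := Real.rpow_pos_of_pos (by linarith) _
      have hlog0 := hn0 P.card (not_lt.1 hsmall)
      rw [← hx] at hlog0
      clear hn0
      generalize hKK : (4096 * (2 ^ 194) ^ 2 * (2 ^ 11) ^ 130 : ℝ) = K at hlog0
      have hxn : (P.card : ℝ) = x ^ 133 := by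
        rw [hx, ← Real.rpow_natCast, ← Real.rpow_mul (by linarith)]
        norm_num
      have hH : (P.card : ℝ) ^ ((1 : ℝ) + 1 / 133) = P.card * x := by
        rw [Real.rpow_add (by linarith), Real.rpow_one]
      have hle : c * (P.card : ℝ) ^ ((1 : ℝ) + 1 / 133 - ε) ≤ P.card * x := by
        rw [← hH]
        calc c * (P.card : ℝ) ^ ((1 : ℝ) + 1 / 133 - ε) ≤
            1 * (P.card : ℝ) ^ ((1 : ℝ) + 1 / 133) := by
              exact mul_le_mul (by linarith)
                (Real.rpow_le_rpow_of_exponent_le hn1' (by linarith))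
                (Real.rpow_nonneg (by linarith) _) zero_le_one
          _ = _ := one_mul _
      refine hle.trans ?_
      by_contra hcon
      rw [not_le] at hcon
      rw [← hKK] at hlog0
      obtain ⟨g1, g2, g3, g4, g5⟩ := num_final (2 ^ 194) (2 ^ 11) (one_le_pow₀ one_le_two)
        (one_le_pow₀ one_le_two) ((Nat.log 2 P.card + 1 : ℕ) : ℝ) x (P.card : ℝ)
        (by exact_mod_cast Nat.le_add_left 1 _) hxn hx0 hlog0
      obtain ⟨M, hM0, hM1, hM2⟩ := geom p P hPp (P.card * x) _ rfl hcon.le hln g1 g2 g3 g4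
      exact g5 M hM0 hM1 hM2
end

section
/- For every ε > 0 there exists a constant c > 0 such that the following holds: for every prime p and every finite nonempty set A ⊆ F_p with |A| < p^(1/2) (equivalently |A|² < p), the set f(A) = {a + a·b : a, b ∈ A} satisfies |f(A)| ≥ c·|A|^(1 + 1/53 − ε). -/
open Finset

theorem aux_cs {α β : Type*} [DecidableEq α] [DecidableEq β] (G : Finset α) (f : α → β) :
    (G.card : ℝ) ^ 2 ≤ ((G.image f).card : ℝ) *
      (((G ×ˢ G).filter fun q => f q.1 = f q.2).card : ℝ) := by
  have h1 : G.card = ∑ b ∈ G.image f, (G.filter fun a => f a = b).card :=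
    card_eq_sum_card_image f G
  have h2 : ((G ×ˢ G).filter fun q => f q.1 = f q.2).card
      = ∑ b ∈ G.image f, (G.filter fun a => f a = b).card ^ 2 := by
    rw [card_eq_sum_card_fiberwise (f := fun q => f q.1) (t := G.image f)]
    · refine sum_congr rfl fun b _ => ?_
      rw [sq, ← card_product]
      congr 1
      ext ⟨x, y⟩
      simp only [mem_filter, mem_product]
      constructor
      · rintro ⟨⟨⟨hx, hy⟩, h⟩, h'⟩
        exact ⟨⟨hx, h'⟩, hy, h ▸ h'⟩
      · rintro ⟨⟨hx, h⟩, hy, h'⟩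
        exact ⟨⟨⟨hx, hy⟩, h.trans h'.symm⟩, h⟩
    · intro q hq
      simp only [coe_filter, mem_product, Set.mem_ofPred_eq] at hq
      exact mem_coe.2 (mem_image_of_mem f hq.1.1)
  rw [h2, h1]
  push_cast
  exact sq_sum_le_card_mul_sum_sq

theorem aux_bsg {α β : Type*} [DecidableEq α] [DecidableEq β] (A : Finset α) (S : Finset β)
    (N : β → Finset α) (hN : ∀ s, N s ⊆ A) (hS : S.Nonempty)
    (hsum : ∑ s ∈ S, (N s).card = A.card ^ 2) (M θ : ℝ) (hM : 0 ≤ M) (hθ : 0 ≤ θ)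
    (h : 2 * M * θ * S.card ≤ (A.card : ℝ) ^ 2) :
    ∃ s ∈ S, (A.card : ℝ) ^ 4 ≤ 2 * (S.card : ℝ) ^ 2 * ((N s).card : ℝ) ^ 2 ∧
      M * (((N s ×ˢ N s).filter fun q =>
        ((S.filter fun r => q.1 ∈ N r ∧ q.2 ∈ N r).card : ℝ) < θ).card : ℝ)
          ≤ ((N s).card : ℝ) ^ 2 := by
  set P : α × α → Prop := fun q => ((S.filter fun r => q.1 ∈ N r ∧ q.2 ∈ N r).card : ℝ) < θ with hP
  have hSpos : (0 : ℝ) < S.card := by exact_mod_cast hS.card_pos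
  have e1 : ∑ s ∈ S, (((N s ×ˢ N s).filter P).card : ℝ) ≤ (A.card : ℝ) ^ 2 * θ := by
    have : ∀ s ∈ S, (((N s ×ˢ N s).filter P).card : ℝ)
        = ∑ q ∈ (A ×ˢ A).filter P, if q.1 ∈ N s ∧ q.2 ∈ N s then (1 : ℝ) else 0 := by
      intro s _
      rw [sum_boole, filter_filter]
      congr 2
      ext ⟨x, y⟩
      simp only [mem_filter, mem_product]
      constructor
      · rintro ⟨⟨a, b⟩, c⟩
        exact ⟨⟨hN s a, hN s b⟩, c, a, b⟩
      · rintro ⟨-, c, a, b⟩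
        exact ⟨⟨a, b⟩, c⟩
    rw [sum_congr rfl this, sum_comm]
    calc _ ≤ ∑ q ∈ (A ×ˢ A).filter P, θ := by
          refine sum_le_sum fun q hq => ?_
          rw [sum_boole]
          exact (mem_filter.1 hq).2.le
      _ = (((A ×ˢ A).filter P).card : ℝ) * θ := by simp
      _ ≤ _ := by
          refine mul_le_mul_of_nonneg_right ?_ hθ
          have := card_filter_le (A ×ˢ A) P
          rw [card_product] at this
          rw [sq]
          exact_mod_cast this
  have e2 : (A.card : ℝ) ^ 4 ≤ S.card * ∑ s ∈ S, ((N s).card : ℝ) ^ 2 := by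
    have := sq_sum_le_card_mul_sum_sq (s := S) (f := fun s => ((N s).card : ℝ))
    have h3 : ∑ s ∈ S, ((N s).card : ℝ) = (A.card : ℝ) ^ 2 := by exact_mod_cast hsum
    rw [h3] at this
    calc _ = ((A.card : ℝ) ^ 2) ^ 2 := by ring
      _ ≤ _ := this
  obtain ⟨s, hs, hle⟩ : ∃ s ∈ S, (A.card : ℝ) ^ 4 / (2 * (S.card : ℝ) ^ 2) ≤
      ((N s).card : ℝ) ^ 2 - M * (((N s ×ˢ N s).filter P).card : ℝ) := by
    apply exists_le_of_sum_le hS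
    rw [sum_sub_distrib, ← mul_sum, sum_const, nsmul_eq_mul]
    have e3 : M * ∑ s ∈ S, (((N s ×ˢ N s).filter P).card : ℝ) ≤ (A.card : ℝ) ^ 4 / (2 * S.card) := by
      refine (mul_le_mul_of_nonneg_left e1 hM).trans ?_
      rw [le_div_iff₀ (by positivity)]
      have := mul_le_mul_of_nonneg_right h (sq_nonneg (A.card : ℝ))
      nlinarith
    have e4 : (A.card : ℝ) ^ 4 / S.card ≤ ∑ s ∈ S, ((N s).card : ℝ) ^ 2 := by
      rw [div_le_iff₀ hSpos]; linarith
    have e5 : (S.card : ℝ) * ((A.card : ℝ) ^ 4 / (2 * (S.card : ℝ) ^ 2)) + (A.card : ℝ) ^ 4 / (2 * S.card) = (A.card : ℝ) ^ 4 / S.card := by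
      field_simp; ring
    linarith
  have hpos : 0 ≤ (A.card : ℝ) ^ 4 / (2 * (S.card : ℝ) ^ 2) := by positivity
  have hpos2 : 0 ≤ M * (((N s ×ˢ N s).filter P).card : ℝ) := by positivity
  refine ⟨s, hs, ?_, by linarith⟩
  have : (A.card : ℝ) ^ 4 / (2 * (S.card : ℝ) ^ 2) ≤ ((N s).card : ℝ) ^ 2 := by linarith
  rw [div_le_iff₀ (by positivity)] at this
  linarith

/-- If every `v = w - x` has at least `m` representations. -/
theorem aux_fiber {α β γ : Type*} [DecidableEq γ] (V : Finset γ) (T : Finset β)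
    (g : β → γ) (m : ℝ) (h : ∀ v ∈ V, ∃ (B : Finset α) (φ : α → β), m ≤ B.card ∧
      Set.InjOn φ B ∧ ∀ b ∈ B, φ b ∈ T ∧ g (φ b) = v) :
    (V.card : ℝ) * m ≤ T.card := by
  classical
  have h1 : ∑ v ∈ V, ((T.filter fun t => g t = v).card : ℝ) ≤ T.card := by
    have := sum_card_fiberwise_eq_card_filter T V g
    have h2 := card_filter_le T (fun i => g i ∈ V)
    rw [← this] at h2
    exact_mod_cast h2
  refine le_trans ?_ h1
  rw [← nsmul_eq_mul]
  apply card_nsmul_le_sum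
  intro v hv
  obtain ⟨B, φ, hm, hinj, hB⟩ := h v hv
  refine hm.trans ?_
  rw [← card_image_of_injOn hinj]
  norm_cast
  apply card_le_card
  intro x hx
  obtain ⟨b, hb, rfl⟩ := mem_image.1 hx
  exact mem_filter.2 (hB b hb)

section
variable {F : Type*} [Field F] [DecidableEq F]

/-- The set `A (A + 1)`. -/
def auxS (A : Finset F) : Finset F := (A ×ˢ A).image fun x => x.1 + x.1 * x.2

/-- The product set. -/
def auxU (A : Finset F) : Finset F := (A ×ˢ A).image fun x => x.1 * x.2

/-- The elements `x` of `A` with `s ∈ x (A + 1)`. -/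
def auxN (A : Finset F) (s : F) : Finset F := A.filter fun x => s * x⁻¹ - 1 ∈ A

theorem aux_mem_S {A : Finset F} {a b : F} (ha : a ∈ A) (hb : b ∈ A) : a * (b + 1) ∈ auxS A :=
  mem_image.2 ⟨(a, b), mem_product.2 ⟨ha, hb⟩, by ring⟩

theorem aux_N_sub (A : Finset F) (s : F) : auxN A s ⊆ A := filter_subset _ _

theorem aux_mem_N {A : Finset F} (h0 : (0 : F) ∉ A) {x s : F} :
    x ∈ auxN A s ↔ x ∈ A ∧ ∃ b ∈ A, x * (b + 1) = s := by
  simp only [auxN, mem_filter]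
  refine and_congr_right fun hx => ?_
  have hx0 : x ≠ 0 := fun h => h0 (h ▸ hx)
  constructor
  · intro h
    exact ⟨_, h, by field_simp; ring⟩
  · rintro ⟨b, hb, rfl⟩
    have : x * (b + 1) * x⁻¹ - 1 = b := by field_simp; ring
    rwa [this]

theorem aux_sub_mem_U {A : Finset F} (h0 : (0 : F) ∉ A) {x s : F} (h : x ∈ auxN A s) :
    s - x ∈ auxU A := by
  obtain ⟨hx, b, hb, rfl⟩ := (aux_mem_N h0).1 h
  exact mem_image.2 ⟨(x, b), mem_product.2 ⟨hx, hb⟩, by ring⟩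

theorem aux_N_sum {A : Finset F} (h0 : (0 : F) ∉ A) (X : Finset F) (hX : X ⊆ A) :
    ∑ s ∈ auxS A, (auxN A s ∩ X).card = X.card * A.card := by
  rw [← card_product]
  rw [card_eq_sum_card_fiberwise (f := fun q : F × F => q.1 * (q.2 + 1)) (t := auxS A)]
  · refine sum_congr rfl fun s _ => ?_
    symm
    apply card_bij (fun q _ => q.1)
    · intro q hq
      simp only [mem_filter, mem_product] at hq
      exact mem_inter.2 ⟨(aux_mem_N h0).2 ⟨hX hq.1.1, q.2, hq.1.2, hq.2⟩, hq.1.1⟩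
    · rintro ⟨x, b⟩ hq ⟨x', b'⟩ hq' h
      simp only [mem_filter, mem_product] at hq hq' h
      subst h
      have hx0 : x ≠ 0 := fun h => h0 (h ▸ hX hq.1.1)
      have := mul_left_cancel₀ hx0 (hq.2.trans hq'.2.symm)
      simp only [Prod.mk.injEq, true_and]
      exact add_right_cancel this
    · intro x hx
      obtain ⟨hx1, hx2⟩ := mem_inter.1 hx
      obtain ⟨-, b, hb, h⟩ := (aux_mem_N h0).1 hx1
      exact ⟨(x, b), mem_filter.2 ⟨mem_product.2 ⟨hx2, hb⟩, h⟩, rfl⟩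
  · intro q hq
    have := mem_product.1 (mem_coe.1 hq)
    exact mem_coe.2 (aux_mem_S (hX this.1) this.2)

open scoped Pointwise in
theorem aux_plu {A : Finset F} (h0 : (0 : F) ∉ A) (h1 : (-1 : F) ∉ A) (hA : A.Nonempty) :
    ((auxU A).card : ℝ) * A.card ≤ ((auxS A).card : ℝ) ^ 2 := by
  classical
  let i : F → Fˣ := fun x => if h : x ≠ 0 then Units.mk0 x h else 1
  have hi : ∀ x, x ≠ 0 → ((i x : Fˣ) : F) = x := by
    intro x hx
    simp [i, hx]
  have n0 : ∀ x ∈ A, x ≠ 0 := fun x hx h => h0 (h ▸ hx)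
  have n1 : ∀ x ∈ A, x + 1 ≠ 0 := fun x hx h => h1 (by rwa [← eq_neg_of_add_eq_zero_left h])
  set B : Finset Fˣ := A.image i with hB
  set C : Finset Fˣ := A.image (fun x => i (x + 1)) with hC
  have cC : C.card = A.card := by
    apply card_image_of_injOn
    intro x hx y hy hxy
    have := congrArg (fun u : Fˣ => (u : F)) hxy
    simp only [hi _ (n1 x hx), hi _ (n1 y hy)] at this
    exact add_right_cancel this
  have cU : (auxU A).card ≤ (B ^ 2).card := by
    have : auxU A ⊆ (B ^ 2).image (fun u : Fˣ => (u : F)) := by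
      intro u hu
      obtain ⟨⟨a, b⟩, hab, rfl⟩ := mem_image.1 hu
      obtain ⟨ha, hb⟩ := mem_product.1 hab
      refine mem_image.2 ⟨i a * i b, ?_, ?_⟩
      · rw [sq]
        exact mul_mem_mul (mem_image_of_mem _ ha) (mem_image_of_mem _ hb)
      · simp [hi _ (n0 a ha), hi _ (n0 b hb)]
    exact (card_le_card this).trans card_image_le
  have cS : (C * B).card ≤ (auxS A).card := by
    rw [← card_image_of_injective (C * B) (f := fun u : Fˣ => (u : F)) Units.val_injective]
    apply card_le_card
    intro u hu
    obtain ⟨v, hv, rfl⟩ := mem_image.1 hu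
    obtain ⟨c, hc, b, hb, rfl⟩ := mem_mul.1 hv
    obtain ⟨x, hx, rfl⟩ := mem_image.1 hc
    obtain ⟨y, hy, rfl⟩ := mem_image.1 hb
    have := aux_mem_S hy hx
    simpa [hi _ (n0 y hy), hi _ (n1 x hx), mul_comm] using this
  have key := pluennecke_ruzsa_inequality_pow_mul (A := C) (hA.image _) B 2
  have key' : ((B ^ 2).card : ℝ) ≤ ((C * B).card / C.card : ℝ) ^ 2 * C.card := by
    have := (NNRat.cast_le (K := ℝ)).2 key
    push_cast at this
    exact this
  have hApos : (0 : ℝ) < A.card := by exact_mod_cast hA.card_pos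
  rw [cC] at key'
  have h2 : ((C * B).card / A.card : ℝ) ^ 2 * A.card * A.card = ((C * B).card : ℝ) ^ 2 := by
    field_simp
  have h3 : ((C * B).card : ℝ) ^ 2 ≤ ((auxS A).card : ℝ) ^ 2 := by
    gcongr
  have h4 : ((auxU A).card : ℝ) ≤ (B ^ 2).card := by exact_mod_cast cU
  calc _ ≤ ((C * B).card / A.card : ℝ) ^ 2 * A.card * A.card := by gcongr; exact h4.trans key'
    _ ≤ _ := by rw [h2]; exact h3

open scoped Pointwise in
theorem aux_2W (W X : Finset F) (hX : X.Nonempty) :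
    ((2 • W - 2 • W).card : ℝ) * (X.card : ℝ) ^ 3 ≤ ((X - W).card : ℝ) ^ 4 := by
  have key := pluennecke_ruzsa_inequality_nsmul_sub_nsmul_sub (A := X) hX W 2 2
  have key' : ((2 • W - 2 • W).card : ℝ) ≤ ((X - W).card / X.card : ℝ) ^ 4 * X.card := by
    have := (NNRat.cast_le (K := ℝ)).2 key
    push_cast at this
    exact this
  have hpos : (0 : ℝ) < X.card := by exact_mod_cast hX.card_pos
  calc _ ≤ ((X - W).card / X.card : ℝ) ^ 4 * X.card * (X.card : ℝ) ^ 3 := by gcongr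
    _ = _ := by field_simp

/-- Additive energy type quantity. -/
def auxE (Y Z : Finset F) : Finset ((F × F) × (F × F)) :=
  ((Y ×ˢ Z) ×ˢ (Y ×ˢ Z)).filter fun q => q.1.1 - q.1.2 = q.2.1 - q.2.2

theorem aux_energy {A Y Z : Finset F} (h0 : (0 : F) ∉ A) (hA : A.Nonempty)
    (hY : Y ⊆ A) (hZ : Z ⊆ A) (hYn : Y.Nonempty) (hZn : Z.Nonempty) :
    (Y.card : ℝ) ^ 3 * (Z.card : ℝ) ^ 3 * A.card ≤
      8 * ((auxS A).card : ℝ) ^ 2 * ((auxU A).card : ℝ) ^ 2 * (auxE Y Z).card := by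
  classical
  have hApos : (0 : ℝ) < A.card := by exact_mod_cast hA.card_pos
  have hYpos : (0 : ℝ) < Y.card := by exact_mod_cast hYn.card_pos
  have hZpos : (0 : ℝ) < Z.card := by exact_mod_cast hZn.card_pos
  have n0 : ∀ x ∈ A, x ≠ 0 := fun x hx h => h0 (h ▸ hx)
  have hSpos : (0 : ℝ) < (auxS A).card := by
    obtain ⟨a, ha⟩ := hA
    exact_mod_cast card_pos.2 ⟨_, aux_mem_S ha ha⟩
  set θ : ℝ := Y.card * Z.card * A.card / (2 * ((auxS A).card : ℝ) ^ 2) with hθ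
  have hθpos : 0 < θ := by positivity
  -- common neighbours
  let w : F → F → Finset F := fun s s' => auxN A s ∩ auxN A s'
  let bad : F → Finset (F × F) := fun a => (Y ×ˢ Z).filter fun q =>
    ((w (a * (q.1 + 1)) (a * (q.2 + 1))).card : ℝ) < θ
  have hbad : ∑ a ∈ A, ((bad a).card : ℝ) ≤ ((auxS A).card : ℝ) ^ 2 * θ := by
    have e1 : ∑ a ∈ A, (bad a).card = (A.sigma bad).card := (card_sigma _ _).symm
    have e2 : ((A.sigma bad).card : ℝ) ≤ ∑ _r ∈ auxS A ×ˢ auxS A, θ := by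
      have e3 : (A.sigma bad).card = ∑ r ∈ auxS A ×ˢ auxS A, ((A.sigma bad).filter fun v =>
          (v.1 * (v.2.1 + 1), v.1 * (v.2.2 + 1)) = r).card := by
        apply card_eq_sum_card_fiberwise
        rintro ⟨a, y, z⟩ hv
        have hv' := mem_sigma.1 (mem_coe.1 hv)
        have hv2 := mem_product.1 (mem_filter.1 hv'.2).1
        exact mem_coe.2 (mem_product.2 ⟨aux_mem_S hv'.1 (hY hv2.1), aux_mem_S hv'.1 (hZ hv2.2)⟩)
      rw [e3]
      push_cast
      refine sum_le_sum fun r _ => ?_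
      by_cases hne : ((A.sigma bad).filter fun v =>
          (v.1 * (v.2.1 + 1), v.1 * (v.2.2 + 1)) = r).Nonempty
      · obtain ⟨⟨a, y, z⟩, hv⟩ := hne
        obtain ⟨hv1, rfl⟩ := mem_filter.1 hv
        have hv3 := (mem_filter.1 (mem_sigma.1 hv1).2).2
        refine le_trans ?_ hv3.le
        norm_cast
        apply card_le_card_of_injOn (fun v => v.1)
        · rintro ⟨a', y', z'⟩ hv'
          obtain ⟨hv1', h'⟩ := mem_filter.1 (mem_coe.1 hv')
          simp only [Prod.mk.injEq] at h'
          have hv2 := mem_product.1 (mem_filter.1 (mem_sigma.1 hv1').2).1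
          have ha' := (mem_sigma.1 hv1').1
          exact mem_coe.2 (mem_inter.2 ⟨(aux_mem_N h0).2 ⟨ha', y', hY hv2.1, h'.1⟩,
            (aux_mem_N h0).2 ⟨ha', z', hZ hv2.2, h'.2⟩⟩)
        · rintro ⟨a1, y1, z1⟩ hv1 ⟨a2, y2, z2⟩ hv2 h
          obtain ⟨hv1', h1⟩ := mem_filter.1 (mem_coe.1 hv1)
          obtain ⟨hv2', h2⟩ := mem_filter.1 (mem_coe.1 hv2)
          simp only at h
          subst h
          have ha' := n0 _ (mem_sigma.1 hv1').1
          have h3 := h1.trans h2.symm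
          simp only [Prod.mk.injEq, mul_eq_mul_left_iff, ha', or_false, add_left_inj] at h3 ⊢
          simp [h3.1, h3.2]
      · rw [not_nonempty_iff_eq_empty.1 hne]
        simpa using hθpos.le
    calc ∑ a ∈ A, ((bad a).card : ℝ) = ((A.sigma bad).card : ℝ) := by exact_mod_cast e1
      _ ≤ _ := e2
      _ = _ := by rw [sum_const, card_product, nsmul_eq_mul]; push_cast; ring
  obtain ⟨a, ha, hba⟩ : ∃ a ∈ A, ((bad a).card : ℝ) ≤ Y.card * Z.card / 2 := by
    apply exists_le_of_sum_le hA
    refine hbad.trans (le_of_eq ?_)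
    simp [hθ]
    field_simp
  set G : Finset (F × F) := (Y ×ˢ Z).filter fun q =>
    ¬ ((w (a * (q.1 + 1)) (a * (q.2 + 1))).card : ℝ) < θ with hG
  have hGc : (Y.card * Z.card / 2 : ℝ) ≤ G.card := by
    have := card_filter_add_card_filter_not (s := Y ×ˢ Z) (fun q : F × F =>
      ((w (a * (q.1 + 1)) (a * (q.2 + 1))).card : ℝ) < θ)
    have h2 : ((bad a).card : ℝ) + G.card = Y.card * Z.card := by
      rw [card_product] at this
      exact_mod_cast this
    linarith
  set P := G.image fun q => q.1 - q.2 with hP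
  have hPc : (P.card : ℝ) * θ ≤ ((auxU A).card : ℝ) ^ 2 := by
    have := aux_fiber P (auxU A ×ˢ auxU A) (fun t => a⁻¹ * (t.1 - t.2)) θ (by
      intro v hv
      obtain ⟨⟨y, z⟩, hq, rfl⟩ := mem_image.1 hv
      obtain ⟨hq1, hq2⟩ := mem_filter.1 hq
      refine ⟨w (a * (y + 1)) (a * (z + 1)),
        fun x => (a * (y + 1) - x, a * (z + 1) - x), not_lt.1 hq2, ?_, ?_⟩
      · intro x _ x' _ h
        simp only [Prod.mk.injEq] at h
        exact sub_right_injective h.1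
      · intro x hx
        obtain ⟨hx1, hx2⟩ := mem_inter.1 hx
        refine ⟨mem_product.2 ⟨aux_sub_mem_U h0 hx1, aux_sub_mem_U h0 hx2⟩, ?_⟩
        have := n0 a ha
        field_simp
        ring)
    rw [card_product] at this
    push_cast at this
    rw [sq]
    exact this
  have hE := aux_cs G (fun q => q.1 - q.2)
  have hE2 : (((G ×ˢ G).filter fun q => q.1.1 - q.1.2 = q.2.1 - q.2.2).card : ℝ)
      ≤ (auxE Y Z).card := by
    norm_cast
    apply card_le_card
    apply filter_subset_filter
    exact product_subset_product (filter_subset _ _) (filter_subset _ _)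
  have h5 : (Y.card * Z.card / 2 : ℝ) ^ 2 ≤ P.card * (auxE Y Z).card := by
    calc _ ≤ (G.card : ℝ) ^ 2 := by gcongr
      _ ≤ _ := hE
      _ ≤ _ := by gcongr
  have h6 : (Y.card * Z.card / 2 : ℝ) ^ 2 * θ ≤ ((auxU A).card : ℝ) ^ 2 * (auxE Y Z).card := by
    calc _ ≤ (P.card * (auxE Y Z).card) * θ := by gcongr
      _ = (P.card * θ) * (auxE Y Z).card := by ring
      _ ≤ _ := by gcongr
  have h7 : (Y.card : ℝ) ^ 3 * (Z.card : ℝ) ^ 3 * A.card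
      = 8 * ((auxS A).card : ℝ) ^ 2 * ((Y.card * Z.card / 2 : ℝ) ^ 2 * θ) := by
    rw [hθ]; field_simp; ring
  rw [h7]
  calc _ ≤ 8 * ((auxS A).card : ℝ) ^ 2 * (((auxU A).card : ℝ) ^ 2 * (auxE Y Z).card) := by gcongr
    _ = _ := by ring

end

theorem aux_dense {α β : Type*} [DecidableEq α] [DecidableEq β] (X : Finset α) (A : Finset β)
    (R : α → β → Prop) [∀ x b, Decidable (R x b)] (hX : X.Nonempty) (hA : A.Nonempty)
    (h : 100 * ((X ×ˢ A).filter fun q => R q.1 q.2).card ≤ X.card * A.card) :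
    ∃ Y ⊆ X, ∃ Z ⊆ A, 9 * X.card ≤ 10 * Y.card ∧ 9 * A.card ≤ 10 * Z.card ∧
      (∀ c ∈ Y, ∀ d ∈ Y, 7 * A.card ≤ 10 * (Z.filter fun z => ¬ R c z ∧ ¬ R d z).card) ∧
      (∀ a ∈ Z, ∀ b ∈ Z, 7 * X.card ≤ 10 * (Y.filter fun y => ¬ R y a ∧ ¬ R y b).card) := by
  have e1 : ((X ×ˢ A).filter fun q => R q.1 q.2).card
      = ∑ x ∈ X, (A.filter fun b => R x b).card := by
    simp only [card_filter, sum_product]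
  have e2 : ((X ×ˢ A).filter fun q => R q.1 q.2).card
      = ∑ b ∈ A, (X.filter fun x => R x b).card := by
    simp only [card_filter, sum_product_right]
  have hX' := hX.card_pos
  have hA' := hA.card_pos
  set Y := X.filter fun x => 10 * (A.filter fun b => R x b).card ≤ A.card with hY
  set Z := A.filter fun b => 10 * (X.filter fun x => R x b).card ≤ X.card with hZ
  have cY := card_filter_add_card_filter_not (s := X)
    (fun x => 10 * (A.filter fun b => R x b).card ≤ A.card)
  rw [← hY] at cY
  have cZ := card_filter_add_card_filter_not (s := A)
    (fun b => 10 * (X.filter fun x => R x b).card ≤ X.card)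
  rw [← hZ] at cZ
  have bY : 10 * (X.filter fun x => ¬ 10 * (A.filter fun b => R x b).card ≤ A.card).card ≤ X.card := by
    set V := X.filter fun x => ¬ 10 * (A.filter fun b => R x b).card ≤ A.card
    have f1 : V.card * A.card ≤ ∑ x ∈ V, 10 * (A.filter fun b => R x b).card := by
      rw [← smul_eq_mul]
      apply card_nsmul_le_sum
      intro x hx
      exact (not_le.1 (mem_filter.1 hx).2).le
    have f2 : ∑ x ∈ V, 10 * (A.filter fun b => R x b).card
        ≤ ∑ x ∈ X, 10 * (A.filter fun b => R x b).card :=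
      sum_le_sum_of_subset (filter_subset _ _)
    rw [← mul_sum (s := X), ← e1] at f2
    by_contra hcon
    push Not at hcon
    nlinarith
  have bZ : 10 * (A.filter fun b => ¬ 10 * (X.filter fun x => R x b).card ≤ X.card).card ≤ A.card := by
    set V := A.filter fun b => ¬ 10 * (X.filter fun x => R x b).card ≤ X.card
    have f1 : V.card * X.card ≤ ∑ b ∈ V, 10 * (X.filter fun x => R x b).card := by
      rw [← smul_eq_mul]
      apply card_nsmul_le_sum
      intro x hx
      exact (not_le.1 (mem_filter.1 hx).2).le
    have f2 : ∑ b ∈ V, 10 * (X.filter fun x => R x b).card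
        ≤ ∑ b ∈ A, 10 * (X.filter fun x => R x b).card :=
      sum_le_sum_of_subset (filter_subset _ _)
    rw [← mul_sum (s := A), ← e2] at f2
    by_contra hcon
    push Not at hcon
    nlinarith
  refine ⟨Y, filter_subset _ _, Z, filter_subset _ _, by omega, by omega, ?_, ?_⟩
  · intro c hc d hd
    have hc' := (mem_filter.1 hc).2
    have hd' := (mem_filter.1 hd).2
    have hsub : Z ⊆ (Z.filter fun z => ¬ R c z ∧ ¬ R d z) ∪
        ((A.filter fun b => R c b) ∪ (A.filter fun b => R d b)) := by
      intro z hz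
      have hzA : z ∈ A := (mem_filter.1 hz).1
      simp only [mem_union, mem_filter, hz, hzA, true_and]
      tauto
    have h1 := card_le_card hsub
    have h2 := card_union_le (Z.filter fun z => ¬ R c z ∧ ¬ R d z)
      ((A.filter fun b => R c b) ∪ (A.filter fun b => R d b))
    have h3 := card_union_le (A.filter fun b => R c b) (A.filter fun b => R d b)
    omega
  · intro a ha b hb
    have ha' := (mem_filter.1 ha).2
    have hb' := (mem_filter.1 hb).2
    have hsub : Y ⊆ (Y.filter fun y => ¬ R y a ∧ ¬ R y b) ∪
        ((X.filter fun x => R x a) ∪ (X.filter fun x => R x b)) := by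
      intro z hz
      have hzA : z ∈ X := (mem_filter.1 hz).1
      simp only [mem_union, mem_filter, hz, hzA, true_and]
      tauto
    have h1 := card_le_card hsub
    have h2 := card_union_le (Y.filter fun y => ¬ R y a ∧ ¬ R y b)
      ((X.filter fun x => R x a) ∪ (X.filter fun x => R x b))
    have h3 := card_union_le (X.filter fun x => R x a) (X.filter fun x => R x b)
    omega

open scoped Pointwise in
theorem aux_diff {F : Type*} [Field F] [DecidableEq F] {A X : Finset F} (h0 : (0 : F) ∉ A)
    (M θ : ℝ) (hM : 0 < M) (hθ : 0 < θ)
    (hbad : M * (((X ×ˢ X).filter fun q =>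
        (((auxS A).filter fun r => q.1 ∈ auxN A r ∧ q.2 ∈ auxN A r).card : ℝ) < θ).card : ℝ)
          ≤ (X.card : ℝ) ^ 2) (hXn : X.Nonempty) :
    ∃ X' ⊆ X, (X.card : ℝ) ≤ 2 * X'.card ∧
      ((X' - (auxS A).filter fun s => 4 * X.card / M ≤ ((auxN A s ∩ X).card : ℝ)).card : ℝ) *
        (2 * X.card / M * θ) ≤ ((auxU A).card : ℝ) ^ 3 := by
  classical
  have hXpos : (0 : ℝ) < X.card := by exact_mod_cast hXn.card_pos
  set t : F → F → Finset F := fun x x' => (auxS A).filter fun r => x ∈ auxN A r ∧ x' ∈ auxN A r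
    with ht
  set bd : F → Finset F := fun x => X.filter fun x' => ((t x x').card : ℝ) < θ with hbd
  have e1 : ((X ×ˢ X).filter fun q => ((t q.1 q.2).card : ℝ) < θ).card = ∑ x ∈ X, (bd x).card := by
    simp only [hbd, card_filter, sum_product]
  set X' := X.filter fun x => ((bd x).card : ℝ) ≤ 2 * X.card / M with hX'
  refine ⟨X', filter_subset _ _, ?_, ?_⟩
  · have c := card_filter_add_card_filter_not (s := X)
      (fun x => ((bd x).card : ℝ) ≤ 2 * X.card / M)
    rw [← hX'] at c
    set V := X.filter fun x => ¬ ((bd x).card : ℝ) ≤ 2 * X.card / M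
    have f1 : (V.card : ℝ) * (2 * X.card / M) ≤ ∑ x ∈ V, ((bd x).card : ℝ) := by
      rw [← nsmul_eq_mul]
      apply card_nsmul_le_sum
      intro x hx
      exact (not_le.1 (mem_filter.1 hx).2).le
    have f2 : ∑ x ∈ V, ((bd x).card : ℝ) ≤ ∑ x ∈ X, ((bd x).card : ℝ) :=
      sum_le_sum_of_subset_of_nonneg (filter_subset _ _) (fun _ _ _ => by positivity)
    have e1' : (((X ×ˢ X).filter fun q => ((t q.1 q.2).card : ℝ) < θ).card : ℝ)
      = ∑ x ∈ X, ((bd x).card : ℝ) := by exact_mod_cast e1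
    have hb : M * ∑ x ∈ X, ((bd x).card : ℝ) ≤ (X.card : ℝ) ^ 2 := by
      rw [← e1']; exact hbad
    have f3 : M * ((V.card : ℝ) * (2 * X.card / M)) ≤ (X.card : ℝ) ^ 2 :=
      (mul_le_mul_of_nonneg_left (f1.trans f2) hM.le).trans hb
    have f4 : M * ((V.card : ℝ) * (2 * X.card / M)) = (2 * V.card) * X.card := by
      field_simp
    rw [f4, sq] at f3
    have f5 := le_of_mul_le_mul_right f3 hXpos
    have c' : (X'.card : ℝ) + V.card = X.card := by exact_mod_cast c
    linarith
  · set W := (auxS A).filter fun s => 4 * X.card / M ≤ ((auxN A s ∩ X).card : ℝ) with hW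
    have := aux_fiber (α := Σ _ : F, F) (X' - W) (auxU A ×ˢ (auxU A ×ˢ auxU A))
      (fun u => - (u.1 - u.2.1 + u.2.2)) (2 * X.card / M * θ) (by
      intro v hv
      obtain ⟨x, hx, w, hw, rfl⟩ := mem_sub.1 hv
      have hx' := (mem_filter.1 hx).2
      have hw' := (mem_filter.1 hw).2
      let G := (auxN A w ∩ X).filter fun x' => ¬ ((t x x').card : ℝ) < θ
      have hG : 2 * X.card / M ≤ (G.card : ℝ) := by
        have c := card_filter_add_card_filter_not (s := auxN A w ∩ X)
          (fun x' => ((t x x').card : ℝ) < θ)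
        have c2 : ((auxN A w ∩ X).filter fun x' => ((t x x').card : ℝ) < θ).card ≤ (bd x).card := by
          apply card_le_card
          exact filter_subset_filter _ inter_subset_right
        have c' : (((auxN A w ∩ X).filter fun x' => ((t x x').card : ℝ) < θ).card : ℝ) + G.card
          = (auxN A w ∩ X).card := by exact_mod_cast c
        have c2' : (((auxN A w ∩ X).filter fun x' => ((t x x').card : ℝ) < θ).card : ℝ)
          ≤ (bd x).card := by exact_mod_cast c2
        have : 4 * X.card / M = 2 * X.card / M + 2 * X.card / M := by ring
        linarith
      refine ⟨G.sigma (fun x' => t x x'), fun u => (w - u.1, u.2 - u.1, u.2 - x), ?_, ?_, ?_⟩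
      · rw [card_sigma]
        push_cast
        calc 2 * X.card / M * θ ≤ G.card * θ := by gcongr
          _ = G.card • θ := by rw [nsmul_eq_mul]
          _ ≤ _ := by
            apply card_nsmul_le_sum
            intro x' hx'
            exact not_lt.1 (mem_filter.1 hx').2
      · rintro ⟨x1, s1⟩ _ ⟨x2, s2⟩ _ h
        simp only [Prod.mk.injEq] at h
        have h1 : x1 = x2 := sub_right_injective h.1
        have h2 : s1 = s2 := sub_left_injective h.2.2
        rw [h1, h2]
      · rintro ⟨x', s'⟩ hu
        obtain ⟨hu1, hu2⟩ := mem_sigma.1 hu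
        have hu3 := (mem_inter.1 (mem_filter.1 hu1).1).1
        have hu4 := (mem_filter.1 hu2).2
        refine ⟨mem_product.2 ⟨aux_sub_mem_U h0 hu3, mem_product.2 ⟨aux_sub_mem_U h0 hu4.2,
          aux_sub_mem_U h0 hu4.1⟩⟩, ?_⟩
        simp only
        ring)
    rw [card_product, card_product] at this
    push_cast at this
    calc _ ≤ _ := this
      _ = _ := by ring

theorem aux_pivot {p : ℕ} [Fact p.Prime] (Y Z : Finset (ZMod p))
    (P : Finset (ZMod p) → Finset (ZMod p) → Prop)
    (D : ℝ) (hD : ∀ c ∈ Y, ∀ d ∈ Y, c ≠ d → ∀ a ∈ Z, ∀ b ∈ Z, ∃ Y' ⊆ Y, ∃ Z' ⊆ Z, P Y' Z' ∧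
      (((Z' ×ˢ Y').image fun q => q.1 + (a - b) / (c - d) * q.2).card : ℝ) ≤ D)
    (hY : 2 ≤ Y.card) (hZ : Z.Nonempty) (hYZ : Y.card * Z.card ≤ p) :
    ∃ Y' ⊆ Y, ∃ Z' ⊆ Z, P Y' Z' ∧ (((Y'.card : ℝ) * Z'.card) ^ 2 ≤ D * (2 * (Y.card * Z.card)) ∨
      ((auxE Y' Z').card : ℝ) ≤ Y'.card * D) := by
  classical
  by_cases hQ : ∀ ξ : ZMod p, ∃ c ∈ Y, ∃ d ∈ Y, c ≠ d ∧ ∃ a ∈ Z, ∃ b ∈ Z, (a - b) / (c - d) = ξ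
  · set T := Z ×ˢ Y with hT
    set E : ZMod p → Finset ((ZMod p × ZMod p) × (ZMod p × ZMod p)) := fun ξ =>
      (T ×ˢ T).filter fun q => q.1.1 + ξ * q.1.2 = q.2.1 + ξ * q.2.2 with hE
    have hTc : (T.card : ℝ) = Y.card * Z.card := by
      rw [hT, card_product]; push_cast; ring
    have hTp : (T.card : ℝ) ≤ p := by rw [hTc]; exact_mod_cast hYZ
    have hsum : ∑ ξ : ZMod p, (E ξ).card ≤ p * T.card + T.card * T.card := by
      have e1 : ∑ ξ : ZMod p, (E ξ).card = ∑ q ∈ T ×ˢ T,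
          ((univ : Finset (ZMod p)).filter fun ξ => q.1.1 + ξ * q.1.2 = q.2.1 + ξ * q.2.2).card := by
        simp only [hE, card_filter]
        exact sum_comm
      rw [e1]
      have e2 : ∀ q ∈ T ×ˢ T,
          ((univ : Finset (ZMod p)).filter fun ξ => q.1.1 + ξ * q.1.2 = q.2.1 + ξ * q.2.2).card
          ≤ (if q.1 = q.2 then p else 0) + 1 := by
        rintro ⟨⟨z, y⟩, ⟨z', y'⟩⟩ _
        split_ifs with h
        · refine (card_filter_le _ _).trans ?_
          rw [card_univ, ZMod.card]
          omega
        · rw [zero_add, card_le_one]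
          intro ξ h1 ξ' h2
          simp only [mem_filter, mem_univ, true_and] at h1 h2
          by_contra hne
          apply h
          have h3 : (ξ - ξ') * (y - y') = 0 := by linear_combination h1 - h2
          have h4 : y = y' := by
            rcases mul_eq_zero.1 h3 with h5 | h5
            · exact absurd (sub_eq_zero.1 h5) hne
            · exact sub_eq_zero.1 h5
          subst h4
          simp only [add_left_inj] at h1
          rw [h1]
      refine (sum_le_sum e2).trans ?_
      rw [sum_add_distrib, sum_const, smul_eq_mul, mul_one, card_product, ← sum_filter, sum_const,
        smul_eq_mul]
      have e3 : ((T ×ˢ T).filter fun q => q.1 = q.2).card ≤ T.card := by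
        apply card_le_card_of_injOn (fun q => q.1)
        · intro q hq
          exact mem_coe.2 (mem_product.1 (mem_filter.1 (mem_coe.1 hq)).1).1
        · rintro ⟨a, b⟩ hq ⟨a', b'⟩ hq' h
          have h1 := (mem_filter.1 (mem_coe.1 hq)).2
          have h2 := (mem_filter.1 (mem_coe.1 hq')).2
          simp only at h h1 h2
          rw [← h1, ← h2, h]
      nlinarith
    obtain ⟨ξ, -, hξ⟩ : ∃ ξ ∈ (univ : Finset (ZMod p)), ((E ξ).card : ℝ) ≤ 2 * T.card := by
      apply exists_le_of_sum_le univ_nonempty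
      rw [sum_const, card_univ, ZMod.card, nsmul_eq_mul]
      have h1 : (∑ ξ : ZMod p, ((E ξ).card : ℝ)) ≤ p * T.card + T.card * T.card := by
        exact_mod_cast hsum
      have : (T.card : ℝ) * T.card ≤ p * T.card := by gcongr
      linarith
    obtain ⟨c, hc, d, hd, hcd, a, ha, b, hb, rfl⟩ := hQ ξ
    obtain ⟨Y', hY', Z', hZ', hP, hle⟩ := hD c hc d hd hcd a ha b hb
    refine ⟨Y', hY', Z', hZ', hP, Or.inl ?_⟩
    have hcs := aux_cs (Z' ×ˢ Y') (fun q => q.1 + (a - b) / (c - d) * q.2)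
    have h2 : (((Z' ×ˢ Y') ×ˢ (Z' ×ˢ Y')).filter fun q =>
        q.1.1 + (a - b) / (c - d) * q.1.2 = q.2.1 + (a - b) / (c - d) * q.2.2).card
        ≤ (E ((a - b) / (c - d))).card := by
      apply card_le_card
      apply filter_subset_filter
      exact product_subset_product (product_subset_product hZ' hY') (product_subset_product hZ' hY')
    have h2' : ((((Z' ×ˢ Y') ×ˢ (Z' ×ˢ Y')).filter fun q =>
        q.1.1 + (a - b) / (c - d) * q.1.2 = q.2.1 + (a - b) / (c - d) * q.2.2).card : ℝ)
        ≤ 2 * (Y.card * Z.card) := by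
      rw [← hTc]
      refine le_trans ?_ hξ
      exact_mod_cast h2
    have hD0 : 0 ≤ D := le_trans (by positivity) hle
    calc ((Y'.card : ℝ) * Z'.card) ^ 2 = ((Z' ×ˢ Y').card : ℝ) ^ 2 := by
          rw [card_product]; push_cast; ring
      _ ≤ _ := hcs
      _ ≤ _ := by gcongr
  · set Q : Set (ZMod p) := {ξ | ∃ c ∈ Y, ∃ d ∈ Y, c ≠ d ∧ ∃ a ∈ Z, ∃ b ∈ Z,
      (a - b) / (c - d) = ξ} with hQdef
    obtain ⟨r, hr, hr1⟩ : ∃ r ∈ Q, r + 1 ∉ Q := by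
      by_contra hcon
      push Not at hcon
      apply hQ
      have h0 : (0 : ZMod p) ∈ Q := by
        obtain ⟨c, hc, d, hd, hcd⟩ := one_lt_card.1 hY
        obtain ⟨a, ha⟩ := hZ
        exact ⟨c, hc, d, hd, hcd, a, ha, a, ha, by simp⟩
      have hn : ∀ n : ℕ, ((n : ZMod p)) ∈ Q := by
        intro n
        induction n with
        | zero => simpa using h0
        | succ k ih => simpa using hcon _ ih
      intro ξ
      have := hn ξ.val
      rw [ZMod.natCast_zmod_val] at this
      exact this
    obtain ⟨c, hc, d, hd, hcd, a, ha, b, hb, rfl⟩ := hr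
    obtain ⟨Y', hY', Z', hZ', hP, hle⟩ := hD c hc d hd hcd a ha b hb
    refine ⟨Y', hY', Z', hZ', hP, Or.inr ?_⟩
    set r := (a - b) / (c - d) with hr
    have hinj : ∀ y ∈ Y, ∀ y' ∈ Y, ∀ z ∈ Z, ∀ z' ∈ Z,
        z + (r + 1) * y = z' + (r + 1) * y' → y = y' ∧ z = z' := by
      intro y hy y' hy' z hz z' hz' h
      by_cases hyy : y = y'
      · subst hyy
        exact ⟨rfl, add_right_cancel h⟩
      · exfalso
        apply hr1
        refine ⟨y, hy, y', hy', hyy, z', hz', z, hz, ?_⟩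
        rw [div_eq_iff (sub_ne_zero.2 hyy)]
        linear_combination -h
    have hc : (auxE Y' Z').card ≤ (Y' ×ˢ ((Z' ×ˢ Y').image fun q => q.1 + r * q.2)).card := by
      -- a quadruple is `((y, z), (y₁, z₁))` with `y - z = y₁ - z₁`
      apply card_le_card_of_injOn (fun q => (q.1.1, q.2.2 + r * q.2.1))
      · rintro ⟨⟨y, z⟩, ⟨y1, z1⟩⟩ hq
        simp only [auxE, coe_filter, mem_product, Set.mem_ofPred_eq] at hq
        exact mem_coe.2 (mem_product.2 ⟨hq.1.1.1, mem_image.2 ⟨(z1, y1),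
          mem_product.2 ⟨hq.1.2.2, hq.1.2.1⟩, rfl⟩⟩)
      · rintro ⟨⟨y, z⟩, ⟨y1, z1⟩⟩ hq ⟨⟨y', z'⟩, ⟨y1', z1'⟩⟩ hq' h
        simp only [auxE, coe_filter, mem_product, Set.mem_ofPred_eq] at hq hq'
        simp only [Prod.mk.injEq] at h
        obtain ⟨h1, h2⟩ := h
        subst h1
        obtain ⟨h3, h4⟩ := hinj y1 (hY' hq.1.2.1) y1' (hY' hq'.1.2.1) z (hZ' hq.1.1.2) z'
          (hZ' hq'.1.1.2) (by linear_combination h2 - hq.2 + hq'.2)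
        subst h3 h4
        have h5 : z1 = z1' := add_right_cancel h2
        rw [h5]
    rw [card_product] at hc
    calc ((auxE Y' Z').card : ℝ) ≤ Y'.card * (((Z' ×ˢ Y').image fun q => q.1 + r * q.2).card : ℝ) := by
          exact_mod_cast hc
      _ ≤ _ := by gcongr

theorem aux_arith (n s u x x' D V : ℝ) (hn : 0 < n) (hs : 0 < s) (hu : 0 ≤ u) (hx : 0 < x)
    (hx' : 0 ≤ x') (hD : 0 ≤ D) (hV : 0 ≤ V) (ha : n ^ 4 ≤ 2 * s ^ 2 * x ^ 2) (hb : x ≤ 2 * x')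
    (hc : V * x * n ^ 4 ≤ 160000 * s ^ 3 * u ^ 3) (hd : D * x' ^ 3 ≤ V ^ 4) (he : u * n ≤ s ^ 2)
    (hf : x ^ 2 * n ^ 6 ≤ 48 * s ^ 6 * D) :
    n ^ 52 ≤ 2 ^ 5 * (384 * 160000 ^ 4) * s ^ 51 := by
  have h1 : x ^ 5 * n ^ 6 ≤ 384 * s ^ 6 * V ^ 4 := by
    calc x ^ 5 * n ^ 6 = (x ^ 2 * n ^ 6) * x ^ 3 := by ring
      _ ≤ (48 * s ^ 6 * D) * (2 * x') ^ 3 := by gcongr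
      _ = 384 * s ^ 6 * (D * x' ^ 3) := by ring
      _ ≤ _ := by gcongr
  have h2 : V * x * n ^ 7 ≤ 160000 * s ^ 9 := by
    calc V * x * n ^ 7 = (V * x * n ^ 4) * n ^ 3 := by ring
      _ ≤ (160000 * s ^ 3 * u ^ 3) * n ^ 3 := by gcongr
      _ = 160000 * s ^ 3 * (u * n) ^ 3 := by ring
      _ ≤ 160000 * s ^ 3 * (s ^ 2) ^ 3 := by gcongr
      _ = _ := by ring
  have h3 : x ^ 9 * n ^ 34 ≤ 384 * 160000 ^ 4 * s ^ 42 := by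
    calc x ^ 9 * n ^ 34 = (x ^ 5 * n ^ 6) * (x ^ 4 * n ^ 28) := by ring
      _ ≤ (384 * s ^ 6 * V ^ 4) * (x ^ 4 * n ^ 28) := by gcongr
      _ = 384 * s ^ 6 * (V * x * n ^ 7) ^ 4 := by ring
      _ ≤ 384 * s ^ 6 * (160000 * s ^ 9) ^ 4 := by gcongr
      _ = _ := by ring
  have h4 : (n ^ 52) ^ 2 ≤ (2 ^ 5 * (384 * 160000 ^ 4) * s ^ 51) ^ 2 := by
    calc (n ^ 52) ^ 2 = (n ^ 4) ^ 9 * n ^ 68 := by ring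
      _ ≤ (2 * s ^ 2 * x ^ 2) ^ 9 * n ^ 68 := by gcongr
      _ = 2 ^ 9 * s ^ 18 * (x ^ 9 * n ^ 34) ^ 2 := by ring
      _ ≤ 2 ^ 9 * s ^ 18 * (384 * 160000 ^ 4 * s ^ 42) ^ 2 := by gcongr
      _ ≤ 2 ^ 10 * s ^ 18 * (384 * 160000 ^ 4 * s ^ 42) ^ 2 := by gcongr <;> norm_num
      _ = _ := by ring
  exact (pow_le_pow_iff_left₀ (by positivity) (by positivity) (by norm_num)).1 h4

theorem aux_arith2 (n s x y' z' y z D : ℝ) (hn : 0 < n) (hns : n ≤ s) (hx : 0 < x) (hxn : x ≤ n)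
    (hD : 0 ≤ D) (h1 : 7 * x ≤ 10 * y') (h2 : 7 * n ≤ 10 * z') (hy : 0 ≤ y) (hz : 0 ≤ z)
    (b1 : y ≤ x) (b2 : z ≤ n) (hor : (y' * z') ^ 2 ≤ D * (2 * (y * z))) :
    x ^ 2 * n ^ 6 ≤ 48 * s ^ 6 * D := by
  have b3 : (7 * x * (7 * n)) ^ 2 ≤ (10 * y' * (10 * z')) ^ 2 := by
    gcongr
    linarith
  have b4 : D * (2 * (y * z)) ≤ D * (2 * (x * n)) := by gcongr
  have b5 : (x * n) * (x * n) ≤ (10 * D) * (x * n) := by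
    have : 0 ≤ D * (x * n) := by positivity
    nlinarith
  have b6 := le_of_mul_le_mul_right b5 (by positivity)
  calc x ^ 2 * n ^ 6 = (x * n) * (x * n ^ 5) := by ring
    _ ≤ (10 * D) * (n * n ^ 5) := by gcongr
    _ = 10 * n ^ 6 * D := by ring
    _ ≤ 48 * s ^ 6 * D := by gcongr; norm_num

theorem aux_arith3 (n s u x y' z' E D : ℝ) (hn : 0 < n) (hs : 0 < s) (hu : 0 ≤ u) (hx : 0 < x)
    (hD : 0 ≤ D) (h1 : 7 * x ≤ 10 * y') (h2 : 7 * n ≤ 10 * z') (hplu : u * n ≤ s ^ 2)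
    (he : y' ^ 3 * z' ^ 3 * n ≤ 8 * s ^ 2 * u ^ 2 * E) (hor : E ≤ y' * D) :
    x ^ 2 * n ^ 6 ≤ 48 * s ^ 6 * D := by
  have hy' : 0 < y' := by linarith
  have hz' : 0 < z' := by linarith
  have c1 : (y' ^ 2 * z' ^ 3 * n) * y' ≤ (8 * s ^ 2 * u ^ 2 * D) * y' := by
    calc _ = y' ^ 3 * z' ^ 3 * n := by ring
      _ ≤ _ := he
      _ ≤ 8 * s ^ 2 * u ^ 2 * (y' * D) := by gcongr
      _ = _ := by ring
  have c2 := le_of_mul_le_mul_right c1 hy'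
  have c3 : (7 * x) ^ 2 * (7 * n) ^ 3 * n ^ 3 ≤ (10 * y') ^ 2 * (10 * z') ^ 3 * n ^ 3 := by gcongr
  have c4 : (10 * y') ^ 2 * (10 * z') ^ 3 * n ^ 3 ≤ 800000 * s ^ 6 * D := by
    calc _ = 100000 * (y' ^ 2 * z' ^ 3 * n) * n ^ 2 := by ring
      _ ≤ 100000 * (8 * s ^ 2 * u ^ 2 * D) * n ^ 2 := by gcongr
      _ = 800000 * s ^ 2 * (u * n) ^ 2 * D := by ring
      _ ≤ 800000 * s ^ 2 * (s ^ 2) ^ 2 * D := by gcongr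
      _ = _ := by ring
  have c5 : 0 ≤ s ^ 6 * D := by positivity
  nlinarith

set_option maxHeartbeats 1000000 in
open scoped Pointwise in
theorem aux_main {p : ℕ} [Fact p.Prime] (A : Finset (ZMod p)) (hA : A.Nonempty)
    (h0 : (0 : ZMod p) ∉ A) (h1 : (-1 : ZMod p) ∉ A) (hp : A.card ^ 2 < p) :
    (A.card : ℝ) ^ 52 ≤ 2 ^ 5 * (384 * 160000 ^ 4) * ((auxS A).card : ℝ) ^ 51 := by
  classical
  have n0 : ∀ x ∈ A, x ≠ 0 := fun x hx h => h0 (h ▸ hx)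
  have hSn : (auxS A).Nonempty := by
    obtain ⟨a, ha⟩ := hA
    exact ⟨_, aux_mem_S ha ha⟩
  have hn : (0 : ℝ) < A.card := by exact_mod_cast hA.card_pos
  have hs : (0 : ℝ) < (auxS A).card := by exact_mod_cast hSn.card_pos
  have hs1 : (1 : ℝ) ≤ (auxS A).card := by exact_mod_cast hSn.card_pos
  have hNsum : ∑ s ∈ auxS A, (auxN A s).card = A.card ^ 2 := by
    have := aux_N_sum h0 A (Subset.refl _)
    rw [sq, ← this]
    refine sum_congr rfl fun s _ => ?_
    rw [inter_eq_left.2 (aux_N_sub A s)]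
  have hns : (A.card : ℝ) ≤ (auxS A).card := by
    have h : A.card ^ 2 ≤ (auxS A).card * A.card := by
      rw [← hNsum, ← smul_eq_mul]
      exact sum_le_card_nsmul _ _ _ (fun s _ => card_le_card (aux_N_sub A s))
    rw [sq] at h
    exact_mod_cast Nat.le_of_mul_le_mul_right h hA.card_pos
  set n : ℝ := (A.card : ℝ) with hndef
  set S : ℝ := ((auxS A).card : ℝ) with hSdef
  set M : ℝ := 400 * S / n with hM
  set θ : ℝ := n ^ 3 / (800 * S ^ 2) with hθ
  have hMpos : 0 < M := by positivity
  have hθpos : 0 < θ := by positivity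
  obtain ⟨s0, hs0, hX1, hX2⟩ := aux_bsg A (auxS A) (auxN A) (aux_N_sub A) hSn hNsum M θ
    hMpos.le hθpos.le (le_of_eq (by
      rw [← hndef, ← hSdef, hM, hθ]
      field_simp
      ring))
  set X := auxN A s0 with hX
  have hXA : X ⊆ A := aux_N_sub A s0
  have hXn : X.Nonempty := by
    rw [nonempty_iff_ne_empty]
    intro h
    rw [h] at hX1
    have : 0 < n ^ 4 := by positivity
    simp at hX1
    linarith
  have hx : (0 : ℝ) < X.card := by exact_mod_cast hXn.card_pos
  have hxn : (X.card : ℝ) ≤ n := by rw [hndef]; exact_mod_cast card_le_card hXA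
  obtain ⟨X', hX'X, hX'1, hX'2⟩ := aux_diff h0 M θ hMpos hθpos hX2 hXn
  set W := (auxS A).filter fun s => 4 * X.card / M ≤ ((auxN A s ∩ X).card : ℝ) with hW
  have hX'n : X'.Nonempty := by
    rw [nonempty_iff_ne_empty]
    rintro rfl
    simp at hX'1
    rw [hX'1] at hXn
    simp at hXn
  have h2W := aux_2W W X' hX'n
  have hplu := aux_plu h0 h1 hA
  have hedge : 100 * ((X ×ˢ A).filter fun q => q.1 * (q.2 + 1) ∉ W).card ≤ X.card * A.card := by
    have e3 : ((X ×ˢ A).filter fun q => q.1 * (q.2 + 1) ∉ W).card = ∑ s ∈ auxS A,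
        (((X ×ˢ A).filter fun q => q.1 * (q.2 + 1) ∉ W).filter fun q => q.1 * (q.2 + 1) = s).card := by
      apply card_eq_sum_card_fiberwise
      intro q hq
      have := mem_product.1 (mem_filter.1 (mem_coe.1 hq)).1
      exact mem_coe.2 (aux_mem_S (hXA this.1) this.2)
    have e4 : (((X ×ˢ A).filter fun q => q.1 * (q.2 + 1) ∉ W).card : ℝ) ≤ S * (4 * X.card / M) := by
      rw [e3]
      push_cast
      rw [hSdef, ← nsmul_eq_mul]
      apply sum_le_card_nsmul
      intro s hs
      by_cases hsW : s ∈ W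
      · have : (((X ×ˢ A).filter fun q => q.1 * (q.2 + 1) ∉ W).filter
            fun q => q.1 * (q.2 + 1) = s) = ∅ := by
          apply filter_eq_empty_iff.2
          intro q hq h
          exact (mem_filter.1 hq).2 (h ▸ hsW)
        rw [this]
        simp only [card_empty, Nat.cast_zero]
        positivity
      · have h2 : ((auxN A s ∩ X).card : ℝ) < 4 * X.card / M := by
          by_contra h
          exact hsW (mem_filter.2 ⟨hs, not_lt.1 h⟩)
        refine le_trans ?_ h2.le
        norm_cast
        apply card_le_card_of_injOn (fun q => q.1)
        · intro q hq
          obtain ⟨hq1, hq2⟩ := mem_filter.1 (mem_coe.1 hq)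
          have hq3 := mem_product.1 (mem_filter.1 hq1).1
          exact mem_coe.2 (mem_inter.2 ⟨(aux_mem_N h0).2 ⟨hXA hq3.1, q.2, hq3.2, hq2⟩, hq3.1⟩)
        · rintro ⟨x, b⟩ hq ⟨x', b'⟩ hq' h
          obtain ⟨hq1, hq2⟩ := mem_filter.1 (mem_coe.1 hq)
          obtain ⟨-, hq2'⟩ := mem_filter.1 (mem_coe.1 hq')
          have hq3 := mem_product.1 (mem_filter.1 hq1).1
          simp only at h hq2 hq2' hq3
          subst h
          have := mul_left_cancel₀ (n0 x (hXA hq3.1)) (hq2.trans hq2'.symm)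
          rw [add_right_cancel this]
    have e5 : 100 * (S * (4 * X.card / M)) = X.card * n := by
      rw [hM]; field_simp; ring
    have e6 : 100 * (((X ×ˢ A).filter fun q => q.1 * (q.2 + 1) ∉ W).card : ℝ) ≤ X.card * n := by
      rw [← e5]; gcongr
    rw [hndef] at e6
    exact_mod_cast e6
  obtain ⟨Y, hYX, Z, hZA, hY9, hZ9, hYY, hZZ⟩ :=
    aux_dense X A (fun x b => x * (b + 1) ∉ W) hXn hA hedge
  rcases Nat.lt_or_ge Y.card 2 with hY2 | hY2
  · have hX1' : X.card = 1 := by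
      have := hXn.card_pos
      omega
    rw [hX1', ← hndef, ← hSdef] at hX1
    simp only [Nat.cast_one, one_pow, mul_one] at hX1
    calc n ^ 52 = (n ^ 4) ^ 13 := by ring
      _ ≤ (2 * S ^ 2) ^ 13 := by gcongr
      _ = 2 ^ 13 * S ^ 26 := by ring
      _ ≤ 2 ^ 13 * S ^ 51 := by
        gcongr 2 ^ 13 * ?_
        exact pow_le_pow_right₀ hs1 (by norm_num)
      _ ≤ _ := by gcongr; norm_num
  have hZn : Z.Nonempty := by
    rw [← card_pos]
    have := hA.card_pos
    omega
  have hYZp : Y.card * Z.card ≤ p := by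
    have a1 := card_le_card (hYX.trans hXA)
    have a2 := card_le_card hZA
    nlinarith
  set D : ℝ := ((2 • W - 2 • W).card : ℝ) with hDdef
  have hDpos : 0 ≤ D := by positivity
  obtain ⟨Y', hY', Z', hZ', ⟨hP1, hP2⟩, hor⟩ := aux_pivot Y Z
    (fun Y' Z' => 7 * X.card ≤ 10 * Y'.card ∧ 7 * A.card ≤ 10 * Z'.card) D (by
      intro c hc d hd hcd a ha b hb
      refine ⟨_, filter_subset _ _, _, filter_subset _ _, ⟨hZZ a ha b hb, hYY c hc d hd⟩, ?_⟩
      rw [hDdef]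
      norm_cast
      have hcd' := sub_ne_zero.2 hcd
      apply card_le_card_of_injOn (fun v => (c - d) * v + (c - d))
      · intro v hv
        obtain ⟨⟨z, y⟩, hq, rfl⟩ := mem_image.1 (mem_coe.1 hv)
        obtain ⟨hz, hy⟩ := mem_product.1 hq
        obtain ⟨-, hz1, hz2⟩ := mem_filter.1 hz
        obtain ⟨-, hy1, hy2⟩ := mem_filter.1 hy
        rw [not_not] at hz1 hz2 hy1 hy2
        rw [mem_coe, two_nsmul]
        refine mem_sub.2 ⟨_, add_mem_add hz1 hy1, _, add_mem_add hz2 hy2, ?_⟩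
        simp only
        field_simp
        ring
      · intro v _ v' _ h
        exact mul_left_cancel₀ hcd' (add_right_cancel h)) hY2 hZn hYZp
  have hP1' : 7 * (X.card : ℝ) ≤ 10 * Y'.card := by exact_mod_cast hP1
  have hP2' : 7 * n ≤ 10 * Z'.card := by rw [hndef]; exact_mod_cast hP2
  have hy'pos : (0 : ℝ) < Y'.card := by linarith
  have hz'pos : (0 : ℝ) < Z'.card := by linarith
  have hf : (X.card : ℝ) ^ 2 * n ^ 6 ≤ 48 * S ^ 6 * D := by
    rcases hor with hor | hor
    · have b1 : (Y.card : ℝ) ≤ X.card := by exact_mod_cast card_le_card hYX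
      have b2 : (Z.card : ℝ) ≤ n := by rw [hndef]; exact_mod_cast card_le_card hZA
      exact aux_arith2 n S X.card Y'.card Z'.card Y.card Z.card D hn hns hx hxn hDpos hP1' hP2'
        (by positivity) (by positivity) b1 b2 hor
    · have he := aux_energy h0 hA ((hY'.trans hYX).trans hXA) (hZ'.trans hZA)
        (card_pos.1 (by exact_mod_cast hy'pos)) (card_pos.1 (by exact_mod_cast hz'pos))
      rw [← hndef, ← hSdef] at he
      exact aux_arith3 n S ((auxU A).card) X.card Y'.card Z'.card (auxE Y' Z').card D hn hs
        (by positivity) hx hDpos hP1' hP2' hplu he hor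
  refine aux_arith n S ((auxU A).card) X.card X'.card D ((X' - W).card) hn hs (by positivity) hx
    (by positivity) hDpos (by positivity) hX1 hX'1 ?_ h2W hplu hf
  have e7 : ((X' - W).card : ℝ) * X.card * n ^ 4 =
      160000 * S ^ 3 * (((X' - W).card : ℝ) * (2 * X.card / M * θ)) := by
    rw [hM, hθ]; field_simp; ring
  rw [e7]
  gcongr

theorem stmt2 :
    ∀ ε : ℝ, 0 < ε → ∃ c : ℝ, 0 < c ∧
      ∀ p : ℕ, p.Prime → ∀ A : Finset (ZMod p), A.Nonempty → A.card ^ 2 < p →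
        c * (A.card : ℝ) ^ ((1 : ℝ) + 1 / 53 - ε) ≤
          ((((A ×ˢ A).image fun x => x.1 + x.1 * x.2).card : ℕ) : ℝ) := by
  intro ε hε
  set C : ℝ := 2 ^ 5 * (384 * 160000 ^ 4) with hC
  have hCpos : 0 < C := by positivity
  refine ⟨1 / (3 ^ 52 * C), by positivity, ?_⟩
  intro p hp A hA hAp
  have : Fact p.Prime := ⟨hp⟩
  change _ ≤ ((auxS A).card : ℝ)
  have hn1 : (1 : ℝ) ≤ A.card := by exact_mod_cast hA.card_pos
  have hs1 : (1 : ℝ) ≤ (auxS A).card := by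
    obtain ⟨a, ha⟩ := hA
    exact_mod_cast card_pos.2 ⟨_, aux_mem_S ha ha⟩
  have key : (A.card : ℝ) ^ 52 ≤ 3 ^ 52 * C * ((auxS A).card : ℝ) ^ 51 := by
    rcases Nat.lt_or_ge A.card 3 with h3 | h3
    · have h3' : (A.card : ℝ) ≤ 3 := by exact_mod_cast h3.le
      calc (A.card : ℝ) ^ 52 ≤ 3 ^ 52 := by gcongr
        _ = 3 ^ 52 * 1 * 1 := by ring
        _ ≤ _ := by
          gcongr
          · rw [hC]; norm_num
          · exact one_le_pow₀ hs1
    · set B := (A.erase 0).erase (-1) with hB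
      have hBA : B ⊆ A := (erase_subset _ _).trans (erase_subset _ _)
      have hc : A.card ≤ B.card + 2 := by
        have g1 := pred_card_le_card_erase (s := A) (a := (0 : ZMod p))
        have g2 := pred_card_le_card_erase (s := A.erase 0) (a := (-1 : ZMod p))
        rw [← hB] at g2
        omega
      have hBn : B.Nonempty := by
        rw [← card_pos]; omega
      have hm := aux_main B hBn (by simp [hB]) (by simp [hB])
        (lt_of_le_of_lt (Nat.pow_le_pow_left (card_le_card hBA) 2) hAp)
      have hSS : ((auxS B).card : ℝ) ≤ (auxS A).card := by
        exact_mod_cast card_le_card (image_subset_image (product_subset_product hBA hBA))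
      have hAB : (A.card : ℝ) ≤ 3 * B.card := by
        have : A.card ≤ 3 * B.card := by omega
        exact_mod_cast this
      calc (A.card : ℝ) ^ 52 ≤ (3 * B.card) ^ 52 := by gcongr
        _ = 3 ^ 52 * (B.card : ℝ) ^ 52 := by ring
        _ ≤ 3 ^ 52 * (C * ((auxS B).card : ℝ) ^ 51) := by gcongr
        _ ≤ 3 ^ 52 * (C * ((auxS A).card : ℝ) ^ 51) := by gcongr
        _ = _ := by ring
  set n : ℝ := (A.card : ℝ) with hn
  set s : ℝ := ((auxS A).card : ℝ) with hs
  have hnpos : 0 < n := by linarith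
  have hspos : 0 < s := by linarith
  set K : ℝ := 3 ^ 52 * C with hK
  have hK1 : 1 ≤ K := by rw [hK, hC]; norm_num
  have k1 : n ^ ((1 : ℝ) + 1 / 53 - ε) ≤ n ^ ((52 : ℝ) / 51) := by
    apply Real.rpow_le_rpow_of_exponent_le hn1
    have : (1 : ℝ) + 1 / 53 ≤ 52 / 51 := by norm_num
    linarith
  have k2 : n ^ ((52 : ℝ) / 51) ≤ K * s := by
    have hK2 : n ^ 52 ≤ (K * s) ^ 51 := by
      refine key.trans ?_
      rw [mul_pow]
      gcongr
      exact le_self_pow₀ hK1 (by norm_num)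
    have e1 : n ^ ((52 : ℝ) / 51) = (n ^ 52) ^ ((1 : ℝ) / 51) := by
      rw [← Real.rpow_natCast, ← Real.rpow_mul hnpos.le]
      norm_num
    have e2 : ((K * s) ^ 51) ^ ((1 : ℝ) / 51) = K * s := by
      rw [← Real.rpow_natCast, ← Real.rpow_mul (by positivity)]
      norm_num
    rw [e1, ← e2]
    exact Real.rpow_le_rpow (by positivity) hK2 (by norm_num)
  rw [one_div, inv_mul_le_iff₀ (by positivity)]
  exact k1.trans k2
end
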